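/- End compactification of a complementary component: let ℱ be a nonempty finite family of pairwise disjoint topological lines in ℝ², and let U be a connected component of the complement in ℝ² of the union of the elements of ℱ. Then there exist a finite subset E of the boundary circle of the closed unit disk 𝔻² and a homeomorphism from 𝔻² ∖ E onto the closure of U in ℝ². -/

import Mathlib

open Set

/-- The plane. -/
abbrev Plane : Type := ℝ × ℝ

/-- `f` is (the underlying function of) a homeomorphism of the plane. -/
def IsHomeoFun (f : Plane → Plane) : Prop :=
  ∃ e : Plane ≃ₜ Plane, ∀ x, e x = f x

/-- `g` and `g'` are isotopic relative to `O` : there is a continuous family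
`F (t, ·)`, `t ∈ [0,1]`, of homeomorphisms of the plane going from `g` to `g'`
and agreeing with `g` on `O` for all times. -/
def IsotopicRel (g g' : Plane → Plane) (O : Set Plane) : Prop :=
  ∃ F : ℝ × Plane → Plane, Continuous F ∧
    (∀ t ∈ Icc (0:ℝ) 1, IsHomeoFun fun x => F (t, x)) ∧
    (∀ x, F (0, x) = g x) ∧
    (∀ x, F (1, x) = g' x) ∧
    (∀ t ∈ Icc (0:ℝ) 1, ∀ x ∈ O, F (t, x) = g x)

/-- A homeomorphism of the plane is orientation preserving iff it is isotopic
to the identity. -/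
def OrientationPreserving (h : Plane ≃ₜ Plane) : Prop :=
  IsotopicRel id (⇑h) (∅ : Set Plane)

/-- A Brouwer homeomorphism: orientation preserving and fixed point free. -/
def IsBrouwer (h : Plane ≃ₜ Plane) : Prop :=
  OrientationPreserving h ∧ ∀ x, h x ≠ x

/-- The orbit of a point under a homeomorphism. -/
def horbit (h : Plane ≃ₜ Plane) (x : Plane) : Set Plane :=
  {y | ∃ n : ℤ, y = (h.toEquiv ^ n) x}

/-- `ℤ₁ = ℤ × {1}`. -/
def Z1 : Set Plane := {p | ∃ n : ℤ, p = ((n : ℝ), 1)}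

/-- `ℤ₂ = ℤ × {2}`. -/
def Z2 : Set Plane := {p | ∃ n : ℤ, p = ((n : ℝ), 2)}

/-- The shear homeomorphism `(x, y) ↦ (x + f y, y)`. -/
def shear (f : ℝ → ℝ) (hf : Continuous f) : Plane ≃ₜ Plane where
  toFun p := (p.1 + f p.2, p.2)
  invFun p := (p.1 - f p.2, p.2)
  left_inv p := by simp
  right_inv p := by simp
  continuous_toFun := (continuous_fst.add (hf.comp continuous_snd)).prodMk continuous_snd
  continuous_invFun := (continuous_fst.sub (hf.comp continuous_snd)).prodMk continuous_snd

/-- The translation `T (x, y) = (x + 1, y)`. -/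
def T : Plane ≃ₜ Plane := shear (fun _ => 1) continuous_const

/-- The twist `T₁ (x, y) = (x + 2 - y, y)`. -/
def T₁ : Plane ≃ₜ Plane := shear (fun y => 2 - y) (by continuity)

/-- The twist `T₂ (x, y) = (x + y - 1, y)`. -/
def T₂ : Plane ≃ₜ Plane := shear (fun y => y - 1) (by continuity)

/-- The model Reeb homeomorphism `R₀ = T₁ ∘ T₂⁻¹`, `R₀ (x, y) = (x + 3 - 2y, y)`. -/
def R₀ : Plane ≃ₜ Plane := shear (fun y => 3 - 2 * y) (by continuity)

/-- The Euclidean norm on the plane. -/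
noncomputable def planeNorm (p : Plane) : ℝ := Real.sqrt (p.1 ^ 2 + p.2 ^ 2)

/-- An angle function for a fixed point free map `h'` along a curve `γ`. -/
def IsAngleFunction (h' : Plane → Plane) (γ : ℝ → Plane) (θ : ℝ → ℝ) : Prop :=
  ContinuousOn θ (Icc 0 1) ∧
    ∀ t ∈ Icc (0:ℝ) 1,
      h' (γ t) - γ t =
        planeNorm (h' (γ t) - γ t) • (Real.cos (θ t), Real.sin (θ t))

/-- The conjugate `Φ ∘ h ∘ Φ⁻¹`. -/
def conjH (Φ h : Plane ≃ₜ Plane) : Plane ≃ₜ Plane := Φ.symm.trans (h.trans Φ)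

/-- An admissible straightening `Φ` for `(h, O₁, O₂)` : an orientation preserving
homeomorphism sending `O₁, O₂` to `ℤ₁, ℤ₂` such that `Φ ∘ h ∘ Φ⁻¹` is isotopic
relative to `ℤ₁ ∪ ℤ₂` to a homeomorphism translating each line `ℝ × {i}` by `±1`. -/
def AdmissibleStraightening (h : Plane ≃ₜ Plane) (O₁ O₂ : Set Plane)
    (Φ : Plane ≃ₜ Plane) : Prop :=
  OrientationPreserving Φ ∧ Φ '' O₁ = Z1 ∧ Φ '' O₂ = Z2 ∧
    ∃ ε₁ ε₂ : ℝ, (ε₁ = 1 ∨ ε₁ = -1) ∧ (ε₂ = 1 ∨ ε₂ = -1) ∧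
      ∃ g : Plane ≃ₜ Plane,
        (∀ x : ℝ, g (x, 1) = (x + ε₁, 1)) ∧
        (∀ x : ℝ, g (x, 2) = (x + ε₂, 2)) ∧
        IsotopicRel (⇑(conjH Φ h)) (⇑g) (Z1 ∪ Z2)

/-- A flow on the plane. -/
def IsFlow (φ : ℝ → Plane → Plane) : Prop :=
  Continuous (fun p : ℝ × Plane => φ p.1 p.2) ∧
    (∀ x, φ 0 x = x) ∧ ∀ s t x, φ (s + t) x = φ s (φ t x)

/-- A topological line in the plane: the image of a proper injective continuous
map from `ℝ` to the plane. -/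
def IsTopLine (L : Set Plane) : Prop :=
  ∃ f : ℝ → Plane, Continuous f ∧ Function.Injective f ∧ IsProperMap f ∧ range f = L

/-- The closed unit disk in the plane. -/
def unitDisk : Set Plane := {p | p.1 ^ 2 + p.2 ^ 2 ≤ 1}

/-- The boundary circle of the closed unit disk. -/
def unitCircle : Set Plane := {p | p.1 ^ 2 + p.2 ^ 2 = 1}

open Filter Topology Complex in
/-- Two continuous logarithms of the same function on a preconnected set differ by a constant. -/
lemma log_sub_const {X : Type*} [TopologicalSpace X] {S : Set X} (hS : IsPreconnected S)
    {h₁ h₂ : X → ℂ} (hc₁ : ContinuousOn h₁ S) (hc₂ : ContinuousOn h₂ S)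
    (he : ∀ x ∈ S, exp (h₁ x) = exp (h₂ x)) :
    ∃ n : ℤ, ∀ x ∈ S, h₁ x = h₂ x + n * (2 * Real.pi * I) := by
  have hne : (2 * Real.pi * I : ℂ) ≠ 0 := by simp [Real.pi_ne_zero]
  have hd : IsDiscrete ((AddSubgroup.zmultiples (2 * Real.pi * I : ℂ) : Set ℂ)) := by
    have : DiscreteTopology (AddSubgroup.zmultiples (2 * Real.pi * I : ℂ)) := inferInstance
    exact ⟨this⟩
  obtain ⟨y, hy, hyS⟩ := hS.eqOn_const_of_mapsTo hd (hc₁.sub hc₂) (fun x hx => by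
    obtain ⟨n, hn⟩ := exp_eq_exp_iff_exists_int.1 (he x hx)
    exact ⟨n, by simp [hn]⟩) ⟨0, AddSubgroup.zero_mem _⟩
  obtain ⟨n, rfl⟩ := hy
  refine ⟨n, fun x hx => ?_⟩
  have := hyS hx
  simp only [Pi.sub_apply, Function.const_apply, zsmul_eq_mul] at this
  linear_combination this

/-- `g` has a continuous logarithm on `K`. -/
def HasLog (g : ℂ → ℂ) (K : Set ℂ) : Prop :=
  ∃ h : ℂ → ℂ, ContinuousOn h K ∧ ∀ z ∈ K, Complex.exp (h z) = g z

lemma HasLog.mono {g : ℂ → ℂ} {K K' : Set ℂ} (h : HasLog g K) (hK : K' ⊆ K) : HasLog g K' := by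
  obtain ⟨k, hk, hk'⟩ := h
  exact ⟨k, hk.mono hK, fun z hz => hk' z (hK hz)⟩

open Complex in
/-- The identity translated by `-a` has no continuous logarithm on a circle around `a`. -/
lemma not_hasLog_sphere (a : ℂ) {R : ℝ} (hR : 0 < R) :
    ¬ HasLog (fun z => z - a) (Metric.sphere a R) := by
  rintro ⟨k, hk, hk'⟩
  have hm : ∀ θ : ℝ, circleMap a R θ ∈ Metric.sphere a R := fun θ =>
    circleMap_mem_sphere a hR.le θ
  have hc : Continuous fun θ : ℝ => k (circleMap a R θ) :=
    hk.comp_continuous (continuous_circleMap a R) hm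
  have hR' : (R : ℂ) ≠ 0 := by exact_mod_cast hR.ne'
  obtain ⟨n, hn⟩ := log_sub_const (S := (univ : Set ℝ)) isPreconnected_univ
    (h₁ := fun θ => k (circleMap a R θ)) (h₂ := fun θ : ℝ => θ * I + Complex.log R)
    hc.continuousOn (by fun_prop) (fun θ _ => by
      rw [hk' _ (hm θ), exp_add, exp_log hR']
      simp [circleMap]; ring)
  have h0 := hn 0 trivial
  have h1 := hn (2 * Real.pi) trivial
  have : circleMap a R (2 * Real.pi) = circleMap a R 0 := by simp [circleMap]
  simp only [this] at h1
  rw [h0] at h1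
  have : (2 * Real.pi * I : ℂ) = 0 := by push_cast at h1; linear_combination -h1
  simp [Real.pi_ne_zero] at this

lemma hasLog_div_symm {a b : ℂ} {K : Set ℂ} (h : HasLog (fun z => (z - a) / (z - b)) K) :
    HasLog (fun z => (z - b) / (z - a)) K := by
  obtain ⟨k, hk, hk'⟩ := h
  exact ⟨fun z => -k z, hk.neg, fun z hz => by rw [Complex.exp_neg, hk' z hz, inv_div]⟩

lemma hasLog_div_of_near {a b : ℂ} {K : Set ℂ} {d : ℝ} (hK : Disjoint (Metric.ball a d) K)
    (hb : b ∈ Metric.ball a d) : HasLog (fun z => (z - b) / (z - a)) K := by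
  have key : ∀ z ∈ K, z - a ≠ 0 ∧ (z - b) / (z - a) ∈ Complex.slitPlane := by
    intro z hz
    have h1 : d ≤ ‖z - a‖ := by
      by_contra! h
      exact hK.le_bot ⟨by simpa [dist_eq_norm] using h, hz⟩
    have h2 : ‖b - a‖ < d := by simpa [dist_eq_norm] using hb
    have h3 : z - a ≠ 0 := by
      rw [← norm_pos_iff]; exact lt_of_lt_of_le (lt_of_le_of_lt (norm_nonneg _) h2) h1
    refine ⟨h3, ?_⟩
    have : (z - b) / (z - a) = 1 + (-((b - a) / (z - a))) := by field_simp; ring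
    rw [this]
    apply Complex.mem_slitPlane_of_norm_lt_one
    rw [norm_neg, norm_div, div_lt_one (by simpa [norm_pos_iff] using h3)]
    linarith
  refine ⟨fun z => Complex.log ((z - b) / (z - a)), ?_, fun z hz => ?_⟩
  · refine ContinuousOn.clog ?_ fun z hz => (key z hz).2
    exact ContinuousOn.div (by fun_prop) (by fun_prop) fun z hz => (key z hz).1
  · exact Complex.exp_log (Complex.slitPlane_ne_zero (key z hz).2)

open Topology in
/-- Points of a connected set avoiding the closed set `K` have quotients with a logarithm on `K`. -/
lemma hasLog_div_of_preconnected {C K : Set ℂ} (hC : IsPreconnected C) (hK : IsClosed K)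
    (hCK : Disjoint C K) {a b : ℂ} (ha : a ∈ C) (hb : b ∈ C) :
    HasLog (fun z => (z - a) / (z - b)) K := by
  refine hC.induction₂ (fun a b => HasLog (fun z => (z - a) / (z - b)) K) ?_ ?_ ?_ ha hb
  · intro x hx
    have : Kᶜ ∈ 𝓝 x := hK.isOpen_compl.mem_nhds (fun h => hCK.le_bot ⟨hx, h⟩)
    obtain ⟨d, hd, hdK⟩ := Metric.mem_nhds_iff.1 this
    filter_upwards [mem_nhdsWithin_of_mem_nhds (Metric.ball_mem_nhds x hd)] with y hy
    exact hasLog_div_symm (hasLog_div_of_near (disjoint_left.2 fun z hz hzK => hdK hz hzK) hy)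
  · rintro x y z hx hy hz ⟨k, hk, hk'⟩ ⟨l, hl, hl'⟩
    refine ⟨fun z => k z + l z, hk.add hl, fun w hw => ?_⟩
    have : w - y ≠ 0 := fun h => hCK.le_bot ⟨hy, (sub_eq_zero.1 h) ▸ hw⟩
    rw [Complex.exp_add, hk' w hw, hl' w hw]
    field_simp
  · intro x y hx hy h
    exact hasLog_div_symm h

lemma HasLog.union_aux {g : ℂ → ℂ} {K L : Set ℂ} (hKL : IsPreconnected (K ∩ L))
    (hu : ∀ h : ℂ → ℂ, ContinuousOn h K → ContinuousOn h L → ContinuousOn h (K ∪ L))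
    (h₁ : HasLog g K) (h₂ : HasLog g L) : HasLog g (K ∪ L) := by
  classical
  obtain ⟨k, hk, hk'⟩ := h₁
  obtain ⟨l, hl, hl'⟩ := h₂
  obtain ⟨n, hn⟩ := log_sub_const hKL (hk.mono inter_subset_left) (hl.mono inter_subset_right)
    (fun x hx => by rw [hk' x hx.1, hl' x hx.2])
  set f : ℂ → ℂ := fun z => if z ∈ K then k z else l z + n * (2 * Real.pi * Complex.I) with hf
  have hfK : ∀ z ∈ K, f z = k z := fun z hz => if_pos hz
  have hfL : ∀ z ∈ L, f z = l z + n * (2 * Real.pi * Complex.I) := fun z hz => by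
    by_cases h : z ∈ K
    · rw [hfK z h, hn z ⟨h, hz⟩]
    · exact if_neg h
  refine ⟨f, hu f (hk.congr hfK) ((hl.add continuousOn_const).congr hfL), ?_⟩
  rintro z (hz | hz)
  · rw [hfK z hz, hk' z hz]
  · rw [hfL z hz, Complex.exp_add, hl' z hz, Complex.exp_int_mul_two_pi_mul_I, mul_one]

lemma HasLog.union_of_isClosed {g : ℂ → ℂ} {K L : Set ℂ} (hKL : IsPreconnected (K ∩ L))
    (hK : IsClosed K) (hL : IsClosed L) (h₁ : HasLog g K) (h₂ : HasLog g L) :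
    HasLog g (K ∪ L) :=
  HasLog.union_aux hKL (fun _ h h' => h.union_of_isClosed h' hK hL) h₁ h₂

lemma HasLog.union_of_isOpen {g : ℂ → ℂ} {K L : Set ℂ} (hKL : IsPreconnected (K ∩ L))
    (hK : IsOpen K) (hL : IsOpen L) (h₁ : HasLog g K) (h₂ : HasLog g L) :
    HasLog g (K ∪ L) :=
  HasLog.union_aux hKL (fun _ h h' => h.union_of_isOpen h' hK hL) h₁ h₂

lemma frontier_connectedComponentIn_subset {X : Type*} [TopologicalSpace X]
    [LocallyConnectedSpace X] {O : Set X} (hO : IsOpen O) (a : X) :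
    frontier (connectedComponentIn O a) ⊆ Oᶜ := by
  intro x hx hxO
  have hop := hO.connectedComponentIn (x := a)
  rw [hop.frontier_eq] at hx
  obtain ⟨y, hy1, hy2⟩ := mem_closure_iff.1 hx.1 _ (hO.connectedComponentIn (x := x))
    (mem_connectedComponentIn hxO)
  have e1 := connectedComponentIn_eq hy1
  have e2 := connectedComponentIn_eq hy2
  exact hx.2 (e2 ▸ e1 ▸ mem_connectedComponentIn hxO)

lemma hasLog_univ {g : ℂ → ℂ} (hg : Continuous g) (h0 : ∀ z, g z ≠ 0) : HasLog g univ := by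
  have hs : IsSimplyConnected (univ : Set ℂ) := by
    have := (convex_univ (𝕜 := ℝ) (E := ℂ)).contractibleSpace univ_nonempty
    exact SimplyConnectedSpace.ofContractible _
  obtain ⟨f, hf, hf'⟩ := Complex.exists_continuousOn_eqOn_exp_comp hs isOpen_univ
    hg.continuousOn (by simpa using h0)
  exact ⟨f, hf, fun z hz => hf' hz⟩

lemma hasLog_component_bounded {K : Set ℂ} (hK : IsClosed K) {a b : ℂ} (ha : a ∉ K) (hb : b ∉ K)
    (hbd : Bornology.IsBounded (connectedComponentIn Kᶜ a))
    (h : HasLog (fun z => (z - a) / (z - b)) K) : b ∈ connectedComponentIn Kᶜ a := by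
  classical
  by_contra hba
  set C := connectedComponentIn Kᶜ a with hC
  obtain ⟨k, hk, hk'⟩ := h
  obtain ⟨e, he⟩ := ContinuousMap.exists_restrict_eq hK (⟨K.domRestrict k, hk.domRestrict⟩ : C(K, ℂ))
  have he' : ∀ z ∈ K, e z = k z := fun z hz => by
    exact DFunLike.congr_fun he ⟨z, hz⟩
  have hfr : frontier C ⊆ K := by
    have := frontier_connectedComponentIn_subset hK.isOpen_compl a
    simpa using this
  have hHc : Continuous fun z => if z ∈ C then (z - b) * Complex.exp (e z) else z - a := by
    refine Continuous.if ?_ (by fun_prop) (by fun_prop)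
    intro z hz
    have hzK := hfr hz
    have : z - b ≠ 0 := fun h => hb (sub_eq_zero.1 h ▸ hzK)
    rw [he' z hzK, hk' z hzK]
    field_simp
  obtain ⟨l, hl, hl'⟩ := hasLog_univ hHc (fun z => by
    by_cases hz : z ∈ C
    · have : z - b ≠ 0 := fun h => hba (sub_eq_zero.1 h ▸ hz)
      simp only [hz, if_true]
      exact mul_ne_zero this (Complex.exp_ne_zero _)
    · have : z - a ≠ 0 := fun h => hz (sub_eq_zero.1 h ▸ mem_connectedComponentIn ha)
      simpa only [hz, if_false] using this)
  obtain ⟨R, hR⟩ := hbd.subset_ball a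
  have hR0 : 0 < R := by
    have := hR (mem_connectedComponentIn (F := Kᶜ) ha); simpa using this
  refine not_hasLog_sphere a hR0 ⟨l, hl.mono (subset_univ _), fun z hz => ?_⟩
  rw [hl' z trivial]
  refine if_neg ?_
  intro hzC
  have := hR hzC
  rw [Metric.mem_ball] at this
  rw [Metric.mem_sphere] at hz
  linarith

lemma isPreconnected_norm_gt (R : ℝ) : IsPreconnected {z : ℂ | R < ‖z‖} := by
  have : {z : ℂ | max R 0 < ‖z‖} = (fun p : ℝ × ℝ => (p.1 : ℂ) * Complex.exp (p.2 * Complex.I)) ''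
      (Ioi (max R 0) ×ˢ univ) := by
    ext z
    constructor
    · intro hz
      exact ⟨(‖z‖, z.arg), ⟨hz, trivial⟩, Complex.norm_mul_exp_arg_mul_I z⟩
    · rintro ⟨⟨r, t⟩, ⟨hr, -⟩, rfl⟩
      have h0 : 0 ≤ r := ((le_max_right _ _).trans_lt hr).le
      have hr' : max R 0 < r := hr
      change max R 0 < ‖(r : ℂ) * Complex.exp (t * Complex.I)‖
      rwa [norm_mul, Complex.norm_exp_ofReal_mul_I, mul_one, Complex.norm_real, Real.norm_of_nonneg h0]
  have h2 : IsPreconnected {z : ℂ | max R 0 < ‖z‖} := by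
    rw [this]
    exact (isPreconnected_Ioi.prod isPreconnected_univ).image _ (by fun_prop)
  rcases le_or_gt 0 R with h | h
  · rwa [max_eq_left h] at h2
  · have : {z : ℂ | R < ‖z‖} = univ := by
      ext z; simp [h.trans_le (norm_nonneg z)]
    rw [this]; exact isPreconnected_univ

lemma mem_component_of_norm_gt {K : Set ℂ} {R : ℝ} (hR : ∀ z ∈ K, ‖z‖ ≤ R) {a z w : ℂ}
    (hz : z ∈ connectedComponentIn Kᶜ a) (hzR : R < ‖z‖) (hw : R < ‖w‖) :
    w ∈ connectedComponentIn Kᶜ a := by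
  rw [connectedComponentIn_eq hz]
  exact (isPreconnected_norm_gt R).subset_connectedComponentIn (x := z) hzR
    (fun x hx hxK => not_lt.2 (hR x hxK) hx) hw

/-- Eilenberg's criterion. -/
lemma mem_connectedComponentIn_of_hasLog {K : Set ℂ} (hK : IsCompact K) {a b : ℂ} (ha : a ∉ K)
    (hb : b ∉ K) (h : HasLog (fun z => (z - a) / (z - b)) K) :
    b ∈ connectedComponentIn Kᶜ a := by
  by_cases h1 : Bornology.IsBounded (connectedComponentIn Kᶜ a)
  · exact hasLog_component_bounded hK.isClosed ha hb h1 h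
  by_cases h2 : Bornology.IsBounded (connectedComponentIn Kᶜ b)
  · have := hasLog_component_bounded hK.isClosed hb ha h2 (hasLog_div_symm h)
    rw [← connectedComponentIn_eq this]
    exact mem_connectedComponentIn hb
  obtain ⟨R, hR⟩ := hK.isBounded.exists_norm_le
  have key : ∀ c, ¬ Bornology.IsBounded (connectedComponentIn Kᶜ c) →
      ∃ z ∈ connectedComponentIn Kᶜ c, R < ‖z‖ := by
    intro c hc
    by_contra! hcon
    exact hc (isBounded_iff_forall_norm_le.2 ⟨R, hcon⟩)
  obtain ⟨z, hz, hzR⟩ := key a h1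
  obtain ⟨w, hw, hwR⟩ := key b h2
  have h3 := mem_component_of_norm_gt hR hw hwR hzR
  have e1 := connectedComponentIn_eq hz
  have e2 := connectedComponentIn_eq h3
  rw [e1, ← e2]
  exact mem_connectedComponentIn hb

open Filter Topology MeasureTheory in
/-- Holomorphic dependence of an integral on a parameter. -/
lemma differentiableAt_intervalIntegral {Φ : ℝ → ℂ → ℂ} {z₀ : ℂ} {r M : ℝ} (hr : 0 < r)
    (hd : ∀ t ∈ Icc (0:ℝ) 1, DifferentiableOn ℂ (Φ t) (Metric.ball z₀ r))
    (hc : ∀ ζ ∈ Metric.ball z₀ r, ContinuousOn (fun t => Φ t ζ) (Icc 0 1))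
    (hb : ∀ t ∈ Icc (0:ℝ) 1, ∀ ζ ∈ Metric.ball z₀ r, ‖Φ t ζ‖ ≤ M) :
    DifferentiableAt ℂ (fun ζ => ∫ t in (0:ℝ)..1, Φ t ζ) z₀ := by
  have hI : uIoc (0:ℝ) 1 ⊆ Icc 0 1 := by
    rw [uIoc_of_le zero_le_one]; exact Ioc_subset_Icc_self
  have hm : ∀ ζ ∈ Metric.ball z₀ r,
      AEStronglyMeasurable (fun t => Φ t ζ) (volume.restrict (uIoc (0:ℝ) 1)) := fun ζ hζ =>
    ((hc ζ hζ).mono hI).aestronglyMeasurable measurableSet_uIoc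
  have h0 : z₀ ∈ Metric.ball z₀ r := Metric.mem_ball_self hr
  have hda : ∀ t ∈ Icc (0:ℝ) 1, ∀ ζ ∈ Metric.ball z₀ r, HasDerivAt (Φ t) (deriv (Φ t) ζ) ζ :=
    fun t ht ζ hζ => ((hd t ht).differentiableAt (Metric.isOpen_ball.mem_nhds hζ)).hasDerivAt
  refine (intervalIntegral.hasDerivAt_integral_of_dominated_loc_of_deriv_le
    (F := fun ζ t => Φ t ζ) (F' := fun ζ t => deriv (Φ t) ζ) (s := Metric.ball z₀ (r/2))
    (bound := fun _ => M / (r/4)) (Metric.ball_mem_nhds _ (by positivity))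
    ?_ ?_ ?_ ?_ (by simp) ?_).2.differentiableAt
  · filter_upwards [Metric.ball_mem_nhds z₀ hr] with ζ hζ using hm ζ hζ
  · exact (ContinuousOn.intervalIntegrable (by rw [uIcc_of_le zero_le_one]; exact hc z₀ h0))
  · have hseq : Tendsto (fun n : ℕ => (r/2) * (1 / ((n:ℝ) + 1))) atTop (𝓝 0) := by
      simpa using (tendsto_one_div_add_atTop_nhds_zero_nat (𝕜 := ℝ)).const_mul (r/2)
    have hpos : ∀ n : ℕ, 0 < (r/2) * (1 / ((n:ℝ) + 1)) := fun n => by positivity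
    have hle : ∀ n : ℕ, (r/2) * (1 / ((n:ℝ) + 1)) < r := fun n => by
      have : 1 / ((n:ℝ) + 1) ≤ 1 := by
        rw [div_le_one (by positivity)]; linarith [(Nat.cast_nonneg n : (0:ℝ) ≤ n)]
      nlinarith
    refine aestronglyMeasurable_of_tendsto_ae atTop (f := fun (n : ℕ) t =>
      (((r/2) * (1 / ((n:ℝ) + 1)) : ℝ) : ℂ)⁻¹ •
        (Φ t (z₀ + (((r/2) * (1 / ((n:ℝ) + 1)) : ℝ) : ℂ)) - Φ t z₀)) ?_ ?_
    · intro n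
      refine AEStronglyMeasurable.const_smul (𝕜 := ℂ) ((hm _ ?_).sub (hm _ h0)) _
      rw [Metric.mem_ball, dist_eq_norm, add_sub_cancel_left, Complex.norm_real,
        Real.norm_of_nonneg (hpos n).le]
      exact hle n
    · rw [ae_restrict_iff' measurableSet_uIoc]
      refine Eventually.of_forall fun t ht => ?_
      have := (hasDerivAt_iff_tendsto_slope_zero.1 (hda t (hI ht) z₀ h0))
      refine this.comp (tendsto_nhdsWithin_iff.2 ⟨?_, Eventually.of_forall fun n => ?_⟩)
      · have := (Complex.continuous_ofReal.tendsto 0).comp hseq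
        rwa [Complex.ofReal_zero] at this
      · simp only [mem_compl_iff, mem_singleton_iff, Complex.ofReal_eq_zero]
        exact (hpos n).ne'
  · refine Eventually.of_forall fun t ht ζ hζ => ?_
    have hsub : Metric.closedBall ζ (r/4) ⊆ Metric.ball z₀ r := by
      intro w hw
      rw [Metric.mem_closedBall] at hw
      rw [Metric.mem_ball] at hζ ⊢
      linarith [dist_triangle w ζ z₀]
    refine Complex.norm_deriv_le_of_forall_mem_sphere_norm_le (by positivity)
      (((hd t (hI ht)).mono hsub).diffContOnCl_ball le_rfl) fun z hz => ?_
    exact hb t (hI ht) z (hsub (Metric.sphere_subset_closedBall hz))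
  · exact Eventually.of_forall fun t ht ζ hζ =>
      hda t (hI ht) ζ (Metric.ball_subset_ball (by linarith) hζ)

/-- The integral of `q` along the segment from `a` to `b`. -/
noncomputable def segInt (a b : ℂ) (q : ℂ → ℂ) : ℂ :=
  ∫ t in (0:ℝ)..1, (b - a) * q (a + t * (b - a))

lemma seg_mem {a b : ℂ} {t : ℝ} (ht : t ∈ Icc (0:ℝ) 1) : a + t * (b - a) ∈ segment ℝ a b := by
  rw [segment_eq_image']
  exact ⟨t, ht, by simp⟩

lemma continuousOn_seg {a b : ℂ} {q : ℂ → ℂ} (hq : ContinuousOn q (segment ℝ a b)) :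
    ContinuousOn (fun t : ℝ => (b - a) * q (a + t * (b - a))) (Icc 0 1) :=
  continuousOn_const.mul (hq.comp (by fun_prop) fun _ ht => seg_mem ht)

lemma intervalIntegrable_seg {a b : ℂ} {q : ℂ → ℂ} (hq : ContinuousOn q (segment ℝ a b)) :
    IntervalIntegrable (fun t : ℝ => (b - a) * q (a + t * (b - a))) MeasureTheory.volume 0 1 :=
  ContinuousOn.intervalIntegrable (by rw [uIcc_of_le zero_le_one]; exact continuousOn_seg hq)

lemma segInt_congr {a b : ℂ} {q q' : ℂ → ℂ} (h : EqOn q q' (segment ℝ a b)) :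
    segInt a b q = segInt a b q' := by
  refine intervalIntegral.integral_congr fun t ht => ?_
  rw [uIcc_of_le zero_le_one] at ht
  simp only [h (seg_mem ht)]

lemma segInt_sub_mul {a b : ℂ} {q q' : ℂ → ℂ} (c : ℂ) (hq : ContinuousOn q (segment ℝ a b))
    (hq' : ContinuousOn q' (segment ℝ a b)) :
    segInt a b (fun z => q z - c * q' z) = segInt a b q - c * segInt a b q' := by
  rw [segInt, segInt, segInt, ← intervalIntegral.integral_const_mul,
    ← intervalIntegral.integral_sub (intervalIntegrable_seg hq)
      ((intervalIntegrable_seg hq').const_mul c)]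
  refine intervalIntegral.integral_congr fun t _ => ?_
  ring

lemma norm_segInt_le {a b : ℂ} {q : ℂ → ℂ} {M : ℝ} (h : ∀ w ∈ segment ℝ a b, ‖q w‖ ≤ M) :
    ‖segInt a b q‖ ≤ ‖b - a‖ * M := by
  have := intervalIntegral.norm_integral_le_of_norm_le_const (a := 0) (b := 1)
    (C := ‖b - a‖ * M) (f := fun t : ℝ => (b - a) * q (a + t * (b - a))) (fun t ht => by
      rw [uIoc_of_le zero_le_one] at ht
      rw [norm_mul]
      gcongr
      exact h _ (seg_mem ⟨ht.1.le, ht.2⟩))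
  rwa [sub_zero, abs_one, mul_one] at this

lemma segInt_eq_sub {a b : ℂ} {q P : ℂ → ℂ} (hq : ContinuousOn q (segment ℝ a b))
    (hP : ∀ z ∈ segment ℝ a b, HasDerivAt P (q z) z) : segInt a b q = P b - P a := by
  have := intervalIntegral.integral_eq_sub_of_hasDerivAt
    (f := fun t : ℝ => P (a + t * (b - a))) (fun t ht => by
      rw [uIcc_of_le zero_le_one] at ht
      have h1 : HasDerivAt (fun t : ℝ => a + t * (b - a)) (b - a) t := by
        simpa using ((Complex.ofRealCLM.hasDerivAt (x := t)).mul_const (b - a)).const_add a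
      have := (hP _ (seg_mem ht)).scomp t h1
      rwa [smul_eq_mul] at this) (intervalIntegrable_seg hq)
  rw [segInt, this]
  simp

lemma exp_segInt_inv {a b ζ : ℂ} (h : ζ ∉ segment ℝ a b) :
    Complex.exp (segInt a b fun z => 1 / (z - ζ)) * (a - ζ) = b - ζ := by
  have hne : ∀ z ∈ segment ℝ a b, z - ζ ≠ 0 := fun z hz h' => h (sub_eq_zero.1 h' ▸ hz)
  have ha := hne a (left_mem_segment ℝ a b)
  have hb := hne b (right_mem_segment ℝ a b)
  have := segInt_eq_sub (a := a) (b := b) (q := fun z => 1 / (z - ζ))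
    (P := fun z => Complex.log ((z - ζ) / (a - ζ)))
    (ContinuousOn.div (by fun_prop) (by fun_prop) hne) (fun z hz => by
      have hs : (z - ζ) / (a - ζ) ∈ Complex.slitPlane := by
        by_contra hcon
        rw [Complex.mem_slitPlane_iff_not_le_zero, not_not] at hcon
        obtain ⟨t, ht, rfl⟩ := (segment_eq_image' ℝ a b) ▸ hz
        apply h
        -- `(z - ζ) = -s (a - ζ)` with `s ≥ 0` puts `ζ` between `a` and `z`
        set s : ℝ := -((a + t • (b - a) - ζ) / (a - ζ)).re with hs
        have hs0 : 0 ≤ s := by rw [hs]; simpa using (Complex.le_def.1 hcon).1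
        have him : ((a + t • (b - a) - ζ) / (a - ζ)) = ((-s : ℝ) : ℂ) := by
          apply Complex.ext
          · simp [hs]
          · simpa using (Complex.le_def.1 hcon).2
        rw [div_eq_iff ha] at him
        have hs1 : (1 + s : ℂ) ≠ 0 := by
          have : (1 + s : ℝ) ≠ 0 := by positivity
          exact_mod_cast this
        rw [segment_eq_image']
        refine ⟨t / (1 + s), ⟨div_nonneg ht.1 (by positivity), ?_⟩, ?_⟩
        · rw [div_le_one (by positivity)]; linarith [ht.2]
        · simp only [Complex.real_smul] at him ⊢
          push_cast at him ⊢
          field_simp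
          linear_combination him
      have h2 : HasDerivAt (fun z : ℂ => (z - ζ) / (a - ζ)) (1 / (a - ζ)) z :=
        ((hasDerivAt_id z).sub_const ζ).div_const _
      have h3 := (Complex.hasDerivAt_log hs).comp z h2
      refine h3.congr_deriv ?_
      rw [inv_div, div_mul_div_comm, mul_one, mul_comm (z - ζ), mul_comm, div_mul_cancel_right₀ ha, one_div])
  rw [this, div_self ha, Complex.log_one, sub_zero, Complex.exp_log (div_ne_zero hb ha)]
  field_simp

/-- `PolyInt W a b Λ Q`: the functional `Λ` is integration along a polygonal chain from `a` to `b`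
carried by the set `Q ⊆ W`. -/
inductive PolyInt (W : Set ℂ) (a : ℂ) : ℂ → ((ℂ → ℂ) → ℂ) → Set ℂ → Prop
  | base (ha : a ∈ W) : PolyInt W a a (fun _ => 0) {a}
  | step {b c : ℂ} {Λ : (ℂ → ℂ) → ℂ} {Q : Set ℂ} (h : PolyInt W a b Λ Q)
      (hs : segment ℝ b c ⊆ W) :
      PolyInt W a c (fun q => Λ q + segInt b c q) (Q ∪ segment ℝ b c)

namespace PolyInt

variable {W : Set ℂ} {a b : ℂ} {Λ : (ℂ → ℂ) → ℂ} {Q : Set ℂ}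

lemma isCompact_segment (b c : ℂ) : IsCompact (segment ℝ b c) := by
  rw [segment_eq_image']
  exact isCompact_Icc.image (by fun_prop)

lemma isCompact (h : PolyInt W a b Λ Q) : IsCompact Q := by
  induction h with
  | base => exact isCompact_singleton
  | step h hs ih => exact ih.union (isCompact_segment _ _)

lemma subset (h : PolyInt W a b Λ Q) : Q ⊆ W := by
  induction h with
  | base ha => simpa
  | step h hs ih => exact union_subset ih hs

lemma mem (h : PolyInt W a b Λ Q) : a ∈ Q ∧ b ∈ Q := by
  induction h with
  | base ha => simp
  | step h hs ih => exact ⟨Or.inl ih.1, Or.inr (right_mem_segment _ _ _)⟩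

lemma exp_inv (h : PolyInt W a b Λ Q) {ζ : ℂ} (hζ : ζ ∉ Q) :
    Complex.exp (Λ fun z => 1 / (z - ζ)) * (a - ζ) = b - ζ := by
  induction h with
  | base => simp
  | step h hs ih =>
    rw [mem_union, not_or] at hζ
    rw [Complex.exp_add, mul_right_comm, ih hζ.1, mul_comm, exp_segInt_inv hζ.2]

lemma congr (h : PolyInt W a b Λ Q) {q q' : ℂ → ℂ} (hq : EqOn q q' Q) : Λ q = Λ q' := by
  induction h with
  | base => rfl
  | step h hs ih =>
    simp only [ih (hq.mono subset_union_left), segInt_congr (hq.mono subset_union_right)]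

lemma sub_mul (h : PolyInt W a b Λ Q) {q q' : ℂ → ℂ} (c : ℂ) (hq : ContinuousOn q Q)
    (hq' : ContinuousOn q' Q) : Λ (fun z => q z - c * q' z) = Λ q - c * Λ q' := by
  induction h with
  | base => simp
  | step h hs ih =>
    simp only [ih (hq.mono subset_union_left) (hq'.mono subset_union_left),
      segInt_sub_mul c (hq.mono subset_union_right) (hq'.mono subset_union_right)]
    ring

lemma norm_le (h : PolyInt W a b Λ Q) :
    ∃ C : ℝ, 0 ≤ C ∧ ∀ (q : ℂ → ℂ) (M : ℝ), (∀ w ∈ Q, ‖q w‖ ≤ M) → ‖Λ q‖ ≤ C * M := by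
  induction h with
  | base => exact ⟨0, le_rfl, by simp⟩
  | @step b c Λ Q h hs ih =>
    obtain ⟨C, hC0, hC⟩ := ih
    refine ⟨C + ‖c - b‖, by positivity, fun q M hM => ?_⟩
    refine (norm_add_le _ _).trans ?_
    rw [add_mul]
    exact add_le_add (hC q M fun w hw => hM w (Or.inl hw))
      (norm_segInt_le fun w hw => hM w (Or.inr hw))

lemma differentiableAt (h : PolyInt W a b Λ Q) {Φ : ℂ → ℂ → ℂ} {z₀ : ℂ} {r M : ℝ} (hr : 0 < r)
    (hd : ∀ w ∈ Q, DifferentiableOn ℂ (Φ w) (Metric.ball z₀ r))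
    (hc : ∀ ζ ∈ Metric.ball z₀ r, ContinuousOn (fun w => Φ w ζ) Q)
    (hb : ∀ w ∈ Q, ∀ ζ ∈ Metric.ball z₀ r, ‖Φ w ζ‖ ≤ M) :
    DifferentiableAt ℂ (fun ζ => Λ fun w => Φ w ζ) z₀ := by
  induction h with
  | base => exact differentiableAt_const _
  | @step b c Λ Q h hs ih =>
    refine (ih (fun w hw => hd w (Or.inl hw)) (fun ζ hζ => (hc ζ hζ).mono subset_union_left)
      (fun w hw => hb w (Or.inl hw))).add ?_
    refine differentiableAt_intervalIntegral (M := ‖c - b‖ * M) hr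
      (fun t ht => (hd _ (Or.inr (seg_mem ht))).const_mul _)
      (fun ζ hζ => continuousOn_seg ((hc ζ hζ).mono subset_union_right))
      (fun t ht ζ hζ => ?_)
    rw [norm_mul]
    gcongr
    exact hb _ (Or.inr (seg_mem ht)) ζ hζ

end PolyInt

lemma dslope_symm (q : ℂ → ℂ) (z w : ℂ) : dslope q z w = dslope q w z := by
  rcases eq_or_ne z w with rfl | h
  · rfl
  · rw [dslope_of_ne _ h.symm, dslope_of_ne _ h, slope_comm]

namespace PolyInt

variable {W : Set ℂ} {a b : ℂ} {Λ : (ℂ → ℂ) → ℂ} {Q : Set ℂ}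

open Filter Topology in
lemma tendsto_cauchy (h : PolyInt W a b Λ Q) {q : ℂ → ℂ} (hq : ContinuousOn q Q) :
    Tendsto (fun ζ => Λ fun w => q w / (w - ζ)) (cocompact ℂ) (𝓝 0) := by
  obtain ⟨C, hC0, hC⟩ := h.norm_le
  obtain ⟨M, hM⟩ := h.isCompact.exists_bound_of_continuousOn hq
  have hM0 : 0 ≤ M := (norm_nonneg _).trans (hM a h.mem.1)
  obtain ⟨R, hR⟩ := h.isCompact.isBounded.exists_norm_le
  have h1 : Tendsto (fun ζ : ℂ => ‖ζ‖ - R) (cocompact ℂ) atTop :=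
    tendsto_atTop_add_const_right _ _ tendsto_norm_cocompact_atTop
  have h2 : Tendsto (fun ζ : ℂ => C * (M / (‖ζ‖ - R))) (cocompact ℂ) (𝓝 0) := by
    simpa using (h1.const_div_atTop M).const_mul C
  refine squeeze_zero_norm' ?_ h2
  filter_upwards [h1.eventually_gt_atTop 0] with ζ hζ
  refine hC _ _ fun w hw => ?_
  rw [norm_div]
  have h3 : ‖ζ‖ - R ≤ ‖w - ζ‖ := by
    rw [norm_sub_rev]
    linarith [norm_sub_norm_le ζ w, hR w hw]
  exact div_le_div₀ hM0 (hM w hw) hζ h3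

lemma differentiableAt_cauchy (h : PolyInt W a b Λ Q) {q : ℂ → ℂ} (hq : ContinuousOn q Q)
    {ζ₀ : ℂ} (hζ : ζ₀ ∉ Q) : DifferentiableAt ℂ (fun ζ => Λ fun w => q w / (w - ζ)) ζ₀ := by
  obtain ⟨M, hM⟩ := h.isCompact.exists_bound_of_continuousOn hq
  have hM0 : 0 ≤ M := (norm_nonneg _).trans (hM a h.mem.1)
  obtain ⟨d, hd, hdQ⟩ := Metric.mem_nhds_iff.1 (h.isCompact.isClosed.isOpen_compl.mem_nhds hζ)
  have key : ∀ w ∈ Q, ∀ ζ ∈ Metric.ball ζ₀ (d/2), d/2 ≤ ‖w - ζ‖ := by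
    intro w hw ζ hζ
    by_contra! hcon
    refine absurd hw (show w ∈ Qᶜ from hdQ ?_)
    rw [Metric.mem_ball] at hζ ⊢
    rw [← dist_eq_norm] at hcon
    linarith [dist_triangle w ζ ζ₀]
  have key' : ∀ w ∈ Q, ∀ ζ ∈ Metric.ball ζ₀ (d/2), w - ζ ≠ 0 := fun w hw ζ hζ => by
    rw [← norm_pos_iff]; linarith [key w hw ζ hζ]
  refine h.differentiableAt (Φ := fun w ζ => q w / (w - ζ)) (r := d/2) (M := M / (d/2))
    (by positivity) ?_ ?_ ?_
  · intro w hw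
    exact (differentiableOn_const _).div (by fun_prop) fun ζ hζ => key' w hw ζ hζ
  · intro ζ hζ
    exact hq.div (by fun_prop) fun w hw => key' w hw ζ hζ
  · intro w hw ζ hζ
    rw [norm_div]
    exact div_le_div₀ hM0 (hM w hw) (by positivity) (key w hw ζ hζ)

lemma differentiableAt_dslope (h : PolyInt W a b Λ Q) (hW : IsOpen W) {q : ℂ → ℂ}
    (hq : DifferentiableOn ℂ q W) {z₀ : ℂ} (hz : z₀ ∈ W) :
    DifferentiableAt ℂ (fun ζ => Λ fun w => dslope q ζ w) z₀ := by
  have hcomp : IsCompact (insert z₀ Q) := h.isCompact.insert z₀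
  obtain ⟨d, hd, hdW⟩ := hcomp.exists_cthickening_subset_open hW
    (insert_subset hz h.subset)
  have hTc : IsCompact (Metric.cthickening d (insert z₀ Q)) := hcomp.cthickening
  obtain ⟨M₀, hM₀⟩ := hTc.exists_bound_of_continuousOn (hq.continuousOn.mono hdW)
  obtain ⟨M₁, hM₁⟩ := hTc.exists_bound_of_continuousOn ((hq.deriv hW).continuousOn.mono hdW)
  have hballT : Metric.ball z₀ d ⊆ Metric.cthickening d (insert z₀ Q) := fun w hw =>
    Metric.mem_cthickening_of_dist_le w z₀ d _ (mem_insert _ _) (Metric.mem_ball.1 hw).le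
  have hQT : Q ⊆ Metric.cthickening d (insert z₀ Q) := (subset_insert _ _).trans
    (Metric.self_subset_cthickening _)
  have hball : Metric.ball z₀ (d/2) ⊆ Metric.ball z₀ d := Metric.ball_subset_ball (by linarith)
  have hM₀0 : 0 ≤ M₀ := (norm_nonneg _).trans (hM₀ a (hQT h.mem.1))
  have hM₁0 : 0 ≤ M₁ := (norm_nonneg _).trans (hM₁ a (hQT h.mem.1))
  refine h.differentiableAt (Φ := fun w ζ => dslope q ζ w) (r := d/2)
    (M := max M₁ (2 * M₀ / (d/2))) (by positivity) ?_ ?_ ?_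
  · intro w hw
    have : DifferentiableOn ℂ (dslope q w) W :=
      (Complex.differentiableOn_dslope (hW.mem_nhds (h.subset hw))).2 hq
    exact (this.mono ((hball.trans hballT).trans hdW)).congr fun ζ _ => dslope_symm q ζ w
  · intro ζ hζ
    have hζW := hdW (hballT (hball hζ))
    exact ((continuousOn_dslope (hW.mem_nhds hζW)).2
      ⟨hq.continuousOn, hq.differentiableAt (hW.mem_nhds hζW)⟩).mono h.subset
  · intro w hw ζ hζ
    by_cases hwζ : dist w ζ < d/2
    · refine le_trans ?_ (le_max_left _ _)
      have hw' : w ∈ Metric.ball z₀ d := by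
        rw [Metric.mem_ball] at hζ ⊢
        linarith [dist_triangle w ζ z₀]
      rcases eq_or_ne w ζ with rfl | hne
      · rw [dslope_same]; exact hM₁ _ (hballT hw')
      · rw [dslope_of_ne _ hne, slope_def_module, norm_smul, norm_inv, inv_mul_le_iff₀
          (by rw [norm_pos_iff]; exact sub_ne_zero.2 hne), mul_comm]
        exact (convex_ball z₀ d).norm_image_sub_le_of_norm_deriv_le
          (fun x hx => hq.differentiableAt (hW.mem_nhds (hdW (hballT hx))))
          (fun x hx => hM₁ x (hballT hx)) (hball hζ) hw'
    · refine le_trans ?_ (le_max_right _ _)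
      push Not at hwζ
      have hne : w ≠ ζ := by
        rintro rfl; rw [dist_self] at hwζ; linarith
      rw [dslope_of_ne _ hne, slope_def_module, smul_eq_mul, norm_mul, norm_inv, inv_mul_eq_div]
      rw [dist_eq_norm] at hwζ
      refine div_le_div₀ (by positivity) ?_ (by positivity) hwζ
      linarith [norm_sub_le (q w) (q ζ), hM₀ w (hQT hw), hM₀ ζ (hballT (hball hζ))]

open Filter Topology in
/-- Integrals of a holomorphic function along two polygonal chains with the same end points agree
when the complement of the domain is connected. -/
lemma eq_of_preconnected_compl {Λ₁ Λ₂ : (ℂ → ℂ) → ℂ} {Q₁ Q₂ : Set ℂ} (hW : IsOpen W)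
    (hWb : Bornology.IsBounded W) (hWc : IsPreconnected Wᶜ) (h₁ : PolyInt W a b Λ₁ Q₁)
    (h₂ : PolyInt W a b Λ₂ Q₂) {q : ℂ → ℂ} (hq : DifferentiableOn ℂ q W) : Λ₁ q = Λ₂ q := by
  classical
  have hQ : ∀ {ζ}, ζ ∉ W → ζ ∉ Q₁ ∪ Q₂ := fun hζ h =>
    hζ (union_subset h₁.subset h₂.subset h)
  have hQc : IsClosed (Q₁ ∪ Q₂) := (h₁.isCompact.union h₂.isCompact).isClosed
  set G : (ℂ → ℂ) → ℂ → ℂ := fun q ζ =>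
    Λ₁ (fun w => q w / (w - ζ)) - Λ₂ (fun w => q w / (w - ζ)) with hG
  have hGd : ∀ q, ContinuousOn q W → ∀ ζ ∉ Q₁ ∪ Q₂, DifferentiableAt ℂ (G q) ζ := by
    intro q hq ζ hζ
    rw [mem_union, not_or] at hζ
    exact (h₁.differentiableAt_cauchy (hq.mono h₁.subset) hζ.1).sub
      (h₂.differentiableAt_cauchy (hq.mono h₂.subset) hζ.2)
  have hGt : ∀ q, ContinuousOn q W → Tendsto (G q) (cocompact ℂ) (𝓝 0) := by
    intro q hq
    simpa using (h₁.tendsto_cauchy (hq.mono h₁.subset)).sub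
      (h₂.tendsto_cauchy (hq.mono h₂.subset))
  have hWco : Wᶜ ∈ cocompact ℂ := by
    rw [← Metric.cobounded_eq_cocompact]
    exact Bornology.isBounded_def.1 hWb
  set N : ℂ → ℂ := G fun _ => 1 with hN
  have hNexp : ∀ ζ ∉ Q₁ ∪ Q₂, Complex.exp (N ζ) = 1 := by
    intro ζ hζ
    rw [mem_union, not_or] at hζ
    have e1 := h₁.exp_inv hζ.1
    have e2 := h₂.exp_inv hζ.2
    have hne : a - ζ ≠ 0 := fun h => hζ.1 (sub_eq_zero.1 h ▸ h₁.mem.1)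
    have e3 := mul_right_cancel₀ hne (e1.trans e2.symm)
    rw [hN, hG, Complex.exp_sub, e3, div_self (Complex.exp_ne_zero _)]
  have hNconst : ∀ S : Set ℂ, IsPreconnected S → Disjoint S (Q₁ ∪ Q₂) →
      ∃ c, ∀ ζ ∈ S, N ζ = c := by
    intro S hS hSQ
    obtain ⟨n, hn⟩ := log_sub_const hS (h₁ := N) (h₂ := fun _ => 0)
      (fun ζ hζ => (hGd _ continuousOn_const ζ
        (disjoint_left.1 hSQ hζ)).continuousAt.continuousWithinAt)
      continuousOn_const (fun ζ hζ => by rw [hNexp ζ (disjoint_left.1 hSQ hζ), Complex.exp_zero])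
    exact ⟨_, hn⟩
  have hN0 : ∀ ζ ∉ W, N ζ = 0 := by
    obtain ⟨c, hc⟩ := hNconst _ hWc (disjoint_left.2 fun ζ hζ => hQ hζ)
    have : c = 0 := tendsto_nhds_unique (tendsto_const_nhds (f := cocompact ℂ))
      ((hGt _ continuousOn_const).congr' (by filter_upwards [hWco] with ζ hζ using hc ζ hζ))
    intro ζ hζ
    rw [hc ζ hζ, this]
  -- vanishing of the Cauchy transform outside `W`
  have hG0 : ∀ q, DifferentiableOn ℂ q W → ∀ ζ ∉ W, G q ζ = 0 := by
    intro q hq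
    set F : ℂ → ℂ := fun ζ => Λ₁ (fun w => dslope q ζ w) - Λ₂ (fun w => dslope q ζ w) with hF
    have hFG : ∀ ζ ∈ W, ζ ∉ Q₁ ∪ Q₂ → N ζ = 0 → F ζ = G q ζ := by
      intro ζ hζW hζ hNζ
      have hζ' := hζ
      rw [mem_union, not_or] at hζ'
      have aux : ∀ {Λ : (ℂ → ℂ) → ℂ} {Q : Set ℂ}, PolyInt W a b Λ Q → ζ ∉ Q →
          Λ (fun w => dslope q ζ w) = Λ (fun w => q w / (w - ζ)) -
            q ζ * Λ (fun w => 1 / (w - ζ)) := by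
        intro Λ Q h hζQ
        have hne : ∀ w ∈ Q, w - ζ ≠ 0 := fun w hw h' => hζQ (sub_eq_zero.1 h' ▸ hw)
        have e := h.sub_mul (q := fun w => q w / (w - ζ)) (q' := fun w => 1 / (w - ζ)) (q ζ)
          ((hq.continuousOn.mono h.subset).div (by fun_prop) hne)
          (continuousOn_const.div (by fun_prop) hne)
        rw [← e]
        refine h.congr fun w hw => ?_
        rw [dslope_of_ne _ (sub_ne_zero.1 (hne w hw)), slope_def_field]
        ring
      have hNζ' : Λ₁ (fun w => 1 / (w - ζ)) - Λ₂ (fun w => 1 / (w - ζ)) = 0 := hNζ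
      rw [hF, hG]
      simp only
      rw [aux h₁ hζ'.1, aux h₂ hζ'.2]
      linear_combination (-q ζ) * hNζ'
    set H : ℂ → ℂ := fun ζ => if ζ ∈ W then F ζ else G q ζ with hH
    have hHd : Differentiable ℂ H := by
      intro z
      by_cases hz : z ∈ W
      · refine ((h₁.differentiableAt_dslope hW hq hz).sub
          (h₂.differentiableAt_dslope hW hq hz)).congr_of_eventuallyEq ?_
        filter_upwards [hW.mem_nhds hz] with ζ hζ
        exact if_pos hζ
      · refine (hGd q hq.continuousOn z (hQ hz)).congr_of_eventuallyEq ?_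
        obtain ⟨d, hd, hdQ⟩ := Metric.mem_nhds_iff.1 (hQc.isOpen_compl.mem_nhds (hQ hz))
        obtain ⟨c, hc⟩ := hNconst _ (convex_ball z d).isPreconnected
          (disjoint_left.2 fun ζ hζ => hdQ hζ)
        filter_upwards [Metric.ball_mem_nhds z hd] with ζ hζ
        by_cases hζW : ζ ∈ W
        · have hNz : N ζ = 0 := by
            rw [hc ζ hζ, ← hc z (Metric.mem_ball_self hd), hN0 z hz]
          rw [← hFG ζ hζW (hdQ hζ) hNz]
          exact if_pos hζW
        · exact if_neg hζW
    have hHt : Tendsto H (cocompact ℂ) (𝓝 0) :=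
      (hGt q hq.continuousOn).congr' (by
        filter_upwards [hWco] with ζ hζ using (if_neg hζ).symm)
    intro ζ hζ
    have := hHd.apply_eq_of_tendsto_cocompact ζ hHt
    rwa [show H ζ = G q ζ from if_neg hζ] at this
  obtain ⟨ζ, hζ⟩ : (Wᶜ).Nonempty := by
    by_contra h
    rw [not_nonempty_iff_eq_empty] at h
    rw [h] at hWco
    exact (inferInstance : (cocompact ℂ).NeBot).ne (empty_mem_iff_bot.1 hWco)
  have h0 := hG0 (fun w => q w * (w - ζ)) (hq.mul (by fun_prop)) ζ hζ
  have hne : ∀ w ∈ W, w - ζ ≠ 0 := fun w hw h' => hζ (sub_eq_zero.1 h' ▸ hw)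
  have e1 : Λ₁ (fun w => q w * (w - ζ) / (w - ζ)) = Λ₁ q := h₁.congr fun w hw =>
    mul_div_cancel_right₀ _ (hne w (h₁.subset hw))
  have e2 : Λ₂ (fun w => q w * (w - ζ) / (w - ζ)) = Λ₂ q := h₂.congr fun w hw =>
    mul_div_cancel_right₀ _ (hne w (h₂.subset hw))
  rw [hG] at h0
  simp only at h0
  rw [e1, e2] at h0
  exact sub_eq_zero.1 h0

open Topology in
lemma exists_of_isPreconnected (hW : IsOpen W) (hWp : IsPreconnected W) (ha : a ∈ W) (hb : b ∈ W) :
    ∃ Λ Q, PolyInt W a b Λ Q := by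
  refine hWp.induction₂' (fun x y => (∃ Λ Q, PolyInt W a x Λ Q) → ∃ Λ Q, PolyInt W a y Λ Q)
    ?_ (fun x y z _ _ _ h h' => h' ∘ h) ha hb ⟨_, _, .base ha⟩
  intro x hx
  obtain ⟨d, hd, hdW⟩ := Metric.mem_nhds_iff.1 (hW.mem_nhds hx)
  filter_upwards [mem_nhdsWithin_of_mem_nhds (Metric.ball_mem_nhds x hd)] with y hy
  have hseg := ((convex_ball x d).segment_subset (Metric.mem_ball_self hd) hy).trans hdW
  refine ⟨fun ⟨Λ, Q, h⟩ => ⟨_, _, .step h hseg⟩, fun ⟨Λ, Q, h⟩ => ⟨_, _, .step h ?_⟩⟩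
  rwa [segment_symm]

end PolyInt

lemma exists_primitive {W : Set ℂ} (hW : IsOpen W) (hWp : IsPreconnected W)
    (hWb : Bornology.IsBounded W) (hWc : IsPreconnected Wᶜ) {q : ℂ → ℂ}
    (hq : DifferentiableOn ℂ q W) : ∃ P : ℂ → ℂ, ∀ z ∈ W, HasDerivAt P (q z) z := by
  classical
  rcases W.eq_empty_or_nonempty with rfl | ⟨a, ha⟩
  · exact ⟨0, by simp⟩
  choose! Λ Q hΛ using fun (z : ℂ) (hz : z ∈ W) =>
    PolyInt.exists_of_isPreconnected hW hWp ha hz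
  refine ⟨fun z => Λ z q, fun z hz => ?_⟩
  obtain ⟨d, hd, hdW⟩ := Metric.mem_nhds_iff.1 (hW.mem_nhds hz)
  obtain ⟨P, hP⟩ := (hq.mono hdW).isExactOn_ball
  have h0 : z ∈ Metric.ball z d := Metric.mem_ball_self hd
  have := (hP z h0).const_add (Λ z q - P z)
  refine this.congr_of_eventuallyEq ?_
  filter_upwards [Metric.ball_mem_nhds z hd] with w hw
  have hseg := (convex_ball z d).segment_subset h0 hw
  rw [(hΛ w (hdW hw)).eq_of_preconnected_compl hW hWb hWc (.step (hΛ z hz) (hseg.trans hdW)) hq,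
    segInt_eq_sub ((hq.continuousOn.mono hdW).mono hseg) fun y hy => hP y (hseg hy)]
  ring

/-- Nonvanishing holomorphic functions on a domain with connected complement have logarithms. -/
lemma exists_holomorphic_log {W : Set ℂ} (hW : IsOpen W) (hWp : IsPreconnected W)
    (hWb : Bornology.IsBounded W) (hWc : IsPreconnected Wᶜ) {g : ℂ → ℂ}
    (hg : DifferentiableOn ℂ g W) (h0 : ∀ z ∈ W, g z ≠ 0) :
    ∃ k : ℂ → ℂ, DifferentiableOn ℂ k W ∧ ∀ z ∈ W, Complex.exp (k z) = g z := by
  rcases W.eq_empty_or_nonempty with rfl | ⟨a, ha⟩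
  · exact ⟨0, by simp, by simp⟩
  obtain ⟨P, hP⟩ := exists_primitive hW hWp hWb hWc ((hg.deriv hW).div hg h0)
  have hgd : ∀ z ∈ W, HasDerivAt g (deriv g z) z := fun z hz =>
    (hg.differentiableAt (hW.mem_nhds hz)).hasDerivAt
  have hd : ∀ z ∈ W, HasDerivAt (fun z => g z * Complex.exp (-P z)) 0 z := by
    intro z hz
    refine ((hgd z hz).mul (hP z hz).neg.cexp).congr_deriv ?_
    simp only [Pi.div_apply]
    field_simp [h0 z hz]
    ring
  obtain ⟨c, hc⟩ := hW.exists_is_const_of_deriv_eq_zero hWp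
    (fun z hz => (hd z hz).differentiableAt.differentiableWithinAt)
    (fun z hz => (hd z hz).deriv)
  have hc0 : c ≠ 0 := by
    rw [← hc a ha]; exact mul_ne_zero (h0 a ha) (Complex.exp_ne_zero _)
  refine ⟨fun z => P z + Complex.log c, fun z hz =>
    ((hP z hz).differentiableAt.add_const _).differentiableWithinAt, fun z hz => ?_⟩
  rw [Complex.exp_add, Complex.exp_log hc0, ← hc z hz, mul_left_comm, ← Complex.exp_add,
    add_neg_cancel, Complex.exp_zero, mul_one]

open Filter Topology in
/-- Local form of Hurwitz's theorem. -/
lemma hurwitz_local {ι : Type*} {l : Filter ι} [l.NeBot] {U : Set ℂ} (hU : IsOpen U)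
    {F : ι → ℂ → ℂ} {h : ℂ → ℂ} (hF : TendstoLocallyUniformlyOn F h l U)
    (hd : ∀ n, DifferentiableOn ℂ (F n) U) (h0 : ∀ n, ∀ z ∈ U, F n z ≠ 0) {p : ℂ} (hp : p ∈ U)
    (hhp : h p = 0) : ∀ᶠ z in 𝓝 p, h z = 0 := by
  have hhd : DifferentiableOn ℂ h U := hF.differentiableOn (Eventually.of_forall hd) hU
  rcases (hhd.analyticOnNhd hU p hp).eventually_eq_zero_or_eventually_ne_zero with h1 | h1
  · exact h1
  exfalso
  rw [eventually_nhdsWithin_iff] at h1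
  obtain ⟨r, hr, hrU⟩ := Metric.nhds_basis_closedBall.mem_iff.1
    (Filter.inter_mem (hU.mem_nhds hp) h1)
  have hsU : Metric.sphere p r ⊆ U := fun z hz => (hrU (Metric.sphere_subset_closedBall hz)).1
  have hpos : ∀ z ∈ Metric.sphere p r, 0 < ‖h z‖ := fun z hz => by
    rw [norm_pos_iff]
    exact (hrU (Metric.sphere_subset_closedBall hz)).2 (Metric.ne_of_mem_sphere hz hr.ne')
  obtain ⟨z₁, hz₁, hmin⟩ := (isCompact_sphere p r).exists_isMinOn
    (NormedSpace.sphere_nonempty.2 hr.le) ((hhd.continuousOn.mono hsU).norm)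
  set m := ‖h z₁‖ with hm
  have hm0 : 0 < m := hpos z₁ hz₁
  have hunif := (tendstoLocallyUniformlyOn_iff_forall_isCompact hU).1 hF _ hsU (isCompact_sphere p r)
  have hlow : ∀ᶠ n in l, m / 2 ≤ ‖F n p‖ := by
    filter_upwards [Metric.tendstoUniformlyOn_iff.1 hunif (m/2) (by positivity)] with n hn
    have hball : Metric.closedBall p r ⊆ U := fun z hz => (hrU hz).1
    have hb : ∀ z ∈ frontier (Metric.ball p r), ‖(F n z)⁻¹‖ ≤ (m/2)⁻¹ := by
      intro z hz
      rw [frontier_ball p hr.ne'] at hz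
      rw [norm_inv]
      refine inv_anti₀ (by positivity) ?_
      have h2 := hn z hz
      rw [dist_eq_norm] at h2
      have h3 : m ≤ ‖h z‖ := hmin hz
      linarith [norm_sub_norm_le (h z) (F n z)]
    have hdc : DiffContOnCl ℂ (fun z => (F n z)⁻¹) (Metric.ball p r) :=
      (((hd n).inv (h0 n)).mono hball).diffContOnCl_ball le_rfl
    have := Complex.norm_le_of_forall_mem_frontier_norm_le Metric.isBounded_ball hdc hb
      (subset_closure (Metric.mem_ball_self hr))
    rw [norm_inv] at this
    exact (inv_le_inv₀ (norm_pos_iff.2 (h0 n p hp)) (by positivity)).1 this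
  have := ge_of_tendsto ((hF.tendsto_at hp).norm) hlow
  rw [hhp, norm_zero] at this
  linarith

open Filter Topology in
/-- A pointwise convergent family of holomorphic functions bounded by one converges locally
uniformly. -/
lemma tendstoLocallyUniformlyOn_of_pointwise {ι : Type*} {l : Filter ι} [l.NeBot] {W : Set ℂ}
    (hW : IsOpen W) {F : ι → ℂ → ℂ} {f : ℂ → ℂ} (hd : ∀ n, DifferentiableOn ℂ (F n) W)
    (hb : ∀ n, ∀ z ∈ W, ‖F n z‖ ≤ 1) (hf : ∀ z ∈ W, Tendsto (fun n => F n z) l (𝓝 (f z))) :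
    TendstoLocallyUniformlyOn F f l W := by
  rw [Metric.tendstoLocallyUniformlyOn_iff]
  intro ε hε x hx
  obtain ⟨r, hr, hrW⟩ := Metric.mem_nhds_iff.1 (hW.mem_nhds hx)
  have hlip : ∀ n, ∀ y ∈ Metric.ball x (r/2), ‖F n y - F n x‖ ≤ (1 / (r/2)) * ‖y - x‖ := by
    intro n y hy
    have hsub : ∀ z ∈ Metric.ball x (r/2), Metric.closedBall z (r/2) ⊆ W := fun z hz w hw => by
      apply hrW
      rw [Metric.mem_ball] at hz ⊢
      rw [Metric.mem_closedBall] at hw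
      linarith [dist_triangle w z x]
    refine (convex_ball x (r/2)).norm_image_sub_le_of_norm_deriv_le (fun z hz => ?_)
      (fun z hz => ?_) (Metric.mem_ball_self (by positivity)) hy
    · exact (hd n).differentiableAt (hW.mem_nhds (hsub z hz (Metric.mem_closedBall_self
        (by positivity))))
    · exact Complex.norm_deriv_le_of_forall_mem_sphere_norm_le (by positivity)
        (((hd n).mono (hsub z hz)).diffContOnCl_ball le_rfl)
        fun w hw => hb n w (hsub z hz (Metric.sphere_subset_closedBall hw))
  have hlipf : ∀ y ∈ Metric.ball x (r/2), ‖f y - f x‖ ≤ (1 / (r/2)) * ‖y - x‖ := by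
    intro y hy
    have hyW : y ∈ W := hrW (Metric.ball_subset_ball (by linarith) hy)
    exact le_of_tendsto ((hf y hyW).sub (hf x hx)).norm (Eventually.of_forall fun n => hlip n y hy)
  have hδ : 0 < min (r/2) (ε * r / 8) := by positivity
  refine ⟨Metric.ball x (min (r/2) (ε * r / 8)),
    mem_nhdsWithin_of_mem_nhds (Metric.ball_mem_nhds x hδ), ?_⟩
  filter_upwards [(Metric.tendsto_nhds.1 (hf x hx)) (ε/4) (by positivity)] with n hn y hy
  have hy1 : y ∈ Metric.ball x (r/2) := Metric.ball_subset_ball (min_le_left _ _) hy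
  have hy2 : ‖y - x‖ < ε * r / 8 := by
    rw [← dist_eq_norm]; exact lt_of_lt_of_le hy (min_le_right _ _)
  have hL : (1 / (r/2)) * ‖y - x‖ ≤ ε / 4 := by
    rw [one_div, inv_mul_le_iff₀ (by positivity)]
    linarith
  rw [dist_eq_norm] at hn ⊢
  have e : f y - F n y = (f y - f x) - (F n y - F n x) - (F n x - f x) := by ring
  rw [e]
  have := hlip n y hy1
  have := hlipf y hy1
  linarith [norm_sub_le ((f y - f x) - (F n y - F n x)) (F n x - f x),
    norm_sub_le (f y - f x) (F n y - F n x)]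

/-- Injective holomorphic immersions of `W` into the unit disk. -/
structure DiskEmb (W : Set ℂ) (f : ℂ → ℂ) : Prop where
  diff : DifferentiableOn ℂ f W
  inj : InjOn f W
  lt_one : ∀ z ∈ W, ‖f z‖ < 1
  deriv_ne : ∀ z ∈ W, deriv f z ≠ 0

namespace DiskEmb

variable {W : Set ℂ} {f : ℂ → ℂ}

lemma hasDerivAt (h : DiskEmb W f) (hW : IsOpen W) {z : ℂ} (hz : z ∈ W) :
    HasDerivAt f (deriv f z) z :=
  (h.diff.differentiableAt (hW.mem_nhds hz)).hasDerivAt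

end DiskEmb

/-- The disk automorphism sending `a` to the origin. -/
noncomputable def diskMob (a w : ℂ) : ℂ := (w - a) / (1 - starRingEnd ℂ a * w)

lemma diskMob_den_ne {a w : ℂ} (ha : ‖a‖ < 1) (hw : ‖w‖ < 1) : 1 - starRingEnd ℂ a * w ≠ 0 := by
  intro h
  have h1 : starRingEnd ℂ a * w = 1 := (sub_eq_zero.1 h).symm
  have h2 : ‖starRingEnd ℂ a * w‖ = 1 := by rw [h1, norm_one]
  rw [norm_mul, Complex.norm_conj] at h2
  nlinarith [norm_nonneg a, norm_nonneg w]

lemma norm_diskMob_lt {a w : ℂ} (ha : ‖a‖ < 1) (hw : ‖w‖ < 1) : ‖diskMob a w‖ < 1 := by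
  rw [diskMob, norm_div, div_lt_one (norm_pos_iff.2 (diskMob_den_ne ha hw)),
    ← sq_lt_sq₀ (norm_nonneg _) (norm_nonneg _), ← Complex.normSq_eq_norm_sq,
    ← Complex.normSq_eq_norm_sq]
  have ha2 : Complex.normSq a < 1 := by
    rw [Complex.normSq_eq_norm_sq]; nlinarith [norm_nonneg a]
  have hw2 : Complex.normSq w < 1 := by
    rw [Complex.normSq_eq_norm_sq]; nlinarith [norm_nonneg w]
  simp only [Complex.normSq_apply, Complex.sub_re, Complex.sub_im, Complex.mul_re, Complex.mul_im,
    Complex.one_re, Complex.one_im, Complex.conj_re, Complex.conj_im] at *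
  nlinarith [mul_pos (sub_pos.2 ha2) (sub_pos.2 hw2)]

lemma one_sub_conj_mul_self_ne {a : ℂ} (ha : ‖a‖ < 1) : 1 - starRingEnd ℂ a * a ≠ 0 :=
  diskMob_den_ne ha ha

lemma hasDerivAt_diskMob {a w : ℂ} (ha : ‖a‖ < 1) (hw : ‖w‖ < 1) :
    HasDerivAt (diskMob a)
      ((1 - starRingEnd ℂ a * a) / (1 - starRingEnd ℂ a * w) ^ 2) w := by
  have h1 : HasDerivAt (fun w => w - a) 1 w := (hasDerivAt_id w).sub_const a
  have h2 : HasDerivAt (fun w => 1 - starRingEnd ℂ a * w) (-(starRingEnd ℂ a)) w := by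
    simpa using ((hasDerivAt_id w).const_mul (starRingEnd ℂ a)).const_sub 1
  refine (h1.div h2 (diskMob_den_ne ha hw)).congr_deriv ?_
  ring

lemma diskMob_injOn {a w w' : ℂ} (ha : ‖a‖ < 1) (hw : ‖w‖ < 1) (hw' : ‖w'‖ < 1)
    (h : diskMob a w = diskMob a w') : w = w' := by
  rw [diskMob, diskMob, div_eq_div_iff (diskMob_den_ne ha hw) (diskMob_den_ne ha hw')] at h
  have : (1 - starRingEnd ℂ a * a) * (w - w') = 0 := by linear_combination h
  exact sub_eq_zero.1 ((mul_eq_zero.1 this).resolve_left (one_sub_conj_mul_self_ne ha))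

namespace DiskEmb

variable {W : Set ℂ} {f : ℂ → ℂ}

lemma hasDerivAt_mob (h : DiskEmb W f) (hW : IsOpen W) {a : ℂ} (ha : ‖a‖ < 1) {z : ℂ}
    (hz : z ∈ W) : HasDerivAt (fun z => diskMob a (f z))
      ((1 - starRingEnd ℂ a * a) / (1 - starRingEnd ℂ a * f z) ^ 2 * deriv f z) z :=
  (hasDerivAt_diskMob ha (h.lt_one z hz)).comp z (h.hasDerivAt hW hz)

lemma mob (h : DiskEmb W f) (hW : IsOpen W) {a : ℂ} (ha : ‖a‖ < 1) :
    DiskEmb W (fun z => diskMob a (f z)) where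
  diff z hz := (h.hasDerivAt_mob hW ha hz).differentiableAt.differentiableWithinAt
  inj z hz w hw e := h.inj hz hw (diskMob_injOn ha (h.lt_one z hz) (h.lt_one w hw) e)
  lt_one z hz := norm_diskMob_lt ha (h.lt_one z hz)
  deriv_ne z hz := by
    rw [(h.hasDerivAt_mob hW ha hz).deriv]
    exact mul_ne_zero (div_ne_zero (one_sub_conj_mul_self_ne ha)
      (pow_ne_zero 2 (diskMob_den_ne ha (h.lt_one z hz)))) (h.deriv_ne z hz)

lemma deriv_of_sq (h : DiskEmb W f) (hW : IsOpen W) {k : ℂ → ℂ} (hk : DifferentiableOn ℂ k W)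
    (hkf : ∀ z ∈ W, k z ^ 2 = f z) {z : ℂ} (hz : z ∈ W) : 2 * k z * deriv k z = deriv f z := by
  have hkd := (hk.differentiableAt (hW.mem_nhds hz)).hasDerivAt
  have h1 : HasDerivAt (fun z => k z ^ 2) (deriv f z) z :=
    (h.hasDerivAt hW hz).congr_of_eventuallyEq (by
      filter_upwards [hW.mem_nhds hz] with w hw using hkf w hw)
  have h2 := hkd.pow 2
  have := h2.unique h1
  simpa using this

lemma sqrt (h : DiskEmb W f) (hW : IsOpen W) {k : ℂ → ℂ} (hk : DifferentiableOn ℂ k W)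
    (hkf : ∀ z ∈ W, k z ^ 2 = f z) : DiskEmb W k where
  diff := hk
  inj z hz w hw e := h.inj hz hw (by rw [← hkf z hz, ← hkf w hw, e])
  lt_one z hz := by
    have := h.lt_one z hz
    rw [← hkf z hz, norm_pow] at this
    nlinarith [norm_nonneg (k z)]
  deriv_ne z hz e := h.deriv_ne z hz (by rw [← h.deriv_of_sq hW hk hkf hz, e, mul_zero])

end DiskEmb

namespace DiskEmb

variable {W : Set ℂ} {f : ℂ → ℂ}

/-- If a disk embedding misses a point, there is another one with larger derivative. -/
lemma exists_norm_deriv_lt (h : DiskEmb W f) (hW : IsOpen W)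
    (hL : ∀ g : ℂ → ℂ, DifferentiableOn ℂ g W → (∀ z ∈ W, g z ≠ 0) →
      ∃ k, DifferentiableOn ℂ k W ∧ ∀ z ∈ W, Complex.exp (k z) = g z)
    {z₀ : ℂ} (hz₀ : z₀ ∈ W) (h0 : f z₀ = 0) {a : ℂ} (ha : ‖a‖ < 1) (hmiss : ∀ z ∈ W, f z ≠ a) :
    ∃ F, DiskEmb W F ∧ F z₀ = 0 ∧ ‖deriv f z₀‖ < ‖deriv F z₀‖ := by
  have hg := h.mob hW ha
  obtain ⟨l, hl, hle⟩ := hL _ hg.diff (fun z hz e => by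
    rw [diskMob, div_eq_zero_iff] at e
    exact hmiss z hz (sub_eq_zero.1 (e.resolve_right (diskMob_den_ne ha (h.lt_one z hz)))))
  set k : ℂ → ℂ := fun z => Complex.exp (l z / 2) with hk
  have hkd : DifferentiableOn ℂ k W := (hl.div_const 2).cexp
  have hksq : ∀ z ∈ W, k z ^ 2 = diskMob a (f z) := fun z hz => by
    rw [← hle z hz, hk, ← Complex.exp_nat_mul]
    congr 1
    push_cast
    ring
  have hke := hg.sqrt hW hkd hksq
  set b := k z₀ with hb
  have hb1 : ‖b‖ < 1 := hke.lt_one z₀ hz₀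
  have hb0 : b ≠ 0 := Complex.exp_ne_zero _
  have hba : b ^ 2 = -a := by
    rw [hb, hksq z₀ hz₀, h0, diskMob]; simp
  refine ⟨_, hke.mob hW hb1, by simp [diskMob, ← hb], ?_⟩
  rw [(hke.hasDerivAt_mob hW hb1 hz₀).deriv, ← hb]
  have e1 := hg.deriv_of_sq hW hkd hksq hz₀
  rw [(h.hasDerivAt_mob hW ha hz₀).deriv, h0, ← hb] at e1
  simp only [mul_zero, sub_zero, one_pow, div_one] at e1
  have hbb : (starRingEnd ℂ b * b) = ((‖b‖ ^ 2 : ℝ) : ℂ) := by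
    rw [mul_comm, Complex.mul_conj, Complex.normSq_eq_norm_sq]
  have haa : (starRingEnd ℂ a * a) = ((‖b‖ ^ 4 : ℝ) : ℂ) := by
    have : a = -b^2 := by rw [hba]; ring
    rw [this, map_neg, map_pow, neg_mul_neg, ← mul_pow, hbb]
    push_cast; ring
  have e2 : 2 * ‖b‖ * ‖deriv k z₀‖ = (1 - ‖b‖^4) * ‖deriv f z₀‖ := by
    have := congrArg norm e1
    rw [haa, norm_mul, norm_mul, norm_mul] at this
    have e3 : ‖(1 - ((‖b‖ ^ 4 : ℝ) : ℂ))‖ = 1 - ‖b‖^4 := by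
      rw [← Complex.ofReal_one, ← Complex.ofReal_sub, Complex.norm_real, Real.norm_of_nonneg]
      have : ‖b‖^4 ≤ 1 := pow_le_one₀ (norm_nonneg b) hb1.le
      linarith
    rw [e3] at this
    simpa using this
  have hpos : 0 < ‖b‖ := norm_pos_iff.2 hb0
  have hd : 0 < ‖deriv f z₀‖ := norm_pos_iff.2 (h.deriv_ne z₀ hz₀)
  have h1 : 0 < 1 - ‖b‖^2 := by nlinarith
  rw [hbb, norm_mul, norm_div, norm_pow]
  have e3 : ‖(1 - ((‖b‖ ^ 2 : ℝ) : ℂ))‖ = 1 - ‖b‖^2 := by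
    rw [← Complex.ofReal_one, ← Complex.ofReal_sub, Complex.norm_real, Real.norm_of_nonneg]
    exact h1.le
  rw [e3]
  have e4 : (1 - ‖b‖^2) / (1 - ‖b‖^2)^2 * ‖deriv k z₀‖ = (1 + ‖b‖^2) / (2 * ‖b‖) * ‖deriv f z₀‖ := by
    field_simp
    nlinarith [e2]
  rw [e4, lt_mul_iff_one_lt_left hd, lt_div_iff₀ (by positivity)]
  nlinarith [sq_pos_of_pos (sub_pos.2 hb1)]

lemma norm_deriv_le (h : DiskEmb W f) {z₀ : ℂ} {r : ℝ} (hr : 0 < r)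
    (hball : Metric.closedBall z₀ r ⊆ W) : ‖deriv f z₀‖ ≤ 1 / r :=
  Complex.norm_deriv_le_of_forall_mem_sphere_norm_le hr
    ((h.diff.mono hball).diffContOnCl_ball le_rfl)
    fun w hw => (h.lt_one w (hball (Metric.sphere_subset_closedBall hw))).le

open Filter Topology in
/-- A pointwise limit of disk embeddings fixing a base value, with nonzero derivative there, is a
disk embedding. -/
lemma of_limit {ι : Type*} {l : Filter ι} [l.NeBot] (hW : IsOpen W) (hWc : IsPreconnected W)
    {F : ι → ℂ → ℂ} (hF : ∀ n, DiskEmb W (F n)) {z₀ : ℂ} (hz₀ : z₀ ∈ W) (h0 : ∀ n, F n z₀ = 0)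
    (hf : ∀ z ∈ W, Tendsto (fun n => F n z) l (𝓝 (f z))) {s : ℝ} (hs : 0 < s)
    (hds : Tendsto (fun n => ‖deriv (F n) z₀‖) l (𝓝 s)) :
    DiskEmb W f ∧ f z₀ = 0 ∧ ‖deriv f z₀‖ = s := by
  have hd : ∀ n, DifferentiableOn ℂ (F n) W := fun n => (hF n).diff
  have hT := tendstoLocallyUniformlyOn_of_pointwise hW hd (fun n z hz => ((hF n).lt_one z hz).le) hf
  have hfd : DifferentiableOn ℂ f W := hT.differentiableOn (Eventually.of_forall hd) hW
  have hT' : TendstoLocallyUniformlyOn (fun n => deriv (F n)) (deriv f) l W :=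
    hT.deriv (Eventually.of_forall hd) hW
  have hf0 : f z₀ = 0 := by
    have := hf z₀ hz₀
    simp only [h0] at this
    exact tendsto_nhds_unique this tendsto_const_nhds
  have hs' : ‖deriv f z₀‖ = s := tendsto_nhds_unique (hT'.tendsto_at hz₀).norm hds
  have hfa := hfd.analyticOnNhd hW
  have hd0 : deriv f z₀ ≠ 0 := by rw [← norm_pos_iff, hs']; exact hs
  have hdn : ∀ z ∈ W, deriv f z ≠ 0 := by
    intro z hz e
    have := hurwitz_local hW hT' (fun n => (hd n).deriv hW) (fun n z hz => (hF n).deriv_ne z hz)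
      hz e
    exact hd0 (hfa.deriv.eqOn_zero_of_preconnected_of_eventuallyEq_zero hWc hz this hz₀)
  have hnc : ∀ p ∈ W, ¬ ∀ᶠ z in 𝓝 p, f z = f p := by
    intro p hp h
    have h1 : f =ᶠ[𝓝 p] fun _ => f p := h
    have := h1.deriv_eq
    simp only [deriv_const] at this
    exact hdn p hp this
  refine ⟨⟨hfd, ?_, ?_, hdn⟩, hf0, hs'⟩
  · intro p hp w hw e
    by_contra hne
    have hopen : IsOpen (W \ {w}) := hW.sdiff isClosed_singleton
    have hT2 : TendstoLocallyUniformlyOn (fun n z => F n z - F n w) (fun z => f z - f w) l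
        (W \ {w}) := by
      have h1 := hT.mono (sdiff_subset : W \ {w} ⊆ W)
      have h2 : TendstoLocallyUniformlyOn (fun n (_ : ℂ) => F n w) (fun _ => f w) l (W \ {w}) := by
        refine TendstoUniformlyOn.tendstoLocallyUniformlyOn ?_
        rw [Metric.tendstoUniformlyOn_iff]
        intro ε hε
        filter_upwards [(Metric.tendsto_nhds.1 (hf w hw)) ε hε] with n hn x _
        rwa [dist_comm]
      exact h1.sub h2
    have := hurwitz_local hopen hT2 (fun n => ((hd n).mono sdiff_subset).sub_const _)
      (fun n z hz e => hz.2 ((hF n).inj hz.1 hw (sub_eq_zero.1 e))) ⟨hp, hne⟩ (sub_eq_zero.2 e)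
    refine hnc p hp ?_
    filter_upwards [this] with z hz
    rw [sub_eq_zero.1 hz, e]
  · have hle : ∀ z ∈ W, ‖f z‖ ≤ 1 := fun z hz =>
      le_of_tendsto (hf z hz).norm (Eventually.of_forall fun n => ((hF n).lt_one z hz).le)
    intro z hz
    refine lt_of_le_of_ne (hle z hz) fun e => ?_
    have := Complex.eqOn_of_isPreconnected_of_isMaxOn_norm hWc hW hfd hz
      (fun y hy => by simpa [e] using hle y hy)
    refine hnc z hz ?_
    filter_upwards [hW.mem_nhds hz] with y hy
    exact this hy

end DiskEmb

open Filter Topology in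
/-- The Riemann mapping theorem for bounded domains with holomorphic logarithms. -/
theorem exists_diskEmb_surjOn {W : Set ℂ} (hW : IsOpen W) (hWp : IsPreconnected W)
    (hWb : Bornology.IsBounded W) {z₀ : ℂ} (hz₀ : z₀ ∈ W)
    (hL : ∀ g : ℂ → ℂ, DifferentiableOn ℂ g W → (∀ z ∈ W, g z ≠ 0) →
      ∃ k, DifferentiableOn ℂ k W ∧ ∀ z ∈ W, Complex.exp (k z) = g z) :
    ∃ f, DiskEmb W f ∧ f z₀ = 0 ∧ SurjOn f W (Metric.ball 0 1) := by
  set S : Set ℝ := {s | ∃ f, DiskEmb W f ∧ f z₀ = 0 ∧ ‖deriv f z₀‖ = s} with hS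
  obtain ⟨R, hR0, hR⟩ := hWb.exists_pos_norm_le
  have hne : ∃ s ∈ S, 0 < s := by
    have hc : (0:ℝ) < 2 * R + 1 := by positivity
    have hcc : ((2 * R + 1 : ℝ) : ℂ) ≠ 0 := by exact_mod_cast hc.ne'
    have hd : ∀ z, HasDerivAt (fun z => (z - z₀) / ((2 * R + 1 : ℝ) : ℂ))
        (1 / ((2 * R + 1 : ℝ) : ℂ)) z := fun z => ((hasDerivAt_id z).sub_const z₀).div_const _
    have hE : DiskEmb W (fun z => (z - z₀) / ((2 * R + 1 : ℝ) : ℂ)) :=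
      { diff := fun z _ => (hd z).differentiableAt.differentiableWithinAt
        inj := fun z _ w _ e => by
          have := (div_left_inj' hcc).1 e
          exact sub_left_injective this
        lt_one := fun z hz => by
          rw [norm_div, Complex.norm_real, Real.norm_of_nonneg hc.le, div_lt_one hc]
          have := norm_sub_le z z₀
          linarith [hR z hz, hR z₀ hz₀]
        deriv_ne := fun z _ => by
          rw [(hd z).deriv]; exact one_div_ne_zero hcc }
    exact ⟨_, ⟨_, hE, by simp, rfl⟩, norm_pos_iff.2 (hE.deriv_ne z₀ hz₀)⟩
  obtain ⟨r, hr, hrW⟩ := Metric.nhds_basis_closedBall.mem_iff.1 (hW.mem_nhds hz₀)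
  have hbdd : BddAbove S := by
    refine ⟨1 / r, ?_⟩
    rintro _ ⟨f, hf, -, rfl⟩
    exact hf.norm_deriv_le hr hrW
  obtain ⟨s₀, hs₀, hs₀p⟩ := hne
  have hspos : 0 < sSup S := hs₀p.trans_le (le_csSup hbdd hs₀)
  obtain ⟨u, -, hu, huS⟩ := exists_seq_tendsto_sSup ⟨s₀, hs₀⟩ hbdd
  choose F hF hF0 hFd using huS
  have hle : (hyperfilter ℕ : Filter ℕ) ≤ atTop := Nat.hyperfilter_le_atTop
  have hlim : ∀ z, ∃ w, z ∈ W → Tendsto (fun n => F n z) (hyperfilter ℕ : Filter ℕ) (𝓝 w) := by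
    intro z
    by_cases hz : z ∈ W
    · obtain ⟨w, -, hw⟩ := (isCompact_closedBall (0:ℂ) 1).ultrafilter_le_nhds
        ((hyperfilter ℕ).map fun n => F n z) (by
          rw [le_principal_iff]
          refine Filter.mem_map.2 (Filter.univ_mem' fun n => ?_)
          simpa using ((hF n).lt_one z hz).le)
      exact ⟨w, fun _ => hw⟩
    · exact ⟨0, fun h => absurd h hz⟩
  choose f hf using hlim
  obtain ⟨h1, h2, h3⟩ := DiskEmb.of_limit hW hWp hF hz₀ hF0 (fun z hz => hf z hz) hspos
    (by simpa only [hFd] using hu.mono_left hle)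
  refine ⟨f, h1, h2, fun a ha => ?_⟩
  by_contra hmiss
  obtain ⟨G, hG, hG0, hlt⟩ := h1.exists_norm_deriv_lt hW hL hz₀ h2 (by simpa using ha)
    (fun z hz e => hmiss ⟨z, hz, e⟩)
  rw [h3] at hlt
  exact absurd (le_csSup hbdd ⟨G, hG, hG0, rfl⟩) (not_le.2 hlt)

/-- A biholomorphic parametrization of a bounded domain whose complement is connected. -/
theorem exists_riemann_map {W : Set ℂ} (hW : IsOpen W) (hWp : IsPreconnected W)
    (hWb : Bornology.IsBounded W) (hne : W.Nonempty) (hWc : IsPreconnected Wᶜ) :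
    ∃ φ f : ℂ → ℂ, DifferentiableOn ℂ φ (Metric.ball 0 1) ∧ ContinuousOn f W ∧
      (∀ z ∈ Metric.ball (0:ℂ) 1, φ z ∈ W ∧ f (φ z) = z ∧ deriv φ z ≠ 0) ∧
      (∀ w ∈ W, f w ∈ Metric.ball (0:ℂ) 1 ∧ φ (f w) = w) := by
  obtain ⟨z₀, hz₀⟩ := hne
  obtain ⟨f, hf, -, hs⟩ := exists_diskEmb_surjOn hW hWp hWb hz₀
    fun g hg h0 => exists_holomorphic_log hW hWp hWb hWc hg h0
  have hφ := hs.mapsTo_invFunOn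
  have hr : ∀ z ∈ Metric.ball (0:ℂ) 1, f (Function.invFunOn f W z) = z := fun z hz =>
    hs.rightInvOn_invFunOn hz
  have hl : ∀ w ∈ W, Function.invFunOn f W (f w) = w := fun w hw =>
    hf.inj.leftInvOn_invFunOn hw
  have hfb : ∀ w ∈ W, f w ∈ Metric.ball (0:ℂ) 1 := fun w hw => by simpa using hf.lt_one w hw
  have hd : ∀ z ∈ Metric.ball (0:ℂ) 1, HasDerivAt (Function.invFunOn f W)
      (deriv f (Function.invFunOn f W z))⁻¹ z := by
    intro z hz
    have hw := hφ hz
    have hst : HasStrictDerivAt f (deriv f (Function.invFunOn f W z)) (Function.invFunOn f W z) :=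
      (hf.diff.analyticOnNhd hW _ hw).hasStrictDerivAt
    have := hst.to_local_left_inverse (hf.deriv_ne _ hw)
      (by filter_upwards [hW.mem_nhds hw] with x hx using hl x hx)
    rw [hr z hz] at this
    exact this.hasDerivAt
  exact ⟨Function.invFunOn f W, f, fun z hz => (hd z hz).differentiableAt.differentiableWithinAt,
    hf.diff.continuousOn, fun z hz => ⟨hφ hz, hr z hz, by
      rw [(hd z hz).deriv]; exact inv_ne_zero (hf.deriv_ne _ (hφ hz))⟩,
    fun w hw => ⟨hfb w hw, hl w hw⟩⟩

open MeasureTheory in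
/-- A displacement along an arc of length at most `π` costs energy. -/
lemma sq_le_integral_norm_deriv_sq {G G' : ℝ → ℂ} {a b η : ℝ} (hab : a ≤ b)
    (hlen : b - a ≤ Real.pi) (hG : ∀ θ ∈ Icc a b, HasDerivAt G (G' θ) θ)
    (hG' : ContinuousOn G' (Icc a b)) (hη : 0 < η) (h : η ≤ ‖G b - G a‖) :
    η ^ 2 / Real.pi ≤ ∫ θ in a..b, ‖G' θ‖ ^ 2 := by
  have hu : uIcc a b = Icc a b := uIcc_of_le hab
  have hi : IntervalIntegrable G' volume a b :=
    ContinuousOn.intervalIntegrable (by rwa [hu])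
  have hi2 : IntervalIntegrable (fun θ => ‖G' θ‖ ^ 2) volume a b :=
    ContinuousOn.intervalIntegrable (by rw [hu]; exact hG'.norm.pow 2)
  have e := intervalIntegral.integral_eq_sub_of_hasDerivAt (by rwa [hu]) hi
  have hpi := Real.pi_pos
  set c := η / Real.pi with hc
  have hc0 : 0 < c := by positivity
  have h1 : ‖G b - G a‖ ≤ ∫ θ in a..b, ‖G' θ‖ := by
    rw [← e]; exact intervalIntegral.norm_integral_le_integral_norm hab
  have h2 : ∫ θ in a..b, ‖G' θ‖ ≤ ∫ θ in a..b, (c / 2 + (1 / (2 * c)) * ‖G' θ‖ ^ 2) := by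
    refine intervalIntegral.integral_mono_on hab hi.norm
      (intervalIntegrable_const.add (hi2.const_mul _)) fun x _ => ?_
    have : c / 2 + (1 / (2 * c)) * ‖G' x‖ ^ 2 - ‖G' x‖ = (1 / (2 * c)) * (‖G' x‖ - c) ^ 2 := by
      field_simp; ring
    have h3 : 0 ≤ (1 / (2 * c)) * (‖G' x‖ - c) ^ 2 := by positivity
    linarith
  rw [intervalIntegral.integral_add intervalIntegrable_const (hi2.const_mul _),
    intervalIntegral.integral_const, intervalIntegral.integral_const_mul, smul_eq_mul] at h2
  have h4 : (b - a) * (c / 2) ≤ η / 2 := by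
    calc (b - a) * (c / 2) ≤ Real.pi * (c / 2) := by gcongr
      _ = η / 2 := by rw [hc]; field_simp
  have h5 : η / 2 ≤ 1 / (2 * c) * ∫ θ in a..b, ‖G' θ‖ ^ 2 := by linarith
  rw [one_div, le_inv_mul_iff₀ (by positivity)] at h5
  have h6 : η ^ 2 / Real.pi = 2 * c * (η / 2) := by rw [hc]; field_simp
  linarith

lemma continuous_ofReal_mul_cos_add : Continuous fun p : ℝ × ℝ =>
    (p.1 : ℂ) * (Real.cos p.2 + Real.sin p.2 * Complex.I) := by fun_prop

lemma cos_add_sin_I_mem_ball {r θ : ℝ} (hr : 0 < r) :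
    (r : ℂ) * (Real.cos θ + Real.sin θ * Complex.I) ∈ Metric.ball (1:ℂ) 1 ↔ r < 2 * Real.cos θ := by
  rw [mem_ball_iff_norm, ← sq_lt_sq₀ (norm_nonneg _) zero_le_one, ← Complex.normSq_eq_norm_sq,
    Complex.normSq_apply]
  simp only [Complex.sub_re, Complex.mul_re, Complex.ofReal_re, Complex.add_re, Complex.I_re,
    Complex.sub_im, Complex.mul_im, Complex.ofReal_im, Complex.add_im, Complex.I_im,
    Complex.one_re, Complex.one_im]
  have := Real.sin_sq_add_cos_sq θ
  constructor
  · intro h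
    have : r * r < r * (2 * Real.cos θ) := by nlinarith
    exact lt_of_mul_lt_mul_left this hr.le
  · intro h
    have : r * r < r * (2 * Real.cos θ) := by gcongr
    nlinarith

open MeasureTheory in
/-- The energy of an injective holomorphic map with bounded image is finite. -/
lemma lintegral_norm_deriv_sq_lt_top {D : Set ℂ} (hD : IsOpen D) {ψ : ℂ → ℂ}
    (hψ : DifferentiableOn ℂ ψ D) (hinj : InjOn ψ D) (hb : Bornology.IsBounded (ψ '' D)) :
    ∫⁻ z in D, ENNReal.ofReal (‖deriv ψ z‖ ^ 2) < ⊤ := by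
  have hd : ∀ z ∈ D, HasFDerivWithinAt ψ
      ((ContinuousLinearMap.toSpanSingleton ℂ (deriv ψ z)).restrictScalars ℝ) D z := fun z hz =>
    ((hψ.differentiableAt (hD.mem_nhds hz)).hasDerivAt.hasFDerivAt.restrictScalars
      ℝ).hasFDerivWithinAt
  have := lintegral_abs_det_fderiv_eq_addHaar_image volume hD.measurableSet hd hinj
  have e : ∀ z, |((ContinuousLinearMap.toSpanSingleton ℂ (deriv ψ z)).restrictScalars ℝ).det| =
      ‖deriv ψ z‖ ^ 2 := by
    intro z
    simp [ContinuousLinearMap.det, LinearMap.det_restrictScalars, Algebra.norm_complex_apply,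
      Complex.normSq_eq_norm_sq]
  simp only [e] at this
  rw [this]
  exact hb.measure_lt_top

open MeasureTheory in
/-- Wolff's lemma: an injective holomorphic map with bounded image has small oscillation on
suitable small arcs around a boundary point. -/
theorem exists_small_arc {ψ : ℂ → ℂ} (hψ : DifferentiableOn ℂ ψ (Metric.ball 1 1))
    (hinj : InjOn ψ (Metric.ball 1 1)) (hb : Bornology.IsBounded (ψ '' Metric.ball 1 1))
    {η δ : ℝ} (hη : 0 < η) (hδ : 0 < δ) :
    ∃ r ∈ Ioo 0 δ, ∀ z₁ ∈ Metric.ball (1:ℂ) 1, ∀ z₂ ∈ Metric.ball (1:ℂ) 1, ‖z₁‖ = r → ‖z₂‖ = r →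
      ‖ψ z₁ - ψ z₂‖ ≤ η := by
  by_contra! hcon
  have hfin := lintegral_norm_deriv_sq_lt_top Metric.isOpen_ball hψ hinj hb
  rw [← lintegral_indicator Metric.isOpen_ball.measurableSet] at hfin
  set g : ℂ → ENNReal := (Metric.ball (1:ℂ) 1).indicator
    fun z => ENNReal.ofReal (‖deriv ψ z‖ ^ 2) with hg
  have hgm : Measurable g :=
    (((measurable_deriv ψ).norm.pow_const 2).ennreal_ofReal).indicator
      Metric.isOpen_ball.measurableSet
  rw [← Complex.lintegral_comp_polarCoord_symm g] at hfin
  rw [polarCoord_target, Measure.volume_eq_prod, ← Measure.prod_restrict,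
    lintegral_prod _ (by
      simp only [Complex.polarCoord_symm_apply, smul_eq_mul]
      exact ((measurable_fst.ennreal_ofReal).mul
        (hgm.comp continuous_ofReal_mul_cos_add.measurable)).aemeasurable)] at hfin
  simp only [Complex.polarCoord_symm_apply, smul_eq_mul] at hfin
  set κ := η ^ 2 / Real.pi with hκ
  have hpi := Real.pi_pos
  have hκ0 : 0 < κ := by positivity
  -- lower bound on every circle
  have hlow : ∀ r ∈ Ioo 0 δ, ENNReal.ofReal (κ * r⁻¹) ≤ ∫⁻ θ in Ioo (-Real.pi) Real.pi,
      ENNReal.ofReal r * g (r * (Real.cos θ + Real.sin θ * Complex.I)) := by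
    intro r hr
    obtain ⟨z₁, hz₁, z₂, hz₂, hn₁, hn₂, hlt⟩ := hcon r hr
    have hr0 := hr.1
    have harg : ∀ z ∈ Metric.ball (1:ℂ) 1, ‖z‖ = r →
        z = r * (Real.cos z.arg + Real.sin z.arg * Complex.I) ∧
        r < 2 * Real.cos z.arg ∧ |z.arg| < Real.pi / 2 := by
      intro z hz hn
      have e1 : z = r * (Real.cos z.arg + Real.sin z.arg * Complex.I) := by
        have := Complex.norm_mul_cos_add_sin_mul_I z
        rw [hn] at this
        push_cast
        exact this.symm
      have e2 : r < 2 * Real.cos z.arg := by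
        rw [← cos_add_sin_I_mem_ball hr0, ← e1]; exact hz
      refine ⟨e1, e2, ?_⟩
      by_contra! hge
      have := Real.cos_nonpos_of_pi_div_two_le_of_le hge
        (by linarith [Complex.abs_arg_le_pi z])
      rw [Real.cos_abs] at this
      linarith
    have key : ∀ z₁ ∈ Metric.ball (1:ℂ) 1, ∀ z₂ ∈ Metric.ball (1:ℂ) 1, ‖z₁‖ = r → ‖z₂‖ = r →
        η < ‖ψ z₁ - ψ z₂‖ → z₁.arg ≤ z₂.arg →
        ENNReal.ofReal (κ * r⁻¹) ≤ ∫⁻ θ in Ioo (-Real.pi) Real.pi,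
          ENNReal.ofReal r * g (r * (Real.cos θ + Real.sin θ * Complex.I)) := by
      intro z₁ hz₁ z₂ hz₂ hn₁ hn₂ hlt hle
      obtain ⟨e1, hc1, ha1⟩ := harg z₁ hz₁ hn₁
      obtain ⟨e2, hc2, ha2⟩ := harg z₂ hz₂ hn₂
      set a := z₁.arg
      set b := z₂.arg
      rw [abs_lt] at ha1 ha2
      have hcos : ∀ θ ∈ Icc a b, r < 2 * Real.cos θ := by
        intro θ hθ
        rcases le_total 0 θ with h0 | h0
        · have := Real.cos_le_cos_of_nonneg_of_le_pi h0 (by linarith) hθ.2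
          linarith
        · have := Real.cos_le_cos_of_nonneg_of_le_pi (x := -θ) (y := -a) (by linarith) (by linarith)
            (by linarith [hθ.1])
          rw [Real.cos_neg, Real.cos_neg] at this
          linarith
      have hmem : ∀ θ ∈ Icc a b,
          (r : ℂ) * (Real.cos θ + Real.sin θ * Complex.I) ∈ Metric.ball (1:ℂ) 1 := fun θ hθ =>
        (cos_add_sin_I_mem_ball hr0).2 (hcos θ hθ)
      set γ : ℝ → ℂ := fun θ => (r : ℂ) * (Real.cos θ + Real.sin θ * Complex.I) with hγ
      set γ' : ℝ → ℂ := fun θ => (r : ℂ) * (-Real.sin θ + Real.cos θ * Complex.I) with hγ'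
      have hγd : ∀ θ, HasDerivAt γ (γ' θ) θ := fun θ => by
        have h1 := (Real.hasDerivAt_cos θ).ofReal_comp
        have h2 := (Real.hasDerivAt_sin θ).ofReal_comp
        have := (h1.add (h2.mul_const Complex.I)).const_mul (r : ℂ)
        refine this.congr_deriv ?_
        rw [hγ']; push_cast; ring
      have hγn : ∀ θ, ‖γ' θ‖ = r := fun θ => by
        have : γ' θ = r * Complex.exp (θ * Complex.I) * Complex.I := by
          rw [hγ', Complex.exp_mul_I]
          push_cast
          linear_combination (-(r : ℂ) * Complex.sin θ) * Complex.I_sq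
        rw [this, norm_mul, norm_mul, Complex.norm_I, Complex.norm_exp_ofReal_mul_I,
          Complex.norm_real, Real.norm_of_nonneg hr0.le, mul_one, mul_one]
      have hG := sq_le_integral_norm_deriv_sq (G := fun θ => ψ (γ θ))
        (G' := fun θ => deriv ψ (γ θ) * γ' θ) hle (by linarith)
        (fun θ hθ => (hψ.differentiableAt (Metric.isOpen_ball.mem_nhds
          (hmem θ hθ))).hasDerivAt.comp θ (hγd θ))
        (by
          refine ContinuousOn.mul ?_ (by fun_prop)
          exact (hψ.deriv Metric.isOpen_ball).continuousOn.comp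
            (fun θ _ => (hγd θ).continuousAt.continuousWithinAt) hmem)
        hη (by
          have : γ b = z₂ := e2.symm
          have h' : γ a = z₁ := e1.symm
          rw [this, h', norm_sub_rev]; exact hlt.le)
      have hinter : IntegrableOn (fun θ => ‖deriv ψ (γ θ) * γ' θ‖ ^ 2) (Ioc a b) := by
        refine (ContinuousOn.integrableOn_Icc ?_).mono_set Ioc_subset_Icc_self
        refine (ContinuousOn.mul ?_ (by fun_prop)).norm.pow 2
        exact (hψ.deriv Metric.isOpen_ball).continuousOn.comp
            (fun θ _ => (hγd θ).continuousAt.continuousWithinAt) hmem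
      rw [intervalIntegral.integral_of_le hle] at hG
      have h1 : ENNReal.ofReal κ ≤ ∫⁻ θ in Ioc a b,
          ENNReal.ofReal (‖deriv ψ (γ θ) * γ' θ‖ ^ 2) := by
        rw [← ofReal_integral_eq_lintegral_ofReal hinter
          (Filter.Eventually.of_forall fun θ => by positivity)]
        exact ENNReal.ofReal_le_ofReal hG
      calc ENNReal.ofReal (κ * r⁻¹) = ENNReal.ofReal r⁻¹ * ENNReal.ofReal κ := by
            rw [mul_comm, ENNReal.ofReal_mul (by positivity)]
        _ ≤ ENNReal.ofReal r⁻¹ * ∫⁻ θ in Ioc a b,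
          ENNReal.ofReal (‖deriv ψ (γ θ) * γ' θ‖ ^ 2) := by gcongr
        _ = ∫⁻ θ in Ioc a b, ENNReal.ofReal r⁻¹ *
          ENNReal.ofReal (‖deriv ψ (γ θ) * γ' θ‖ ^ 2) := by
            rw [lintegral_const_mul' _ _ ENNReal.ofReal_ne_top]
        _ ≤ ∫⁻ θ in Ioc a b, ENNReal.ofReal r * g (γ θ) := by
            refine setLIntegral_mono' measurableSet_Ioc fun θ hθ => ?_
            rw [hg, indicator_of_mem (hmem θ (Ioc_subset_Icc_self hθ)),
              ← ENNReal.ofReal_mul (by positivity), ← ENNReal.ofReal_mul hr0.le]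
            apply ENNReal.ofReal_le_ofReal
            rw [norm_mul, hγn, mul_pow]
            apply le_of_eq
            change _ = r * ‖deriv ψ (γ θ)‖ ^ 2
            field_simp
        _ ≤ _ := by
            have hsub : Ioc a b ⊆ Ioo (-Real.pi) Real.pi := fun θ hθ =>
              ⟨by linarith [hθ.1], by linarith [hθ.2]⟩
            exact lintegral_mono_set hsub
    rcases le_total z₁.arg z₂.arg with h | h
    · exact key z₁ hz₁ z₂ hz₂ hn₁ hn₂ hlt h
    · exact key z₂ hz₂ z₁ hz₁ hn₂ hn₁ (by rwa [norm_sub_rev]) h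
  have h1 : ∫⁻ r in Ioo 0 δ, ENNReal.ofReal (κ * r⁻¹) < ⊤ := by
    refine lt_of_le_of_lt ?_ hfin
    exact (setLIntegral_mono' measurableSet_Ioo hlow).trans
      (lintegral_mono_set fun r hr => hr.1)
  have h2 : IntegrableOn (fun r : ℝ => κ * r⁻¹) (Ioo 0 δ) := by
    refine ⟨(measurable_inv.const_mul κ).aestronglyMeasurable, ?_⟩
    rw [hasFiniteIntegral_iff_ofReal]
    · exact h1
    · filter_upwards [ae_restrict_mem measurableSet_Ioo] with r hr
      have := hr.1
      simp only [Pi.zero_apply]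
      positivity
  have h3 : IntegrableOn (fun r : ℝ => r ^ (-1 : ℝ)) (Ioo 0 δ) := by
    have h4 : IntegrableOn (fun r : ℝ => κ⁻¹ * (κ * r⁻¹)) (Ioo 0 δ) := h2.const_mul κ⁻¹
    refine h4.congr_fun (fun r _ => ?_) measurableSet_Ioo
    simp only [Real.rpow_neg_one]
    field_simp
  rw [intervalIntegral.integrableOn_Ioo_rpow_iff hδ] at h3
  exact lt_irrefl _ h3

/-- A bounded plane domain `W` with boundary in a uniformly locally connected continuum `K`. -/
structure ContinuumDomain (W K : Set ℂ) : Prop where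
  isOpen : IsOpen W
  isPreconnected : IsPreconnected W
  isBounded : Bornology.IsBounded W
  nonempty : W.Nonempty
  disjoint : Disjoint W K
  closure_subset : closure W ⊆ W ∪ K
  isCompact : IsCompact K
  isPreconnected_bdry : IsPreconnected K
  locallyConnected : ∀ ε > 0, ∃ η > 0, ∀ a ∈ K, ∃ J ⊆ K, IsCompact J ∧ IsPreconnected J ∧
    K ∩ Metric.closedBall a η ⊆ J ∧ J ⊆ Metric.closedBall a ε

namespace ContinuumDomain

variable {W K : Set ℂ}

lemma subset_of_preconnected (h : ContinuumDomain W K) {V : Set ℂ} (hV : IsPreconnected V)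
    (hVK : Disjoint V K) (hne : (V ∩ W).Nonempty) : V ⊆ W :=
  hV.subset_of_closure_inter_subset h.isOpen hne fun _ hz =>
    (h.closure_subset hz.1).resolve_right (hVK.notMem_of_mem_left hz.2)

lemma frontier_nonempty (h : ContinuumDomain W K) : (frontier W).Nonempty := by
  rw [nonempty_frontier_iff]
  refine ⟨h.nonempty, fun e => ?_⟩
  have := h.isBounded
  rw [e] at this
  exact NormedSpace.unbounded_univ ℂ ℂ this

lemma bdry_nonempty (h : ContinuumDomain W K) : K.Nonempty := by
  obtain ⟨z, hz⟩ := h.frontier_nonempty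
  rw [h.isOpen.frontier_eq] at hz
  exact ⟨z, (h.closure_subset hz.1).resolve_left hz.2⟩

lemma isPreconnected_compl (h : ContinuumDomain W K) : IsPreconnected Wᶜ := by
  obtain ⟨p, hp⟩ := h.bdry_nonempty
  have hKW : K ⊆ Wᶜ := fun z hz hz' => h.disjoint.notMem_of_mem_left hz' hz
  refine isPreconnected_of_forall p fun z hz => ?_
  by_cases hzK : z ∈ K
  · exact ⟨K, hKW, hp, hzK, h.isPreconnected_bdry⟩
  set V := connectedComponentIn Kᶜ z with hV
  have hzV : z ∈ V := mem_connectedComponentIn hzK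
  have hVo : IsOpen V := h.isCompact.isClosed.isOpen_compl.connectedComponentIn
  have hVp : IsPreconnected V := isPreconnected_connectedComponentIn
  have hVK : V ⊆ Kᶜ := connectedComponentIn_subset _ _
  have hVW : Disjoint V W := by
    rw [Set.disjoint_iff_inter_eq_empty, ← not_nonempty_iff_eq_empty]
    intro hne
    exact hz (h.subset_of_preconnected hVp (disjoint_left.2 fun _ h1 h2 => hVK h1 h2) hne hzV)
  have hfr : (frontier V).Nonempty := by
    rw [nonempty_frontier_iff]
    exact ⟨⟨z, hzV⟩, fun e => hVK (e ▸ mem_univ p) hp⟩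
  obtain ⟨q, hq⟩ := hfr
  have hqK : q ∈ K := by
    have := frontier_connectedComponentIn_subset h.isCompact.isClosed.isOpen_compl z hq
    rwa [compl_compl] at this
  refine ⟨K ∪ closure V, union_subset hKW ?_, Or.inl hp, Or.inr (subset_closure hzV), ?_⟩
  · exact closure_minimal (fun w hw hw' => hVW.notMem_of_mem_left hw hw') h.isOpen.isClosed_compl
  · exact h.isPreconnected_bdry.union q hqK (frontier_subset_closure hq) hVp.closure

end ContinuumDomain

lemma isPreconnected_compl_closedBall (a : ℂ) (R : ℝ) :
    IsPreconnected (Metric.closedBall a R)ᶜ := by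
  have := (isPreconnected_norm_gt R).image (fun z => z + a) (by fun_prop)
  convert this using 1
  ext z
  simp only [mem_compl_iff, Metric.mem_closedBall, dist_eq_norm, not_le, mem_image, mem_ofPred_eq]
  exact ⟨fun hz => ⟨z - a, hz, by ring⟩, by rintro ⟨w, hw, rfl⟩; simpa using hw⟩

/-- The parametrization of a circular arc around the boundary point `ζ`. -/
noncomputable def arcPoint (ζ : ℂ) (r θ : ℝ) : ℂ :=
  ζ * (1 - r * (Real.cos θ + Real.sin θ * Complex.I))

lemma continuous_arcPoint (ζ : ℂ) (r : ℝ) : Continuous (arcPoint ζ r) := by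
  unfold arcPoint; fun_prop

lemma normSq_arc (r θ : ℝ) :
    ‖(1 - r * (Real.cos θ + Real.sin θ * Complex.I) : ℂ)‖ ^ 2 = 1 - 2 * r * Real.cos θ + r ^ 2 := by
  rw [← Complex.normSq_eq_norm_sq, Complex.normSq_apply]
  simp only [Complex.sub_re, Complex.mul_re, Complex.ofReal_re, Complex.add_re, Complex.I_re,
    Complex.sub_im, Complex.mul_im, Complex.ofReal_im, Complex.add_im, Complex.I_im,
    Complex.one_re, Complex.one_im]
  nlinarith [Real.sin_sq_add_cos_sq θ]

lemma arc_eq_image {ζ : ℂ} (hζ : ‖ζ‖ = 1) {r : ℝ} (hr : 0 < r) (hr1 : r < 1) :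
    Metric.ball (0:ℂ) 1 ∩ Metric.sphere ζ r =
      arcPoint ζ r '' Ioo (-Real.arccos (r / 2)) (Real.arccos (r / 2)) := by
  have hζ0 : ζ ≠ 0 := by rw [← norm_ne_zero_iff, hζ]; exact one_ne_zero
  have hcos : Real.cos (Real.arccos (r/2)) = r/2 := Real.cos_arccos (by linarith) (by linarith)
  have hpi := Real.arccos_le_pi (r/2)
  ext z
  simp only [mem_inter_iff, mem_ball_zero_iff, mem_sphere_iff_norm, mem_image, ← abs_lt, mem_Ioo]
  have hdisk : ∀ θ, ‖arcPoint ζ r θ‖ < 1 ↔ r / 2 < Real.cos θ := by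
    intro θ
    rw [arcPoint, norm_mul, hζ, one_mul, ← sq_lt_sq₀ (norm_nonneg _) zero_le_one, normSq_arc]
    constructor
    · intro h
      have : r * (r/2) < r * Real.cos θ := by nlinarith
      exact lt_of_mul_lt_mul_left this hr.le
    · intro h
      have : r * (r/2) < r * Real.cos θ := by gcongr
      nlinarith
  have hiff : ∀ θ, |θ| ≤ Real.pi → (r / 2 < Real.cos θ ↔ |θ| < Real.arccos (r/2)) := by
    intro θ hθ
    rw [← Real.cos_abs θ]
    nth_rw 1 [← hcos]
    exact Real.strictAntiOn_cos.lt_iff_gt ⟨Real.arccos_nonneg _, hpi⟩ ⟨abs_nonneg _, hθ⟩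
  constructor
  · rintro ⟨hz, hn⟩
    have he : z = arcPoint ζ r (1 - z / ζ).arg := by
      have h1 := Complex.norm_mul_cos_add_sin_mul_I (1 - z / ζ)
      have h2 : ‖1 - z / ζ‖ = r := by
        have : 1 - z / ζ = (ζ - z) / ζ := by field_simp
        rw [this, norm_div, hζ, div_one, norm_sub_rev, hn]
      rw [h2] at h1
      rw [arcPoint, Complex.ofReal_cos, Complex.ofReal_sin, h1]
      field_simp; ring
    rw [he, hdisk, hiff _ (Complex.abs_arg_le_pi _)] at hz
    exact ⟨_, hz, he.symm⟩
  · rintro ⟨θ, hθ, rfl⟩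
    refine ⟨(hdisk θ).2 ((hiff θ (hθ.le.trans hpi)).2 hθ), ?_⟩
    have : arcPoint ζ r θ - ζ = -(ζ * (r * Complex.exp (θ * Complex.I))) := by
      rw [arcPoint, Complex.exp_mul_I]; push_cast; ring
    rw [this, norm_neg, norm_mul, hζ, norm_mul, Complex.norm_exp_ofReal_mul_I, Complex.norm_real,
      Real.norm_of_nonneg hr.le, one_mul, mul_one]

open Filter Topology in
lemma exists_arc_norm_gt {ζ : ℂ} (hζ : ‖ζ‖ = 1) {r : ℝ} (hr : 0 < r) (hr1 : r < 1) {τ : ℝ}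
    (hτ : 0 < τ) : ∃ z ∈ Metric.ball (0:ℂ) 1 ∩ Metric.sphere ζ r, 1 - τ < ‖z‖ := by
  have hcos : Real.cos (Real.arccos (r/2)) = r/2 := Real.cos_arccos (by linarith) (by linarith)
  have hpos : 0 < Real.arccos (r/2) := Real.arccos_pos.2 (by linarith)
  have hn : ‖arcPoint ζ r (Real.arccos (r/2))‖ = 1 := by
    rw [arcPoint, norm_mul, hζ, one_mul, ← sq_eq_sq₀ (norm_nonneg _) zero_le_one, normSq_arc, hcos]
    ring
  have h1 : ∀ᶠ θ in 𝓝 (Real.arccos (r/2)), 1 - τ < ‖arcPoint ζ r θ‖ :=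
    (continuous_arcPoint ζ r).norm.continuousAt.eventually_const_lt
      (show 1 - τ < ‖arcPoint ζ r (Real.arccos (r/2))‖ by rw [hn]; linarith)
  have h2 : ∀ᶠ θ in 𝓝 (Real.arccos (r/2)), 0 < θ := lt_mem_nhds hpos
  obtain ⟨θ, ⟨h3, h4⟩, h5⟩ := ((h1.and h2).filter_mono nhdsWithin_le_nhds |>.and
    (self_mem_nhdsWithin (s := Iio (Real.arccos (r/2))))).exists
  refine ⟨arcPoint ζ r θ, ?_, h3⟩
  rw [arc_eq_image hζ hr hr1]
  exact mem_image_of_mem _ ⟨by linarith, h5⟩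

/-- A Riemann map of `W`. -/
structure RiemannMap (W : Set ℂ) (φ f : ℂ → ℂ) : Prop where
  diff : DifferentiableOn ℂ φ (Metric.ball 0 1)
  cont_inv : ContinuousOn f W
  mapsTo : ∀ z ∈ Metric.ball (0:ℂ) 1, φ z ∈ W
  left_inv : ∀ z ∈ Metric.ball (0:ℂ) 1, f (φ z) = z
  deriv_ne : ∀ z ∈ Metric.ball (0:ℂ) 1, deriv φ z ≠ 0
  inv_mapsTo : ∀ w ∈ W, f w ∈ Metric.ball (0:ℂ) 1
  right_inv : ∀ w ∈ W, φ (f w) = w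

namespace RiemannMap

variable {W K : Set ℂ} {φ f : ℂ → ℂ}

lemma injOn (hφ : RiemannMap W φ f) : InjOn φ (Metric.ball 0 1) := fun z hz w hw e => by
  rw [← hφ.left_inv z hz, e, hφ.left_inv w hw]

lemma image_eq (hφ : RiemannMap W φ f) : φ '' Metric.ball 0 1 = W := by
  refine Subset.antisymm (image_subset_iff.2 hφ.mapsTo) fun w hw =>
    ⟨f w, hφ.inv_mapsTo w hw, hφ.right_inv w hw⟩

lemma exists_infDist_lt (hφ : RiemannMap W φ f) (h : ContinuumDomain W K) {η : ℝ} (hη : 0 < η) :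
    ∃ τ > 0, ∀ z ∈ Metric.ball (0:ℂ) 1, 1 - τ < ‖z‖ → Metric.infDist (φ z) K < η := by
  set Q := closure W ∩ {w | η ≤ Metric.infDist w K} with hQ
  have hQc : IsCompact Q := h.isBounded.isCompact_closure.inter_right
    (isClosed_le continuous_const (Metric.continuous_infDist_pt K))
  have hQW : Q ⊆ W := fun w hw => (h.closure_subset hw.1).resolve_right fun hK => by
    have := hw.2
    rw [mem_ofPred_eq, Metric.infDist_zero_of_mem hK] at this
    linarith
  rcases Q.eq_empty_or_nonempty with he | hne
  · refine ⟨1, one_pos, fun z hz _ => ?_⟩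
    by_contra! hc
    exact he.subset (⟨subset_closure (hφ.mapsTo z hz), hc⟩ : φ z ∈ Q)
  · obtain ⟨w, hw, hmax⟩ := hQc.exists_isMaxOn hne ((hφ.cont_inv.mono hQW).norm)
    have h1 : ‖f w‖ < 1 := by simpa using hφ.inv_mapsTo w (hQW hw)
    refine ⟨1 - ‖f w‖, by linarith, fun z hz hlt => ?_⟩
    by_contra! hc
    have := hmax (⟨subset_closure (hφ.mapsTo z hz), hc⟩ : φ z ∈ Q)
    simp only [mem_ofPred_eq, hφ.left_inv z hz] at this
    linarith

lemma exists_image_subset_closedBall (hφ : RiemannMap W φ f) (h : ContinuumDomain W K) {ζ : ℂ}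
    (hζ : ‖ζ‖ = 1) {ε : ℝ} (hε : 0 < ε) : ∃ r > 0, ∃ a,
      ∀ z ∈ Metric.ball (0:ℂ) 1 ∩ Metric.ball ζ r, φ z ∈ Metric.closedBall a ε := by
  have h00 : (0:ℂ) ∈ Metric.ball (0:ℂ) 1 := by simp
  have hw0 : φ 0 ∉ K := h.disjoint.notMem_of_mem_left (hφ.mapsTo 0 h00)
  have hdist : 0 < Metric.infDist (φ 0) K :=
    (h.isCompact.isClosed.notMem_iff_infDist_pos h.bdry_nonempty).1 hw0
  wlog hε2 : ε < Metric.infDist (φ 0) K generalizing ε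
  · obtain ⟨r, hr, a, ha⟩ := this (half_pos hdist) (half_lt_self hdist)
    exact ⟨r, hr, a, fun z hz => Metric.closedBall_subset_closedBall
      (by linarith [not_lt.1 hε2]) (ha z hz)⟩
  obtain ⟨η₀, hη₀, hJ⟩ := h.locallyConnected ε hε
  set η := min η₀ ε with hη
  have hη0 : 0 < η := lt_min hη₀ hε
  have hζ0 : ζ ≠ 0 := by rw [← norm_ne_zero_iff, hζ]; exact one_ne_zero
  have hmaps : ∀ z ∈ Metric.ball (1:ℂ) 1, ζ * (1 - z) ∈ Metric.ball (0:ℂ) 1 := fun z hz => by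
    rw [mem_ball_zero_iff, norm_mul, hζ, one_mul, norm_sub_rev]
    exact mem_ball_iff_norm.1 hz
  obtain ⟨r, ⟨hr0, hr1⟩, hr⟩ := exists_small_arc (ψ := fun z => φ (ζ * (1 - z)))
    (hφ.diff.comp (by fun_prop) hmaps)
    (fun z hz w hw e => by
      have := mul_left_cancel₀ hζ0 (hφ.injOn (hmaps z hz) (hmaps w hw) e)
      exact sub_right_injective this)
    (h.isBounded.subset (by rintro _ ⟨z, hz, rfl⟩; exact hφ.mapsTo _ (hmaps z hz)))
    (show 0 < η / 4 by positivity) one_pos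
  set C := Metric.ball (0:ℂ) 1 ∩ Metric.sphere ζ r with hC
  have hCosc : ∀ z₁ ∈ C, ∀ z₂ ∈ C, ‖φ z₁ - φ z₂‖ ≤ η / 4 := by
    have e : ∀ z : ℂ, ζ * (1 - (1 - z / ζ)) = z := fun z => by field_simp; ring
    have e2 : ∀ z ∈ C, (1 - z / ζ) ∈ Metric.ball (1:ℂ) 1 ∧ ‖1 - z / ζ‖ = r := fun z hz => by
      constructor
      · rw [mem_ball_iff_norm, sub_sub_cancel_left, norm_neg, norm_div, hζ, div_one]
        exact mem_ball_zero_iff.1 hz.1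
      · have : 1 - z / ζ = (ζ - z) / ζ := by field_simp
        rw [this, norm_div, hζ, div_one, norm_sub_rev]
        exact mem_sphere_iff_norm.1 hz.2
    intro z₁ h₁ z₂ h₂
    have := hr _ (e2 z₁ h₁).1 _ (e2 z₂ h₂).1 (e2 z₁ h₁).2 (e2 z₂ h₂).2
    simpa only [e] using this
  have hCp : IsPreconnected C := by
    rw [hC, arc_eq_image hζ hr0 hr1]
    exact isPreconnected_Ioo.image _ (continuous_arcPoint ζ r).continuousOn
  obtain ⟨τ, hτ, hprop⟩ := hφ.exists_infDist_lt h (show 0 < η / 4 by positivity)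
  obtain ⟨z₀, hz₀, hz₀n⟩ := exists_arc_norm_gt hζ hr0 hr1 hτ
  obtain ⟨a, haK, ha⟩ := (Metric.infDist_lt_iff h.bdry_nonempty).1 (hprop z₀ hz₀.1 hz₀n)
  obtain ⟨J, hJK, hJc, hJp, hJ1, hJ2⟩ := hJ a haK
  set S := closure (φ '' C) with hS
  have hSball : S ⊆ Metric.closedBall a (η / 2) := by
    refine closure_minimal ?_ Metric.isClosed_closedBall
    rintro _ ⟨z, hz, rfl⟩
    have h1 := hCosc z hz z₀ hz₀
    rw [← dist_eq_norm] at h1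
    rw [Metric.mem_closedBall]
    linarith [dist_triangle (φ z) (φ z₀) a]
  have hSc : IsCompact S := (isCompact_closedBall a (η/2)).of_isClosed_subset isClosed_closure hSball
  have hSp : IsPreconnected S :=
    (hCp.image φ (hφ.diff.continuousOn.mono inter_subset_left)).closure
  have hKS : K ∩ S ⊆ J := fun z hz => hJ1 ⟨hz.1, Metric.closedBall_subset_closedBall
    (by have := min_le_left η₀ ε; linarith) (hSball hz.2)⟩
  have hSJ : S ∪ J ⊆ Metric.closedBall a ε := union_subset (hSball.trans
    (Metric.closedBall_subset_closedBall (by have := min_le_right η₀ ε; linarith))) hJ2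
  refine ⟨r, hr0, a, fun z' hz' => ?_⟩
  by_contra hout
  have hout0 : φ 0 ∉ Metric.closedBall a ε := fun hc => by
    have := Metric.infDist_le_dist_of_mem (x := φ 0) haK
    rw [Metric.mem_closedBall] at hc
    linarith
  have hw' : φ z' ∉ K := h.disjoint.notMem_of_mem_left (hφ.mapsTo z' hz'.1)
  have hlog1 := hasLog_div_of_preconnected h.isPreconnected h.isCompact.isClosed h.disjoint
    (hφ.mapsTo 0 h00) (hφ.mapsTo z' hz'.1)
  have hlog2 := hasLog_div_of_preconnected (isPreconnected_compl_closedBall a ε)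
    (hSc.union hJc).isClosed (disjoint_left.2 fun z h1 h2 => h1 (hSJ h2)) hout0 hout
  have hinter : K ∩ (S ∪ J) = J := by
    rw [inter_union_distrib_left, inter_eq_self_of_subset_right hJK]
    exact union_eq_self_of_subset_left hKS
  have hlog := HasLog.union_of_isClosed (by rw [hinter]; exact hJp) h.isCompact.isClosed
    (hSc.union hJc).isClosed hlog1 hlog2
  have hcomp := mem_connectedComponentIn_of_hasLog (h.isCompact.union (hSc.union hJc))
    (by rintro (h1 | h1); exacts [hw0 h1, hout0 (hSJ h1)])
    (by rintro (h1 | h1); exacts [hw' h1, hout (hSJ h1)]) hlog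
  set Z := connectedComponentIn (K ∪ (S ∪ J))ᶜ (φ 0) with hZ
  have hZsub : Z ⊆ (K ∪ (S ∪ J))ᶜ := connectedComponentIn_subset _ _
  have h0Z : φ 0 ∈ Z := mem_connectedComponentIn
    (by rintro (h1 | h1); exacts [hw0 h1, hout0 (hSJ h1)])
  have hZp : IsPreconnected Z := isPreconnected_connectedComponentIn
  have hZW : Z ⊆ W := h.subset_of_preconnected hZp
    (disjoint_left.2 fun z h1 h2 => hZsub h1 (Or.inl h2)) ⟨_, h0Z, hφ.mapsTo 0 h00⟩
  have hcont : ContinuousOn (fun w => dist (f w) ζ) Z :=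
    (continuous_id.dist continuous_const).comp_continuousOn (hφ.cont_inv.mono hZW)
  have := hZp.intermediate_value hcomp h0Z hcont
  obtain ⟨v, hvZ, hv⟩ := this (show r ∈ Icc (dist (f (φ z')) ζ) (dist (f (φ 0)) ζ) by
    rw [hφ.left_inv z' hz'.1, hφ.left_inv 0 h00]
    refine ⟨le_of_lt hz'.2, ?_⟩
    rw [dist_zero_left, hζ]; exact hr1.le)
  refine hZsub hvZ (Or.inr (Or.inl (subset_closure ⟨f v, ⟨hφ.inv_mapsTo v (hZW hvZ), hv⟩,
    hφ.right_inv v (hZW hvZ)⟩)))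

open Filter Topology in
lemma exists_tendsto (hφ : RiemannMap W φ f) (h : ContinuumDomain W K) {ζ : ℂ}
    (hζ : ‖ζ‖ = 1) : ∃ y ∈ K, Tendsto φ (𝓝[Metric.ball 0 1] ζ) (𝓝 y) := by
  have hcl : ζ ∈ closure (Metric.ball (0:ℂ) 1) := by
    rw [closure_ball _ one_ne_zero]; simp [hζ]
  have : (𝓝[Metric.ball (0:ℂ) 1] ζ).NeBot := mem_closure_iff_nhdsWithin_neBot.1 hcl
  have hc : Cauchy (map φ (𝓝[Metric.ball 0 1] ζ)) := by
    rw [Metric.cauchy_iff]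
    refine ⟨inferInstance, fun ε hε => ?_⟩
    obtain ⟨r, hr, a, ha⟩ := hφ.exists_image_subset_closedBall h hζ (show 0 < ε / 3 by positivity)
    refine ⟨_, image_mem_map (inter_mem self_mem_nhdsWithin
      (mem_nhdsWithin_of_mem_nhds (Metric.ball_mem_nhds ζ hr))), ?_⟩
    rintro _ ⟨z, hz, rfl⟩ _ ⟨w, hw, rfl⟩
    have h1 := ha z hz
    have h2 := ha w hw
    rw [Metric.mem_closedBall] at h1 h2
    linarith [dist_triangle_right (φ z) (φ w) a]
  obtain ⟨y, hy⟩ := CompleteSpace.complete hc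
  refine ⟨y, ?_, hy⟩
  rw [h.isCompact.isClosed.mem_iff_infDist_zero h.bdry_nonempty]
  refine le_antisymm (le_of_forall_pos_le_add fun η hη => ?_) Metric.infDist_nonneg
  obtain ⟨τ, hτ, hprop⟩ := hφ.exists_infDist_lt h hη
  have hT : Tendsto (fun z => Metric.infDist (φ z) K) (𝓝[Metric.ball 0 1] ζ)
      (𝓝 (Metric.infDist y K)) := ((Metric.continuous_infDist_pt K).tendsto y).comp hy
  refine le_of_tendsto hT ?_
  have h1 : ∀ᶠ z in 𝓝[Metric.ball 0 1] ζ, 1 - τ < ‖z‖ :=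
    (continuous_norm.continuousAt.eventually_const_lt
      (show 1 - τ < ‖ζ‖ by rw [hζ]; linarith)).filter_mono nhdsWithin_le_nhds
  filter_upwards [h1, self_mem_nhdsWithin] with z hz hz'
  linarith [hprop z hz' hz]

end RiemannMap

/-- A Riemann map of `W` extended continuously to the closed disk, with boundary values in `K`. -/
structure ExtendedRiemannMap (W K : Set ℂ) (φ : ℂ → ℂ) : Prop where
  cont : ContinuousOn φ (Metric.closedBall 0 1)
  diff : DifferentiableOn ℂ φ (Metric.ball 0 1)
  injOn : InjOn φ (Metric.ball 0 1)
  image_ball : φ '' Metric.ball 0 1 = W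
  deriv_ne : ∀ z ∈ Metric.ball (0:ℂ) 1, deriv φ z ≠ 0
  mapsTo_sphere : ∀ z ∈ Metric.sphere (0:ℂ) 1, φ z ∈ K

open Filter Topology in
/-- Carathéodory's theorem. -/
theorem ContinuumDomain.exists_extendedRiemannMap {W K : Set ℂ} (h : ContinuumDomain W K) :
    ∃ φ, ExtendedRiemannMap W K φ := by
  obtain ⟨φ, f, h1, h2, h3, h4⟩ := exists_riemann_map h.isOpen h.isPreconnected h.isBounded
    h.nonempty h.isPreconnected_compl
  have hφ : RiemannMap W φ f := ⟨h1, h2, fun z hz => (h3 z hz).1, fun z hz => (h3 z hz).2.1,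
    fun z hz => (h3 z hz).2.2, fun w hw => (h4 w hw).1, fun w hw => (h4 w hw).2⟩
  have hcl : closure (Metric.ball (0:ℂ) 1) = Metric.closedBall 0 1 := closure_ball _ one_ne_zero
  have hball : ∀ z ∈ Metric.ball (0:ℂ) 1, Tendsto φ (𝓝[Metric.ball 0 1] z) (𝓝 (φ z)) :=
    fun z hz => h1.continuousOn z hz
  have heq : EqOn (extendFrom (Metric.ball 0 1) φ) φ (Metric.ball 0 1) := fun z hz =>
    extendFrom_eq (subset_closure hz) (hball z hz)
  refine ⟨extendFrom (Metric.ball 0 1) φ, ?_, h1.congr heq, hφ.injOn.congr heq.symm, ?_, ?_, ?_⟩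
  · refine continuousOn_extendFrom hcl.ge fun z hz => ?_
    rw [mem_closedBall_zero_iff] at hz
    rcases hz.lt_or_eq with hz | hz
    · exact ⟨_, hball z (mem_ball_zero_iff.2 hz)⟩
    · obtain ⟨y, -, hy⟩ := hφ.exists_tendsto h hz
      exact ⟨y, hy⟩
  · rw [heq.image_eq, hφ.image_eq]
  · intro z hz
    rw [(heq.eventuallyEq_of_mem (Metric.isOpen_ball.mem_nhds hz)).deriv_eq]
    exact hφ.deriv_ne z hz
  · intro z hz
    rw [mem_sphere_zero_iff_norm] at hz
    obtain ⟨y, hyK, hy⟩ := hφ.exists_tendsto h hz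
    rw [extendFrom_eq (by rw [hcl]; simp [hz]) hy]
    exact hyK

open Filter Topology in
lemma continuousAt_dslope_diag {φ : ℂ → ℂ} {U : Set ℂ} (hU : IsOpen U)
    (hφ : DifferentiableOn ℂ φ U) {p : ℂ} (hp : p ∈ U) :
    ContinuousAt (fun q : ℂ × ℂ => dslope φ q.1 q.2) (p, p) := by
  rw [Metric.continuousAt_iff]
  intro c hc
  have hd : ContinuousAt (deriv φ) p :=
    ((hφ.deriv hU).continuousOn p hp).continuousAt (hU.mem_nhds hp)
  obtain ⟨r, hr, hrs⟩ := Metric.mem_nhds_iff.1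
    (inter_mem (hU.mem_nhds hp) (hd.preimage_mem_nhds (Metric.ball_mem_nhds _ (half_pos hc))))
  refine ⟨r, hr, fun {q} hq => ?_⟩
  rw [Prod.dist_eq, max_lt_iff] at hq
  have h1 : q.1 ∈ Metric.ball p r := hq.1
  have h2 : q.2 ∈ Metric.ball p r := hq.2
  rw [dslope_same]
  by_cases e : q.2 = q.1
  · rw [e, dslope_same]
    exact (Metric.mem_ball.1 (hrs h1).2).trans (half_lt_self hc)
  have hmv := (convex_ball p r).norm_image_sub_le_of_norm_hasDerivWithin_le (C := c / 2)
    (f := fun z => φ z - deriv φ p * z) (f' := fun z => deriv φ z - deriv φ p)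
    (fun z hz => (((hφ.differentiableAt (hU.mem_nhds (hrs hz).1)).hasDerivAt.sub
      ((hasDerivAt_id z).const_mul (deriv φ p))).congr_deriv (by simp)).hasDerivWithinAt)
    (fun z hz => by
      have := (hrs hz).2
      rw [mem_preimage, mem_ball_iff_norm] at this
      exact this.le) h1 h2
  have hne : q.2 - q.1 ≠ 0 := sub_ne_zero.2 e
  rw [dslope_of_ne _ e, slope_def_field, dist_eq_norm]
  have e3 : (φ q.2 - φ q.1) / (q.2 - q.1) - deriv φ p =
      ((φ q.2 - deriv φ p * q.2) - (φ q.1 - deriv φ p * q.1)) / (q.2 - q.1) := by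
    field_simp; ring
  rw [e3, norm_div, div_lt_iff₀ (norm_pos_iff.2 hne)]
  refine hmv.trans_lt ?_
  have := norm_pos_iff.2 hne
  nlinarith

open Filter Topology in
lemma continuousOn_dslope_prod {φ : ℂ → ℂ} {U S : Set ℂ} (hU : IsOpen U) (hUS : U ⊆ S)
    (hφ : DifferentiableOn ℂ φ U) (hc : ContinuousOn φ S) :
    ContinuousOn (fun q : ℂ × ℂ => dslope φ q.1 q.2) (U ×ˢ S) := by
  rintro ⟨p, s⟩ ⟨hp, hs⟩
  by_cases e : s = p
  · subst e
    exact (continuousAt_dslope_diag hU hφ hp).continuousWithinAt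
  have hne : ∀ᶠ q : ℂ × ℂ in 𝓝 (p, s), q.2 ≠ q.1 :=
    (isOpen_ne_fun continuous_snd continuous_fst).mem_nhds e
  have h1 : ContinuousWithinAt (fun q : ℂ × ℂ => (φ q.2 - φ q.1) / (q.2 - q.1)) (U ×ˢ S) (p, s) := by
    refine ContinuousWithinAt.div (ContinuousWithinAt.sub ?_ ?_)
      (continuous_snd.sub continuous_fst).continuousWithinAt (sub_ne_zero.2 e)
    · exact (hc s hs).comp (f := Prod.snd) continuous_snd.continuousWithinAt fun q hq => hq.2
    · exact ((hc p (hUS hp)).mono hUS).comp (f := Prod.fst) continuous_fst.continuousWithinAt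
        fun q hq => hq.1
  refine h1.congr_of_eventuallyEq ?_ ?_
  · filter_upwards [hne.filter_mono nhdsWithin_le_nhds] with q hq
    rw [dslope_of_ne _ hq, slope_def_field]
  · rw [dslope_of_ne _ e, slope_def_field]

lemma exp_two_mul_arctan (x : ℝ) :
    Complex.exp (2 * (Real.arctan x : ℂ) * Complex.I) = (1 + x * Complex.I) / (1 - x * Complex.I) := by
  have hc : (Real.cos (Real.arctan x) : ℂ) ≠ 0 := by exact_mod_cast (Real.cos_arctan_pos x).ne'
  have hs : (Real.sin (Real.arctan x) : ℂ) = x * Real.cos (Real.arctan x) := by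
    rw [← Complex.ofReal_mul]
    congr 1
    have := Real.tan_mul_cos (Real.cos_arctan_pos x).ne'
    rw [Real.tan_arctan] at this
    exact this.symm
  have e1 : Complex.exp (Real.arctan x * Complex.I) =
      Real.cos (Real.arctan x) * (1 + x * Complex.I) := by
    rw [Complex.exp_mul_I, ← Complex.ofReal_cos, ← Complex.ofReal_sin, hs]; ring
  have e2 : Complex.exp (-(Real.arctan x * Complex.I)) =
      Real.cos (Real.arctan x) * (1 - x * Complex.I) := by
    rw [← neg_mul, Complex.exp_mul_I, Complex.cos_neg, Complex.sin_neg, ← Complex.ofReal_cos,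
      ← Complex.ofReal_sin, hs]; ring
  have : 2 * (Real.arctan x : ℂ) * Complex.I =
      Real.arctan x * Complex.I - -(Real.arctan x * Complex.I) := by ring
  rw [this, Complex.exp_sub, e1, e2, mul_div_mul_left _ _ hc]

/-- The signed area deciding on which side of the line through `ζ₁`, `ζ₂` a point lies. -/
noncomputable def chordSide (ζ₁ ζ₂ z : ℂ) : ℝ := ((z - ζ₁) * starRingEnd ℂ (ζ₂ - ζ₁)).im

lemma continuous_chordSide (ζ₁ ζ₂ : ℂ) : Continuous (chordSide ζ₁ ζ₂) := by
  unfold chordSide; fun_prop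

lemma chordSide_combo (ζ₁ ζ₂ : ℂ) {x y : ℂ} {a b : ℝ} (hab : a + b = 1) :
    chordSide ζ₁ ζ₂ (a • x + b • y) = a * chordSide ζ₁ ζ₂ x + b * chordSide ζ₁ ζ₂ y := by
  have : a • x + b • y - ζ₁ = a • (x - ζ₁) + b • (y - ζ₁) := by
    have : ζ₁ = (a + b) • ζ₁ := by rw [hab, one_smul]
    nth_rw 1 [this]
    module
  rw [chordSide, this, add_mul, Complex.add_im, smul_mul_assoc, smul_mul_assoc, Complex.smul_im,
    Complex.smul_im]
  rfl

lemma convex_chordSide_pos (ζ₁ ζ₂ : ℂ) : Convex ℝ {z | 0 < chordSide ζ₁ ζ₂ z} := by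
  intro x hx y hy a b ha hb hab
  rw [mem_ofPred_eq] at *
  rw [chordSide_combo _ _ hab]
  rcases ha.eq_or_lt with rfl | ha
  · have : b = 1 := by linarith
    subst this; linarith
  · have := mul_pos ha hx
    have := mul_nonneg hb hy.le
    linarith

lemma chordSide_swap (ζ₁ ζ₂ z : ℂ) : chordSide ζ₂ ζ₁ z = -chordSide ζ₁ ζ₂ z := by
  simp only [chordSide, Complex.mul_im, map_sub, Complex.sub_re, Complex.sub_im, Complex.conj_re,
    Complex.conj_im]
  ring

/-- A point of the chord from `ζ₁` to `ζ₂` pushed off the chord. -/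
noncomputable def chordPoint (ζ₁ ζ₂ : ℂ) (t ε : ℝ) : ℂ :=
  ζ₁ + t * (ζ₂ - ζ₁) + ε * Complex.I * (ζ₂ - ζ₁)

lemma chordSide_chordPoint (ζ₁ ζ₂ : ℂ) (t ε : ℝ) :
    chordSide ζ₁ ζ₂ (chordPoint ζ₁ ζ₂ t ε) = ε * ‖ζ₂ - ζ₁‖ ^ 2 := by
  have : (chordPoint ζ₁ ζ₂ t ε - ζ₁) * starRingEnd ℂ (ζ₂ - ζ₁) =
      (t + ε * Complex.I) * ((‖ζ₂ - ζ₁‖ ^ 2 : ℝ) : ℂ) := by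
    rw [← Complex.normSq_eq_norm_sq, ← Complex.mul_conj, chordPoint]; ring
  rw [chordSide, this, Complex.im_mul_ofReal]
  simp

open Filter Topology in
/-- If a boundary map identifies the endpoints of a chord to `w`, no connected set missing `w` and
the domain contains boundary values from both sides of the chord. -/
theorem ExtendedRiemannMap.not_preconnected_across {W K : Set ℂ} {φ : ℂ → ℂ}
    (hφ : ExtendedRiemannMap W K φ) (h : ContinuumDomain W K) {ζ₁ ζ₂ w : ℂ} (hζ₁ : ‖ζ₁‖ = 1)
    (hζ₂ : ‖ζ₂‖ = 1) (hne : ζ₁ ≠ ζ₂) (h₁ : φ ζ₁ = w) (h₂ : φ ζ₂ = w) {C : Set ℂ}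
    (hC : IsPreconnected C) (hCW : Disjoint C W) (hwC : w ∉ C) {a₁ a₂ : ℂ} (ha₁ : ‖a₁‖ = 1)
    (ha₂ : ‖a₂‖ = 1) (hs₁ : 0 < chordSide ζ₁ ζ₂ a₁) (hs₂ : chordSide ζ₁ ζ₂ a₂ < 0)
    (hc₁ : φ a₁ ∈ C) (hc₂ : φ a₂ ∈ C) : False := by
  have hbc : Metric.ball (0:ℂ) 1 ⊆ Metric.closedBall 0 1 := Metric.ball_subset_closedBall
  have hmW : ∀ z ∈ Metric.ball (0:ℂ) 1, φ z ∈ W := fun z hz => hφ.image_ball ▸ mem_image_of_mem φ hz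
  have hwK : w ∈ K := h₁ ▸ hφ.mapsTo_sphere ζ₁ (by simp [hζ₁])
  have hwW : w ∉ W := h.disjoint.notMem_of_mem_right hwK
  -- the chord
  have hz : ∀ t ∈ Icc (0:ℝ) 1, chordPoint ζ₁ ζ₂ t 0 ∈ Metric.closedBall (0:ℂ) 1 ∧
      (chordPoint ζ₁ ζ₂ t 0 ∈ Metric.ball (0:ℂ) 1 ∨ φ (chordPoint ζ₁ ζ₂ t 0) = w) := by
    intro t ht
    have e : chordPoint ζ₁ ζ₂ t 0 = (1 - t) • ζ₁ + t • ζ₂ := by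
      simp only [chordPoint, Complex.real_smul]; push_cast; ring
    have hb : chordPoint ζ₁ ζ₂ t 0 ∈ Metric.ball (0:ℂ) 1 ∨ φ (chordPoint ζ₁ ζ₂ t 0) = w := by
      rcases ht.1.eq_or_lt with rfl | h0
      · right; rw [e]; simpa using h₁
      rcases ht.2.eq_or_lt with rfl | h1
      · right; rw [e]; simpa using h₂
      left
      rw [e]
      exact combo_mem_ball_of_ne (by simp [hζ₁]) (by simp [hζ₂]) hne (by linarith) h0 (by ring)
    refine ⟨?_, hb⟩
    rw [e]
    exact convex_closedBall (0:ℂ) 1 (by simp [hζ₁]) (by simp [hζ₂]) (by linarith [ht.2]) ht.1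
      (by ring)
  have hcp : Continuous fun q : ℝ × ℝ => chordPoint ζ₁ ζ₂ q.1 q.2 := by
    unfold chordPoint; fun_prop
  have hcz : Continuous fun t : ℝ => chordPoint ζ₁ ζ₂ t 0 := by
    unfold chordPoint; fun_prop
  set Γ := (fun t => φ (chordPoint ζ₁ ζ₂ t 0)) '' Icc 0 1 with hΓ
  have hγc : ContinuousOn (fun t => φ (chordPoint ζ₁ ζ₂ t 0)) (Icc 0 1) :=
    hφ.cont.comp hcz.continuousOn fun t ht => (hz t ht).1
  have hΓc : IsClosed Γ := (isCompact_Icc.image_of_continuousOn hγc).isClosed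
  -- half disks
  have hhalf : ∀ (ξ₁ ξ₂ a : ℂ), ‖a‖ = 1 → 0 < chordSide ξ₁ ξ₂ a →
      IsPreconnected (φ '' insert a (Metric.ball (0:ℂ) 1 ∩ {z | 0 < chordSide ξ₁ ξ₂ z})) := by
    intro ξ₁ ξ₂ a ha hpos
    have hcl : a ∈ closure (Metric.ball (0:ℂ) 1 ∩ {z | 0 < chordSide ξ₁ ξ₂ z}) := by
      have ho : IsOpen {z | 0 < chordSide ξ₁ ξ₂ z} :=
        isOpen_lt continuous_const (continuous_chordSide _ _)
      rw [inter_comm]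
      refine ho.inter_closure ⟨hpos, ?_⟩
      rw [closure_ball _ one_ne_zero]; simp [ha]
    refine IsPreconnected.image ?_ φ (hφ.cont.mono ?_)
    · exact ((convex_ball (0:ℂ) 1).inter (convex_chordSide_pos ξ₁ ξ₂)).isPreconnected.subset_closure
        (subset_insert _ _) (insert_subset hcl subset_closure)
    · exact insert_subset (by simp [ha]) (inter_subset_left.trans hbc)
  set S₁ := insert a₁ (Metric.ball (0:ℂ) 1 ∩ {z | 0 < chordSide ζ₁ ζ₂ z}) with hS₁
  set S₂ := insert a₂ (Metric.ball (0:ℂ) 1 ∩ {z | 0 < chordSide ζ₂ ζ₁ z}) with hS₂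
  have hS₁p := hhalf ζ₁ ζ₂ a₁ ha₁ hs₁
  have hS₂p := hhalf ζ₂ ζ₁ a₂ ha₂ (by rw [chordSide_swap]; linarith)
  have hC' : IsPreconnected ((C ∪ φ '' S₁) ∪ φ '' S₂) :=
    (hC.union (φ a₁) hc₁ (mem_image_of_mem φ (mem_insert _ _)) hS₁p).union (φ a₂) (Or.inl hc₂)
      (mem_image_of_mem φ (mem_insert _ _)) hS₂p
  have hCΓ : ∀ u ∈ C, u ∉ Γ := by
    rintro u hu ⟨t, ht, rfl⟩
    rcases (hz t ht).2 with hb | hb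
    · exact hCW.notMem_of_mem_left hu (hmW _ hb)
    · exact hwC (hb ▸ hu)
  have hbΓ : ∀ z ∈ Metric.ball (0:ℂ) 1, chordSide ζ₁ ζ₂ z ≠ 0 → φ z ∉ Γ := by
    rintro z hzb hzs ⟨t, ht, e⟩
    rcases (hz t ht).2 with hb | hb
    · have := hφ.injOn hb hzb e
      rw [← this, chordSide_chordPoint, zero_mul] at hzs
      exact hzs rfl
    · exact hwW (by rw [← hb, show φ (chordPoint ζ₁ ζ₂ t 0) = φ z from e]; exact hmW z hzb)
  have hdisj : Disjoint ((C ∪ φ '' S₁) ∪ φ '' S₂) Γ := by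
    rw [disjoint_left]
    rintro u ((hu | ⟨z, hz, rfl⟩) | ⟨z, hz, rfl⟩)
    · exact hCΓ u hu
    · rcases hz with rfl | hz
      · exact hCΓ _ hc₁
      · exact hbΓ z hz.1 (ne_of_gt hz.2)
    · rcases hz with rfl | hz
      · exact hCΓ _ hc₂
      · refine hbΓ z hz.1 ?_
        have := hz.2
        rw [mem_ofPred_eq, chordSide_swap] at this
        linarith
  -- choice of the push-off
  have hm : chordPoint ζ₁ ζ₂ (1/2) 0 ∈ Metric.ball (0:ℂ) 1 := by
    have e : chordPoint ζ₁ ζ₂ (1/2) 0 = (1/2 : ℝ) • ζ₁ + (1/2 : ℝ) • ζ₂ := by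
      simp only [chordPoint, Complex.real_smul]; push_cast; ring
    rw [e]
    exact combo_mem_ball_of_ne (by simp [hζ₁]) (by simp [hζ₂]) hne (by norm_num) (by norm_num)
      (by norm_num)
  have hce : Continuous fun ε : ℝ => chordPoint ζ₁ ζ₂ (1/2) ε := by
    unfold chordPoint; fun_prop
  obtain ⟨δ, hδ, hδb⟩ := Metric.nhds_basis_closedBall.mem_iff.1
    (hce.continuousAt.preimage_mem_nhds (Metric.isOpen_ball.mem_nhds hm))
  rw [Real.closedBall_eq_Icc, zero_sub, zero_add] at hδb
  have hδb' : ∀ ε ∈ Icc (-δ) δ, chordPoint ζ₁ ζ₂ (1/2) ε ∈ Metric.ball (0:ℂ) 1 ∧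
      chordPoint ζ₁ ζ₂ (1/2) (-ε) ∈ Metric.ball (0:ℂ) 1 := fun ε hε =>
    ⟨hδb hε, hδb ⟨by linarith [hε.2], by linarith [hε.1]⟩⟩
  have hds0 : ∀ s ∈ Metric.ball (0:ℂ) 1, ∀ t ∈ Icc (0:ℝ) 1,
      dslope φ s (chordPoint ζ₁ ζ₂ t 0) ≠ 0 := by
    intro s hs t ht
    by_cases e : chordPoint ζ₁ ζ₂ t 0 = s
    · rw [e, dslope_same]; exact hφ.deriv_ne s hs
    · rw [dslope_of_ne _ e, slope_def_field]
      refine div_ne_zero (sub_ne_zero.2 fun e' => ?_) (sub_ne_zero.2 e)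
      rcases (hz t ht).2 with hb | hb
      · exact e (hφ.injOn hb hs e')
      · exact hwW (by rw [← hb, e']; exact hmW s hs)
  have hdc := continuousOn_dslope_prod Metric.isOpen_ball hbc hφ.diff hφ.cont
  set G : ℝ × ℝ → ℂ := fun q => dslope φ (chordPoint ζ₁ ζ₂ (1/2) q.2) (chordPoint ζ₁ ζ₂ q.1 0) /
    dslope φ (chordPoint ζ₁ ζ₂ (1/2) (-q.2)) (chordPoint ζ₁ ζ₂ q.1 0) with hG
  have hGc : ContinuousOn G (Icc (0:ℝ) 1 ×ˢ Icc (-δ) δ) := by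
    refine ContinuousOn.div ?_ ?_ fun q hq => hds0 _ (hδb' q.2 hq.2).2 _ hq.1
    · exact hdc.comp (f := fun q : ℝ × ℝ => (chordPoint ζ₁ ζ₂ (1/2) q.2, chordPoint ζ₁ ζ₂ q.1 0))
        ((hce.comp continuous_snd).prodMk (hcz.comp continuous_fst)).continuousOn
        fun q hq => ⟨(hδb' q.2 hq.2).1, (hz q.1 hq.1).1⟩
    · exact hdc.comp (f := fun q : ℝ × ℝ => (chordPoint ζ₁ ζ₂ (1/2) (-q.2), chordPoint ζ₁ ζ₂ q.1 0))
        ((hce.comp continuous_snd.neg).prodMk (hcz.comp continuous_fst)).continuousOn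
        fun q hq => ⟨(hδb' q.2 hq.2).2, (hz q.1 hq.1).1⟩
  have huc := (isCompact_Icc.prod isCompact_Icc).uniformContinuousOn_of_continuous hGc
  obtain ⟨δ', hδ', hunif⟩ := Metric.uniformContinuousOn_iff.1 huc (1/2) (by norm_num)
  obtain ⟨ε, hε0, hε⟩ : ∃ ε : ℝ, 0 < ε ∧ ε < δ ∧ ε < δ' ∧ ε ≤ 1/2 :=
    ⟨min (min (δ/2) (δ'/2)) (1/2), by positivity, by
      have h1 := min_le_left (min (δ/2) (δ'/2)) (1/2)
      have h2 := min_le_left (δ/2) (δ'/2)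
      linarith, by
      have h1 := min_le_left (min (δ/2) (δ'/2)) (1/2)
      have h2 := min_le_right (δ/2) (δ'/2)
      linarith, min_le_right _ _⟩
  obtain ⟨hεδ, hεδ', hε2⟩ := hε
  have hεm : ε ∈ Icc (-δ) δ := ⟨by linarith, hεδ.le⟩
  have hG1 : ∀ t ∈ Icc (0:ℝ) 1, ‖G (t, ε) - 1‖ < 1 / 2 := by
    intro t ht
    have := hunif (t, ε) ⟨ht, hεm⟩ (t, 0) ⟨ht, by constructor <;> linarith⟩ (by
      rw [Prod.dist_eq, dist_self, Real.dist_eq, sub_zero, abs_of_pos hε0]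
      simpa using ⟨hδ', hεδ'⟩)
    have e : G (t, 0) = 1 := by
      rw [hG]
      simp only [neg_zero]
      exact div_self (hds0 _ hm t ht)
    rwa [e, dist_eq_norm] at this
  -- logarithms along the chord
  obtain ⟨hsp, hsm⟩ := hδb' ε hεm
  set sp := chordPoint ζ₁ ζ₂ (1/2) ε with hspd
  set sm := chordPoint ζ₁ ζ₂ (1/2) (-ε) with hsmd
  have hv : 0 < ‖ζ₂ - ζ₁‖ := norm_pos_iff.2 (sub_ne_zero.2 hne.symm)
  have hspC : φ sp ∈ (C ∪ φ '' S₁) ∪ φ '' S₂ := by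
    refine Or.inl (Or.inr ⟨sp, Or.inr ⟨hsp, ?_⟩, rfl⟩)
    rw [mem_ofPred_eq, chordSide_chordPoint]
    positivity
  have hsmC : φ sm ∈ (C ∪ φ '' S₁) ∪ φ '' S₂ := by
    refine Or.inr ⟨sm, Or.inr ⟨hsm, ?_⟩, rfl⟩
    rw [mem_ofPred_eq, chordSide_swap, chordSide_chordPoint, neg_mul, neg_neg]
    positivity
  obtain ⟨l, hlc, hl⟩ := hasLog_div_of_preconnected hC' hΓc hdisj hspC hsmC
  have hLc : ContinuousOn (fun t => l (φ (chordPoint ζ₁ ζ₂ t 0)) - Complex.log (G (t, ε)))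
      (Icc 0 1) := by
    refine (hlc.comp hγc fun t ht => mem_image_of_mem _ ht).sub (ContinuousOn.clog ?_ ?_)
    · exact hGc.comp (continuous_id.prodMk continuous_const).continuousOn fun t ht => ⟨ht, hεm⟩
    · intro t ht
      refine Complex.mem_slitPlane_of_norm_lt_one (z := G (t, ε) - 1) ?_ |> fun h => by
        simpa using h
      linarith [hG1 t ht]
  have hne2 : ∀ t : ℝ, ∀ e : ℝ, e ≠ 0 → chordPoint ζ₁ ζ₂ t 0 - chordPoint ζ₁ ζ₂ (1/2) e ≠ 0 := by
    intro t e he e'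
    have := congrArg (chordSide ζ₁ ζ₂) (sub_eq_zero.1 e')
    rw [chordSide_chordPoint, chordSide_chordPoint, zero_mul] at this
    exact mul_ne_zero he (pow_ne_zero 2 hv.ne') this.symm
  have hden : ∀ x : ℝ, (1 - x * Complex.I : ℂ) ≠ 0 := fun x e => by
    have := congrArg Complex.re e
    simp at this
  have hLexp : ∀ t ∈ Icc (0:ℝ) 1,
      Complex.exp (l (φ (chordPoint ζ₁ ζ₂ t 0)) - Complex.log (G (t, ε))) =
      Complex.exp (Real.pi * Complex.I + 2 * (Real.arctan ((t - 1/2) / ε) : ℂ) * Complex.I) := by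
    intro t ht
    have n1 := hne2 t ε hε0.ne'
    have n2 := hne2 t (-ε) (neg_ne_zero.2 hε0.ne')
    have d1 := hds0 sp hsp t ht
    have d2 := hds0 sm hsm t ht
    have hGne : G (t, ε) ≠ 0 := div_ne_zero d1 d2
    rw [Complex.exp_sub, hl _ (mem_image_of_mem _ ht), Complex.exp_log hGne, Complex.exp_add,
      Complex.exp_pi_mul_I, exp_two_mul_arctan]
    have e1 : φ (chordPoint ζ₁ ζ₂ t 0) - φ sp =
        dslope φ sp (chordPoint ζ₁ ζ₂ t 0) * (chordPoint ζ₁ ζ₂ t 0 - sp) := by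
      rw [mul_comm, ← smul_eq_mul, sub_smul_dslope]
    have e2 : φ (chordPoint ζ₁ ζ₂ t 0) - φ sm =
        dslope φ sm (chordPoint ζ₁ ζ₂ t 0) * (chordPoint ζ₁ ζ₂ t 0 - sm) := by
      rw [mul_comm, ← smul_eq_mul, sub_smul_dslope]
    have e3 : G (t, ε) = dslope φ sp (chordPoint ζ₁ ζ₂ t 0) / dslope φ sm (chordPoint ζ₁ ζ₂ t 0) :=
      rfl
    have e4 : chordPoint ζ₁ ζ₂ t 0 - sp =
        (ζ₂ - ζ₁) * (-(ε * Complex.I) * (1 + ((t - 1/2) / ε : ℝ) * Complex.I)) := by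
      have : (ε : ℂ) ≠ 0 := by exact_mod_cast hε0.ne'
      rw [hspd, chordPoint, chordPoint]
      push_cast
      field_simp
      linear_combination ((t - 1/2) * (ζ₂ - ζ₁)) * 2 * Complex.I_sq
    have e5 : chordPoint ζ₁ ζ₂ t 0 - sm =
        (ζ₂ - ζ₁) * ((ε * Complex.I) * (1 - ((t - 1/2) / ε : ℝ) * Complex.I)) := by
      have : (ε : ℂ) ≠ 0 := by exact_mod_cast hε0.ne'
      rw [hsmd, chordPoint, chordPoint]
      push_cast
      field_simp
      linear_combination ((t - 1/2) * (ζ₂ - ζ₁)) * 2 * Complex.I_sq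
    have hε' : (ε : ℂ) ≠ 0 := by exact_mod_cast hε0.ne'
    have hv' : ζ₂ - ζ₁ ≠ 0 := sub_ne_zero.2 hne.symm
    have hd := hden ((t - 1/2) / ε)
    have hI := Complex.I_ne_zero
    beta_reduce
    rw [e1, e2, e3, e4, e5]
    generalize (((t - 1/2) / ε : ℝ) : ℂ) = x at *
    generalize dslope φ sp (chordPoint ζ₁ ζ₂ t 0) = A at *
    generalize dslope φ sm (chordPoint ζ₁ ζ₂ t 0) = B at *
    generalize ζ₂ - ζ₁ = v at *
    field_simp
  obtain ⟨n, hn⟩ := log_sub_const isPreconnected_Icc hLc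
    (h₂ := fun t : ℝ => (Real.pi * Complex.I + 2 * (Real.arctan ((t - 1/2) / ε) : ℂ) * Complex.I))
    (by fun_prop) hLexp
  have hn0 := hn 0 (by simp)
  have hn1 := hn 1 (by simp)
  have hp0 : φ (chordPoint ζ₁ ζ₂ 0 0) = w := by rw [chordPoint]; simpa using h₁
  have hp1 : φ (chordPoint ζ₁ ζ₂ 1 0) = w := by rw [chordPoint]; simpa using h₂
  simp only [hp0] at hn0
  simp only [hp1] at hn1
  have harc : Real.arctan ((0 - 1/2) / ε) = -Real.arctan ((1 - 1/2) / ε) := by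
    rw [← Real.arctan_neg]; congr 1; ring
  rw [harc] at hn0
  have hdiff : Complex.log (G (0, ε)) - Complex.log (G (1, ε)) =
      ((4 * Real.arctan ((1 - 1/2) / ε) : ℝ) : ℂ) * Complex.I := by
    push_cast at hn0 hn1 ⊢
    linear_combination hn1 - hn0
  have hlog : ∀ t ∈ Icc (0:ℝ) 1, ‖Complex.log (G (t, ε))‖ ≤ 3 / 4 := fun t ht => by
    have := Complex.norm_log_one_add_half_le_self (hG1 t ht).le
    rw [add_sub_cancel] at this
    linarith [hG1 t ht]
  have harc2 : Real.pi / 4 ≤ Real.arctan ((1 - 1/2) / ε) := by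
    rw [← Real.arctan_one]
    refine Real.arctan_strictMono.monotone ?_
    rw [le_div_iff₀ hε0]; linarith
  have hnorm := congrArg norm hdiff
  rw [norm_mul, Complex.norm_I, mul_one, Complex.norm_real, Real.norm_of_nonneg (by
    linarith [Real.pi_pos])] at hnorm
  have := norm_sub_le (Complex.log (G (0, ε))) (Complex.log (G (1, ε)))
  linarith [hlog 0 (by simp), hlog 1 (by simp), Real.pi_gt_three]

lemma ExtendedRiemannMap.exists_ne {W K : Set ℂ} {φ : ℂ → ℂ} (hφ : ExtendedRiemannMap W K φ)
    (h : ContinuumDomain W K) {O : Set ℂ} (hO : IsOpen O) {a₀ : ℂ} (ha₀ : ‖a₀‖ = 1) (haO : a₀ ∈ O)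
    (w : ℂ) : ∃ a ∈ O, ‖a‖ = 1 ∧ φ a ≠ w := by
  by_contra hcon
  push Not at hcon
  have hcov : Metric.sphere (0:ℂ) 1 ⊆
      ⋃ c : Metric.sphere (0:ℂ) 1, {a : ℂ | (c : ℂ) * a ∈ O} := by
    intro a ha
    have ha1 : ‖a‖ = 1 := by simpa using ha
    have ha0 : a ≠ 0 := norm_ne_zero_iff.1 (by rw [ha1]; exact one_ne_zero)
    refine mem_iUnion.2 ⟨⟨a₀ / a, by simp [ha₀, ha1]⟩, ?_⟩
    simpa [div_mul_cancel₀ _ ha0] using haO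
  obtain ⟨F, hF⟩ := (isCompact_sphere (0:ℂ) 1).elim_finite_subcover _
    (fun c => hO.preimage (continuous_const.mul continuous_id)) hcov
  set g : ℂ → ℂ := fun z => ∏ c ∈ F, (φ ((c : ℂ) * z) - w) with hg
  have hcl : closure (Metric.ball (0:ℂ) 1) = Metric.closedBall 0 1 :=
    closure_ball _ one_ne_zero
  have hcn : ∀ c : Metric.sphere (0:ℂ) 1, ‖(c : ℂ)‖ = 1 := fun c => by simp
  have hgd : DiffContOnCl ℂ g (Metric.ball 0 1) := by
    constructor
    · refine DifferentiableOn.fun_finsetProd fun c _ => ?_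
      refine DifferentiableOn.sub_const (hφ.diff.comp (by fun_prop) fun z hz => ?_) _
      simpa [hcn c] using hz
    · rw [hcl]
      refine continuousOn_finsetProd _ fun c _ => ?_
      refine ContinuousOn.sub (hφ.cont.comp (by fun_prop) fun z hz => ?_) continuousOn_const
      simpa [hcn c] using hz
  have hz : EqOn g (fun _ => 0) (frontier (Metric.ball (0:ℂ) 1)) := by
    rw [frontier_ball _ one_ne_zero]
    intro z hz
    obtain ⟨c, hcF, hc⟩ := mem_iUnion₂.1 (hF hz)
    refine Finset.prod_eq_zero hcF (sub_eq_zero.2 (hcon _ hc ?_))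
    rw [norm_mul, hcn c, one_mul]; simpa using hz
  have h0 := Complex.eqOn_closure_of_eqOn_frontier Metric.isBounded_ball hgd diffContOnCl_const hz
    (subset_closure (Metric.mem_ball_self one_pos))
  rw [hg] at h0
  obtain ⟨c, -, hc⟩ := Finset.prod_eq_zero_iff.1 h0
  rw [mul_zero, sub_eq_zero] at hc
  have h1 : w ∈ K := by
    rw [← hcon a₀ haO ha₀]; exact hφ.mapsTo_sphere _ (by simpa using ha₀)
  have h2 : w ∈ W := by
    rw [← hc, ← hφ.image_ball]; exact mem_image_of_mem _ (Metric.mem_ball_self one_pos)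
  exact Set.disjoint_left.1 h.disjoint h2 h1

lemma exists_chordSide_pos {ζ₁ ζ₂ : ℂ} (hζ₁ : ‖ζ₁‖ = 1) (hζ₂ : ‖ζ₂‖ = 1) (hne : ζ₁ ≠ ζ₂) :
    ∃ a : ℂ, ‖a‖ = 1 ∧ 0 < chordSide ζ₁ ζ₂ a := by
  set v := ζ₂ - ζ₁ with hv
  have hv0 : 0 < ‖v‖ := norm_pos_iff.2 (sub_ne_zero.2 hne.symm)
  refine ⟨(v / ‖v‖ * Complex.I), ?_, ?_⟩
  · simp [hv0.ne']
  have e1 : chordSide ζ₁ ζ₂ ((v / ‖v‖ * Complex.I)) = ‖v‖ - (ζ₁ * star v).im := by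
    have : (v / ‖v‖ * Complex.I) * star v = ‖v‖ * Complex.I := by
      have h1 : v * star v = (‖v‖ : ℂ) ^ 2 := by
        rw [Complex.star_def, Complex.mul_conj, Complex.normSq_eq_norm_sq]; push_cast; ring
      have h2 : (‖v‖ : ℂ) ≠ 0 := by exact_mod_cast hv0.ne'
      field_simp
      linear_combination h1
    rw [chordSide, ← hv, ← Complex.star_def, sub_mul, this]
    simp
  rw [e1, sub_pos]
  have hlt : |(ζ₁ * star v).im| < ‖ζ₁ * star v‖ := by
    rw [Complex.abs_im_lt_norm]
    intro hre
    have h1 : ‖ζ₁ * star ζ₂‖ = 1 := by simp [hζ₁, hζ₂]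
    have h2 : (ζ₁ * star ζ₂).re = 1 := by
      have : ζ₁ * star v = ζ₁ * star ζ₂ - 1 := by
        have h3 : ζ₁ * star ζ₁ = 1 := by
          rw [Complex.star_def, Complex.mul_conj, Complex.normSq_eq_norm_sq, hζ₁]; simp
        rw [hv, star_sub, mul_sub, h3]
      rw [this] at hre
      simpa [sub_eq_zero] using hre
    have h3 : ζ₁ * star ζ₂ = 1 := by
      have h4 := Complex.sq_norm_sub_sq_re (ζ₁ * star ζ₂)
      rw [h1, h2] at h4
      apply Complex.ext
      · simpa using h2
      · have : (ζ₁ * star ζ₂).im = 0 := by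
          have : (ζ₁ * star ζ₂).im ^ 2 = 0 := by linarith
          exact pow_eq_zero_iff (two_ne_zero) |>.1 this
        simpa using this
    apply hne
    have h5 : ζ₂ * star ζ₂ = 1 := by
      rw [Complex.star_def, Complex.mul_conj, Complex.normSq_eq_norm_sq, hζ₂]; simp
    calc ζ₁ = ζ₁ * (ζ₂ * star ζ₂) := by rw [h5, mul_one]
      _ = ζ₂ * (ζ₁ * star ζ₂) := by ring
      _ = ζ₂ := by rw [h3, mul_one]
  rw [norm_mul, hζ₁, one_mul, norm_star] at hlt
  exact (le_abs_self _).trans_lt hlt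

lemma ExtendedRiemannMap.injOn_fiber {W K : Set ℂ} {φ : ℂ → ℂ} (hφ : ExtendedRiemannMap W K φ)
    (h : ContinuumDomain W K) {ζ₁ ζ₂ : ℂ} (hζ₁ : ‖ζ₁‖ = 1) (hζ₂ : ‖ζ₂‖ = 1)
    (he : φ ζ₁ = φ ζ₂) (hK : IsPreconnected (K \ {φ ζ₂})) : ζ₁ = ζ₂ := by
  by_contra hne
  have hmem : ∀ a : ℂ, ‖a‖ = 1 → φ a ≠ φ ζ₂ → φ a ∈ K \ {φ ζ₂} := fun a ha ha' =>
    ⟨hφ.mapsTo_sphere _ (by simpa using ha), ha'⟩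
  have key : ∀ ξ₁ ξ₂ : ℂ, ‖ξ₁‖ = 1 → ‖ξ₂‖ = 1 → ξ₁ ≠ ξ₂ →
      ∃ a : ℂ, 0 < chordSide ξ₁ ξ₂ a ∧ ‖a‖ = 1 ∧ φ a ≠ φ ζ₂ := by
    intro ξ₁ ξ₂ h₁ h₂ hne
    obtain ⟨a, ha, hs⟩ := exists_chordSide_pos h₁ h₂ hne
    exact hφ.exists_ne h (isOpen_lt continuous_const (continuous_chordSide ξ₁ ξ₂)) ha hs _
  obtain ⟨a₁, hs₁, ha₁, hφ₁⟩ := key _ _ hζ₁ hζ₂ hne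
  obtain ⟨a₂, hs₂, ha₂, hφ₂⟩ := key _ _ hζ₂ hζ₁ (Ne.symm hne)
  rw [chordSide_swap] at hs₂
  exact hφ.not_preconnected_across h hζ₁ hζ₂ hne he rfl hK
    (Set.disjoint_left.2 fun z hz hW => Set.disjoint_left.1 h.disjoint hW hz.1) (fun hz => hz.2 rfl)
    ha₁ ha₂ hs₁ (by linarith) (hmem _ ha₁ hφ₁) (hmem _ ha₂ hφ₂)

lemma chordSide_exp (α β ψ : ℝ) :
    chordSide (Complex.exp (α * Complex.I)) (Complex.exp (β * Complex.I))
      (Complex.exp (ψ * Complex.I)) =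
    4 * Real.sin ((ψ - α) / 2) * Real.sin ((β - α) / 2) * Real.sin ((ψ - β) / 2) := by
  have e : chordSide (Complex.exp (α * Complex.I)) (Complex.exp (β * Complex.I))
      (Complex.exp (ψ * Complex.I)) = (Real.sin ψ - Real.sin α) * (Real.cos β - Real.cos α) -
      (Real.cos ψ - Real.cos α) * (Real.sin β - Real.sin α) := by
    simp only [chordSide, map_sub, Complex.mul_im, Complex.sub_re, Complex.sub_im,
      Complex.conj_re, Complex.conj_im, Complex.exp_ofReal_mul_I_re, Complex.exp_ofReal_mul_I_im]
    ring
  have e2 : (ψ - β) / 2 = (ψ + α) / 2 - (β + α) / 2 := by ring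
  rw [e, Real.sin_sub_sin, Real.sin_sub_sin, Real.cos_sub_cos, Real.cos_sub_cos, e2, Real.sin_sub]
  ring

lemma ExtendedRiemannMap.exists_angle {W K : Set ℂ} {φ : ℂ → ℂ} (hφ : ExtendedRiemannMap W K φ)
    (h : ContinuumDomain W K) {α β : ℝ} (hαβ : α < β) (hβ : β < α + 2 * Real.pi) (w : ℂ) :
    ∃ ψ : ℝ, α < ψ ∧ ψ < β ∧ φ (Complex.exp (ψ * Complex.I)) ≠ w := by
  have hs : 0 < Real.sin ((β - α) / 2) :=
    Real.sin_pos_of_pos_of_lt_pi (by linarith) (by linarith)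
  set O : Set ℂ := {z | chordSide (Complex.exp (α * Complex.I)) (Complex.exp (β * Complex.I)) z < 0}
  have hm : Complex.exp (((α + β) / 2 : ℝ) * Complex.I) ∈ O := by
    have h1 : 0 < Real.sin (((α + β) / 2 - α) / 2) :=
      Real.sin_pos_of_pos_of_lt_pi (by linarith) (by linarith)
    have h2 : Real.sin (((α + β) / 2 - β) / 2) < 0 :=
      Real.sin_neg_of_neg_of_neg_pi_lt (by linarith) (by linarith)
    simp only [O, mem_ofPred_eq]
    rw [chordSide_exp]
    exact mul_neg_of_pos_of_neg (by positivity) h2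
  obtain ⟨a, haO, ha, hne⟩ := hφ.exists_ne h
    (isOpen_lt (continuous_chordSide _ _) continuous_const)
    (Complex.norm_exp_ofReal_mul_I _) hm w
  obtain ⟨ψ, hψ, rfl⟩ : ∃ ψ : ℝ, ψ ∈ Ioc α (α + 2 * Real.pi) ∧ Complex.exp (ψ * Complex.I) = a := by
    refine ⟨toIocMod Real.two_pi_pos α a.arg, toIocMod_mem_Ioc _ _ _, ?_⟩
    rw [toIocMod]
    push_cast
    have : ((a.arg : ℂ) - toIocDiv Real.two_pi_pos α a.arg • (2 * Real.pi : ℂ)) * Complex.I =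
        a.arg * Complex.I - toIocDiv Real.two_pi_pos α a.arg * (2 * Real.pi * Complex.I) := by
      rw [zsmul_eq_mul]; ring
    rw [this, Complex.exp_sub, Complex.exp_int_mul_two_pi_mul_I, div_one]
    simpa [ha] using Complex.norm_mul_exp_arg_mul_I a
  refine ⟨ψ, hψ.1, ?_, hne⟩
  by_contra hge
  push Not at hge
  have haO' : chordSide _ _ _ < 0 := haO
  rw [chordSide_exp] at haO'
  have h1 : 0 ≤ Real.sin ((ψ - α) / 2) :=
    Real.sin_nonneg_of_nonneg_of_le_pi (by linarith [hψ.1]) (by linarith [hψ.2])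
  have h2 : 0 ≤ Real.sin ((ψ - β) / 2) :=
    Real.sin_nonneg_of_nonneg_of_le_pi (by linarith) (by linarith [hψ.2])
  have : 0 ≤ 4 * Real.sin ((ψ - α) / 2) * Real.sin ((β - α) / 2) * Real.sin ((ψ - β) / 2) := by
    positivity
  linarith

lemma ExtendedRiemannMap.finite_fiber {W K : Set ℂ} {φ : ℂ → ℂ} (hφ : ExtendedRiemannMap W K φ)
    (h : ContinuumDomain W K) {ι : Type*} [Finite ι] {C : ι → Set ℂ} {p : ℂ}
    (hC : ∀ i, IsPreconnected (C i)) (hK : K \ {p} = ⋃ i, C i) :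
    {z : ℂ | ‖z‖ = 1 ∧ φ z = p}.Finite := by
  have := Fintype.ofFinite ι
  set A : Set ℝ := {θ | θ ∈ Ioc (-Real.pi) Real.pi ∧ φ (Complex.exp (θ * Complex.I)) = p} with hA
  suffices hAf : A.Finite by
    refine (hAf.image fun θ : ℝ => Complex.exp (θ * Complex.I)).subset ?_
    rintro z ⟨hz, hzp⟩
    have e : Complex.exp (z.arg * Complex.I) = z := by
      simpa [hz] using Complex.norm_mul_exp_arg_mul_I z
    exact ⟨z.arg, ⟨Complex.arg_mem_Ioc z, by rw [e, hzp]⟩, e⟩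
  by_contra hinf
  obtain ⟨F, hFA, hFc⟩ := Set.Infinite.exists_subset_card_eq hinf (Fintype.card ι + 2)
  set θ := F.orderEmbOfFin hFc
  have hθ : ∀ k, θ k ∈ A := fun k => hFA (Finset.orderEmbOfFin_mem F hFc k)
  have hψ : ∀ k : Fin (Fintype.card ι + 1), ∃ ψ : ℝ, θ k.castSucc < ψ ∧ ψ < θ k.succ ∧
      φ (Complex.exp (ψ * Complex.I)) ≠ p := fun k =>
    hφ.exists_angle h (θ.strictMono k.castSucc_lt_succ)
      (by linarith [(hθ k.castSucc).1.1, (hθ k.succ).1.2]) p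
  choose ψ hψ₁ hψ₂ hψp using hψ
  have hmem : ∀ k, ∃ i, φ (Complex.exp (ψ k * Complex.I)) ∈ C i := fun k => by
    rw [← mem_iUnion, ← hK]
    exact ⟨hφ.mapsTo_sphere _ (by simp [Complex.norm_exp_ofReal_mul_I]), hψp k⟩
  choose c hc using hmem
  obtain ⟨k, l, hkl, hcc⟩ := Fintype.exists_ne_map_eq_of_card_lt c (by simp)
  wlog hlt : k < l generalizing k l
  · exact this l k hkl.symm hcc.symm (lt_of_le_of_ne (not_lt.1 hlt) hkl.symm)
  have hα := (hθ k.castSucc)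
  have hβ := (hθ k.succ)
  have h1 : θ k.succ ≤ θ l.castSucc := θ.monotone (by
    rw [Fin.le_def]; simpa [Nat.succ_le_iff] using hlt)
  have h2 := hψ₁ k
  have h3 := hψ₂ k
  have h4 := hψ₁ l
  have h5 := hψ₂ l
  have h6 := (hθ l.succ).1.2
  have h7 := hα.1.1
  have hs : ∀ x : ℝ, 0 < x → x < 2 * Real.pi → 0 < Real.sin (x / 2) := fun x hx hx' =>
    Real.sin_pos_of_pos_of_lt_pi (by linarith) (by linarith)
  have hs₁ : 0 < chordSide (Complex.exp (θ k.castSucc * Complex.I))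
      (Complex.exp (θ k.succ * Complex.I)) (Complex.exp (ψ l * Complex.I)) := by
    rw [chordSide_exp]
    have := hs (ψ l - θ k.castSucc) (by linarith) (by linarith)
    have := hs (θ k.succ - θ k.castSucc) (by linarith) (by linarith)
    have := hs (ψ l - θ k.succ) (by linarith) (by linarith)
    positivity
  have hs₂ : chordSide (Complex.exp (θ k.castSucc * Complex.I))
      (Complex.exp (θ k.succ * Complex.I)) (Complex.exp (ψ k * Complex.I)) < 0 := by
    rw [chordSide_exp]
    have := hs (ψ k - θ k.castSucc) (by linarith) (by linarith)
    have := hs (θ k.succ - θ k.castSucc) (by linarith) (by linarith)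
    refine mul_neg_of_pos_of_neg (by positivity) ?_
    exact Real.sin_neg_of_neg_of_neg_pi_lt (by linarith) (by linarith)
  refine hφ.not_preconnected_across h (Complex.norm_exp_ofReal_mul_I _)
    (Complex.norm_exp_ofReal_mul_I _) ?_ hα.2 hβ.2 (hC (c l)) ?_ ?_
    (Complex.norm_exp_ofReal_mul_I _) (Complex.norm_exp_ofReal_mul_I _) hs₁ hs₂ (hc l)
    (hcc ▸ hc k)
  · intro e
    rw [e] at hs₂
    simp [chordSide] at hs₂
  · refine Set.disjoint_left.2 fun z hz hW => Set.disjoint_left.1 h.disjoint hW ?_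
    have : z ∈ K \ {p} := hK ▸ mem_iUnion_of_mem _ hz
    exact this.1
  · intro hp
    have : p ∈ K \ {p} := hK ▸ mem_iUnion_of_mem _ hp
    exact this.2 rfl

lemma IsCompact.homeomorph_diff_fiber {X Y : Set ℂ} {φ : ℂ → ℂ} {p : ℂ} (hX : IsCompact X)
    (hφ : ContinuousOn φ X) (hY : φ '' X = Y)
    (hinj : ∀ a ∈ X, ∀ b ∈ X, φ a = φ b → φ b ≠ p → a = b) {E : Set ℂ}
    (hE : ∀ z ∈ X, z ∈ E ↔ φ z = p) :
    Nonempty ((X \ E : Set ℂ) ≃ₜ (Y \ {p} : Set ℂ)) := by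
  have hmaps : ∀ z : (X \ E : Set ℂ), φ z ∈ Y \ {p} := fun z =>
    ⟨hY ▸ mem_image_of_mem _ z.2.1, fun e => z.2.2 ((hE _ z.2.1).2 e)⟩
  set F : (X \ E : Set ℂ) → (Y \ {p} : Set ℂ) := fun z => ⟨φ z, hmaps z⟩ with hF
  have hFc : Continuous F :=
    Continuous.subtype_mk (continuousOn_iff_continuous_domRestrict.1 (hφ.mono sdiff_subset)) _
  have hbij : Function.Bijective F := by
    constructor
    · intro a b hab
      have hab' : φ a = φ b := congrArg Subtype.val hab
      exact Subtype.ext (hinj a a.2.1 b b.2.1 hab' (hmaps b).2)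
    · rintro ⟨y, hyY, hyp⟩
      rw [← hY] at hyY
      obtain ⟨z, hz, rfl⟩ := hyY
      exact ⟨⟨z, hz, fun hzE => hyp ((hE z hz).1 hzE)⟩, rfl⟩
  have hcl : IsClosedMap F := by
    intro C hC
    obtain ⟨C', hC', rfl⟩ := isClosed_induced_iff.1 hC
    have h1 : IsClosed (φ '' (X ∩ C')) :=
      ((hX.inter_right hC').image_of_continuousOn (hφ.mono inter_subset_left)).isClosed
    convert h1.preimage (continuous_subtype_val (p := fun z => z ∈ Y \ {p})) using 1
    ext ⟨y, hy⟩
    constructor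
    · rintro ⟨z, hz, e⟩
      exact ⟨z, ⟨z.2.1, hz⟩, congrArg Subtype.val e⟩
    · rintro ⟨z, ⟨hz, hz'⟩, e⟩
      refine ⟨⟨z, hz, fun hzE => hy.2 ?_⟩, hz', Subtype.ext e⟩
      have e' : φ z = y := e
      rw [mem_singleton_iff, ← e', (hE z hz).1 hzE]
  exact ⟨(Equiv.ofBijective F hbij).toHomeomorphOfContinuousClosed hFc hcl⟩

theorem ContinuumDomain.exists_homeomorph {W K : Set ℂ} (h : ContinuumDomain W K) {p : ℂ}
    (hp : p ∈ K) (hcut : ∀ w ∈ K, w ≠ p → IsPreconnected (K \ {w}))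
    {ι : Type*} [Finite ι] {C : ι → Set ℂ}
    (hC : ∀ i, IsPreconnected (C i)) (hK : K \ {p} = ⋃ i, C i) :
    ∃ E ⊆ Metric.sphere (0:ℂ) 1, E.Finite ∧
      Nonempty ((Metric.closedBall (0:ℂ) 1 \ E : Set ℂ) ≃ₜ (closure W \ {p} : Set ℂ)) := by
  obtain ⟨φ, hφ⟩ := h.exists_extendedRiemannMap
  have hball : ∀ z, ‖z‖ ≤ 1 → (z ∈ Metric.ball (0:ℂ) 1 ∧ φ z ∈ W) ∨ (‖z‖ = 1 ∧ φ z ∈ K) := by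
    intro z hz
    rcases hz.lt_or_eq with hz | hz
    · have : z ∈ Metric.ball (0:ℂ) 1 := by simpa using hz
      exact Or.inl ⟨this, hφ.image_ball ▸ mem_image_of_mem _ this⟩
    · exact Or.inr ⟨hz, hφ.mapsTo_sphere _ (by simpa using hz)⟩
  have hWK : ∀ z ∈ W, z ∉ K := fun z hz => Set.disjoint_left.1 h.disjoint hz
  refine ⟨{z | ‖z‖ = 1 ∧ φ z = p}, fun z hz => by simpa using hz.1,
    hφ.finite_fiber h hC hK, (isCompact_closedBall 0 1).homeomorph_diff_fiber hφ.cont ?_ ?_ ?_⟩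
  · refine subset_antisymm ?_ ?_
    · have := hφ.cont
      rw [← closure_ball (0:ℂ) one_ne_zero] at this ⊢
      have h2 := this.image_closure
      rwa [hφ.image_ball] at h2
    · refine closure_minimal ?_ ((isCompact_closedBall 0 1).image_of_continuousOn hφ.cont).isClosed
      rw [← hφ.image_ball]
      exact image_mono Metric.ball_subset_closedBall
  · intro a ha b hb hab hbp
    rcases hball a (by simpa using ha) with ⟨ha', haW⟩ | ⟨ha', haK⟩ <;>
      rcases hball b (by simpa using hb) with ⟨hb', hbW⟩ | ⟨hb', hbK⟩
    · exact hφ.injOn ha' hb' hab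
    · exact absurd hbK (hWK _ (hab ▸ haW))
    · exact absurd haK (hWK _ (hab ▸ hbW))
    · exact hφ.injOn_fiber h ha' hb' hab (hcut _ hbK hbp)
  · intro z hz
    refine ⟨fun hz => hz.2, fun hz' => ⟨?_, hz'⟩⟩
    rcases hball z (by simpa using hz) with ⟨ha', haW⟩ | ⟨ha', haK⟩
    · exact absurd hp (hWK _ (hz' ▸ haW))
    · exact ha'

lemma isPreconnected_iUnion_of_mem {X : Type*} [TopologicalSpace X] {ι : Sort*} {s : ι → Set X}
    {x : X} (hx : ∀ i, x ∈ s i) (hs : ∀ i, IsPreconnected (s i)) : IsPreconnected (⋃ i, s i) :=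
  isPreconnected_iUnion ⟨x, mem_iInter.2 hx⟩ hs

lemma isCompact_iUnion_range_of_periodic {ι : Type*} [Finite ι] {c : ι → ℝ → ℂ}
    (hc : ∀ i, Continuous (c i)) (hp : ∀ i, Function.Periodic (c i) Real.pi) :
    IsCompact (⋃ i, range (c i)) := by
  refine isCompact_iUnion fun i => ?_
  rw [← (hp i).image_Icc Real.pi_pos 0]
  exact isCompact_Icc.image (hc i)

lemma locallyConnected_iUnion_range {ι : Type*} [Finite ι] {c : ι → ℝ → ℂ}
    (hc : ∀ i, Continuous (c i)) (hp : ∀ i, Function.Periodic (c i) Real.pi) {ε : ℝ} (hε : 0 < ε) :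
    ∃ η > 0, ∀ a ∈ ⋃ i, range (c i), ∃ J ⊆ ⋃ i, range (c i), IsCompact J ∧ IsPreconnected J ∧
      (⋃ i, range (c i)) ∩ Metric.closedBall a η ⊆ J ∧ J ⊆ Metric.closedBall a ε := by
  have := Fintype.ofFinite ι
  set K := ⋃ i, range (c i) with hK
  have hKc : IsCompact K := isCompact_iUnion_range_of_periodic hc hp
  have huc := isCompact_Icc (a := -Real.pi) (b := 2 * Real.pi) |>.uniformContinuousOn_of_continuous
    (f := fun t => fun i => c i t) (continuous_pi hc).continuousOn
  obtain ⟨δ₀, hδ₀, hδ⟩ := Metric.uniformContinuousOn_iff.1 huc (ε / 2) (by positivity)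
  obtain ⟨δ, hδpos, hδlt, hδπ⟩ : ∃ δ, 0 < δ ∧ δ < δ₀ ∧ δ ≤ Real.pi :=
    ⟨min (δ₀ / 2) Real.pi, lt_min (by positivity) Real.pi_pos,
      (min_le_left _ _).trans_lt (by linarith), min_le_right _ _⟩
  have hlocal : ∀ p : K, ∃ η, 0 < η ∧ η ≤ ε / 2 ∧ ∃ J ⊆ K, IsCompact J ∧ IsPreconnected J ∧
      K ∩ Metric.ball p η ⊆ J ∧ J ⊆ Metric.closedBall p (ε / 2) := by
    rintro ⟨p, hpK⟩
    set B : Set ℂ := ⋃ q : {q : ι × ℝ // q.2 ∈ Icc 0 Real.pi ∧ c q.1 q.2 = p},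
      c q.1.1 '' Metric.closedBall q.1.2 δ with hB
    set R : Set ℂ := ⋃ i, c i '' (Icc 0 Real.pi \
      ⋃ t : {t : ℝ // t ∈ Icc 0 Real.pi ∧ c i t = p}, Metric.ball (t : ℝ) δ) with hR
    have hRc : IsCompact R := isCompact_iUnion fun i =>
      (isCompact_Icc.diff (isOpen_iUnion fun t => Metric.isOpen_ball)).image (hc i)
    have hpR : p ∉ R := by
      intro h
      obtain ⟨i, t, ⟨ht, htn⟩, e⟩ := mem_iUnion.1 h
      exact htn (mem_iUnion.2 ⟨⟨t, ht, e⟩, Metric.mem_ball_self hδpos⟩)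
    obtain ⟨r, hr, hrR⟩ := Metric.isOpen_iff.1 hRc.isClosed.isOpen_compl p hpR
    have hBK : B ⊆ K := iUnion_subset fun q => (image_subset_range _ _).trans
      (subset_iUnion (fun i => range (c i)) q.1.1)
    have hBb : B ⊆ Metric.closedBall p (ε / 2) := by
      refine iUnion_subset fun q => ?_
      rintro _ ⟨s, hs, rfl⟩
      obtain ⟨⟨i, t⟩, ht, rfl⟩ := q
      have hst : dist s t ≤ δ := hs
      have hst' := abs_le.1 (Real.dist_eq s t ▸ hst)
      have ht' : t ∈ Icc 0 Real.pi := ht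
      have h1 := hδ s ⟨by linarith [hst'.1, ht'.1], by linarith [hst'.2, ht'.2]⟩ t
        ⟨by linarith [ht'.1, Real.pi_pos], by linarith [ht'.2, Real.pi_pos]⟩ (hst.trans_lt hδlt)
      exact ((dist_pi_lt_iff (by positivity)).1 h1 i).le
    refine ⟨min r (ε / 2), by positivity, min_le_right _ _, closure B,
      closure_minimal hBK hKc.isClosed, hKc.of_isClosed_subset isClosed_closure
        (closure_minimal hBK hKc.isClosed), IsPreconnected.closure ?_, ?_,
      closure_minimal hBb Metric.isClosed_closedBall⟩
    · refine isPreconnected_iUnion_of_mem (x := p) (fun q => ?_) fun q => ?_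
      · exact ⟨q.1.2, Metric.mem_closedBall_self hδpos.le, q.2.2⟩
      · exact ((convex_closedBall _ _).isPreconnected).image _ (hc _).continuousOn
    · rintro z ⟨hzK, hzb⟩
      have hzR : z ∉ R := hrR (Metric.ball_subset_ball (min_le_left _ _) hzb)
      obtain ⟨i, hi⟩ := mem_iUnion.1 hzK
      rw [← (hp i).image_Icc Real.pi_pos 0, zero_add] at hi
      obtain ⟨s, hs, rfl⟩ := hi
      have : s ∈ ⋃ t : {t : ℝ // t ∈ Icc 0 Real.pi ∧ c i t = p}, Metric.ball (t : ℝ) δ := by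
        by_contra hn
        exact hzR (mem_iUnion.2 ⟨i, s, ⟨hs, hn⟩, rfl⟩)
      obtain ⟨t, ht⟩ := mem_iUnion.1 this
      exact subset_closure (mem_iUnion.2 ⟨⟨(i, t), t.2⟩, s, Metric.ball_subset_closedBall ht, rfl⟩)
  choose η hη hηε J hJK hJc hJp hJ hJb using hlocal
  obtain ⟨δ', hδ', hleb⟩ := lebesgue_number_lemma_of_metric hKc
    (fun p : K => Metric.isOpen_ball (x := (p : ℂ)) (ε := η p))
    (fun p hp => mem_iUnion.2 ⟨⟨p, hp⟩, Metric.mem_ball_self (hη _)⟩)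
  refine ⟨δ' / 2, by positivity, fun a ha => ?_⟩
  obtain ⟨p, hp⟩ := hleb a ha
  refine ⟨J p, hJK p, hJc p, hJp p, ?_, ?_⟩
  · exact (inter_subset_inter_right _ ((Metric.closedBall_subset_ball (by linarith)).trans hp)).trans
      (hJ p)
  · refine (hJb p).trans (Metric.closedBall_subset_closedBall' ?_)
    have : dist a p < η p := hp (Metric.mem_ball_self hδ')
    rw [dist_comm] at this
    linarith [hηε p]

/-- The closed loop through the origin obtained by inverting the curve `f` at the point `b`,
parametrized through the tangent. -/
noncomputable def invLoop (f : ℝ → ℂ) (b : ℂ) (t : ℝ) : ℂ :=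
  if Real.cos t = 0 then 0 else (f (Real.tan t) - b)⁻¹

lemma invLoop_of_cos_eq_zero {f : ℝ → ℂ} {b : ℂ} {t : ℝ} (h : Real.cos t = 0) :
    invLoop f b t = 0 := if_pos h

lemma invLoop_of_cos_ne_zero {f : ℝ → ℂ} {b : ℂ} {t : ℝ} (h : Real.cos t ≠ 0) :
    invLoop f b t = (f (Real.tan t) - b)⁻¹ := if_neg h

lemma periodic_invLoop (f : ℝ → ℂ) (b : ℂ) : Function.Periodic (invLoop f b) Real.pi := by
  intro t
  simp [invLoop, Real.cos_add_pi, Real.tan_add_pi]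

lemma invLoop_eq_zero_iff {f : ℝ → ℂ} {b : ℂ} (hb : b ∉ range f) {t : ℝ} :
    invLoop f b t = 0 ↔ Real.cos t = 0 := by
  refine ⟨fun h => ?_, invLoop_of_cos_eq_zero⟩
  by_contra hc
  rw [invLoop_of_cos_ne_zero hc, inv_eq_zero, sub_eq_zero] at h
  exact hb ⟨_, h⟩

lemma continuous_invLoop {f : ℝ → ℂ} (hf : IsProperMap f) {b : ℂ} (hb : b ∉ range f) :
    Continuous (invLoop f b) := by
  refine continuous_iff_continuousAt.2 fun t => ?_
  by_cases hc : Real.cos t = 0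
  · have h1 : Filter.Tendsto f (Filter.cocompact ℝ) (Filter.cocompact ℂ) :=
      (isProperMap_iff_tendsto_cocompact.1 hf).2
    have h2 : Filter.Tendsto Real.tan (nhdsWithin t {t}ᶜ) (Filter.cocompact ℝ) := by
      rw [← Metric.cobounded_eq_cocompact, ← tendsto_norm_atTop_iff_cobounded]
      exact Real.tendsto_abs_tan_of_cos_eq_zero hc
    have h3 := h1.comp h2
    have h4 : Filter.Tendsto (fun s => (f (Real.tan s) - b)⁻¹) (nhdsWithin t {t}ᶜ) (nhds 0) := by
      refine Filter.tendsto_inv₀_cobounded.comp ?_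
      rw [← Metric.cobounded_eq_cocompact] at h3
      have h5 : Filter.Tendsto (fun z : ℂ => z - b) (Bornology.cobounded ℂ)
          (Bornology.cobounded ℂ) := by
        rw [Metric.cobounded_eq_cocompact]
        exact (Homeomorph.subRight b).isClosedEmbedding.tendsto_cocompact
      exact h5.comp h3
    rw [continuousAt_iff_punctured_nhds, invLoop_of_cos_eq_zero hc]
    refine squeeze_zero_norm' (Filter.Eventually.of_forall fun s => ?_) (h4.norm.trans (by simp))
    rw [invLoop]
    split_ifs <;> simp
  · have hev : ∀ᶠ s in nhds t, Real.cos s ≠ 0 :=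
      Real.continuous_cos.continuousAt.eventually_ne hc
    have : invLoop f b =ᶠ[nhds t] fun s => (f (Real.tan s) - b)⁻¹ :=
      hev.mono fun s hs => invLoop_of_cos_ne_zero hs
    rw [continuousAt_congr this]
    refine ContinuousAt.inv₀ ?_ (sub_ne_zero.2 fun e => hb ⟨_, e⟩)
    exact (hf.continuous.continuousAt.comp (Real.continuousAt_tan.2 hc)).sub continuousAt_const

lemma range_invLoop (f : ℝ → ℂ) (b : ℂ) :
    range (invLoop f b) = insert 0 ((fun z => (z - b)⁻¹) '' range f) := by
  refine subset_antisymm ?_ (insert_subset ⟨Real.pi / 2, invLoop_of_cos_eq_zero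
    Real.cos_pi_div_two⟩ ?_)
  · rintro _ ⟨t, rfl⟩
    rw [invLoop]
    split_ifs
    · exact mem_insert _ _
    · exact Or.inr ⟨_, mem_range_self _, rfl⟩
  · rintro _ ⟨_, ⟨u, rfl⟩, rfl⟩
    refine ⟨Real.arctan u, ?_⟩
    rw [invLoop_of_cos_ne_zero (Real.cos_arctan_pos u).ne', Real.tan_arctan]

lemma range_invLoop_eq_image (f : ℝ → ℂ) (b : ℂ) :
    range (invLoop f b) = invLoop f b '' Icc (-(Real.pi / 2)) (Real.pi / 2) := by
  rw [← (periodic_invLoop f b).image_Icc Real.pi_pos (-(Real.pi / 2))]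
  congr 2; ring

section Bouquet

variable {ι : Type*} {f : ι → ℝ → ℂ} {b : ℂ}

lemma invLoop_injOn (hinj : ∀ i, Function.Injective (f i))
    (hdisj : ∀ i j, i ≠ j → Disjoint (range (f i)) (range (f j))) {i j : ι} {s t : ℝ}
    (hs : s ∈ Ioo (-(Real.pi / 2)) (Real.pi / 2)) (ht : t ∈ Ioo (-(Real.pi / 2)) (Real.pi / 2))
    (h : invLoop (f i) b s = invLoop (f j) b t) : i = j ∧ s = t := by
  rw [invLoop_of_cos_ne_zero (Real.cos_pos_of_mem_Ioo hs).ne',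
    invLoop_of_cos_ne_zero (Real.cos_pos_of_mem_Ioo ht).ne', inv_inj, sub_left_inj] at h
  have hij : i = j := by
    by_contra hij
    exact Set.disjoint_left.1 (hdisj i j hij) ⟨_, rfl⟩ ⟨_, h.symm⟩
  subst hij
  exact ⟨rfl, Real.injOn_tan hs ht (hinj i h)⟩

lemma bouquet_diff_zero (hb : ∀ i, b ∉ range (f i)) :
    (⋃ i, range (invLoop (f i) b)) \ {0} =
      ⋃ i, invLoop (f i) b '' Ioo (-(Real.pi / 2)) (Real.pi / 2) := by
  ext z
  constructor
  · rintro ⟨hz, hz0⟩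
    obtain ⟨i, hi⟩ := mem_iUnion.1 hz
    rw [range_invLoop_eq_image] at hi
    obtain ⟨t, ht, rfl⟩ := hi
    refine mem_iUnion.2 ⟨i, t, ⟨ht.1.lt_of_ne ?_, ht.2.lt_of_ne ?_⟩, rfl⟩
    · rintro rfl
      exact hz0 (invLoop_of_cos_eq_zero (by simp))
    · rintro rfl
      exact hz0 (invLoop_of_cos_eq_zero (by simp))
  · intro hz
    obtain ⟨i, t, ht, rfl⟩ := mem_iUnion.1 hz
    exact ⟨mem_iUnion.2 ⟨i, mem_range_self _⟩, fun h =>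
      (Real.cos_pos_of_mem_Ioo ht).ne' ((invLoop_eq_zero_iff (hb i)).1 h)⟩

lemma bouquet_preconnected (hf : ∀ i, IsProperMap (f i)) (hb : ∀ i, b ∉ range (f i)) :
    IsPreconnected (⋃ i, range (invLoop (f i) b)) := by
  have h0 : ∀ i, (0:ℂ) ∈ range (invLoop (f i) b) := fun i => by
    rw [range_invLoop]; exact mem_insert _ _
  refine isPreconnected_iUnion_of_mem h0 fun i => ?_
  exact isPreconnected_range (continuous_invLoop (hf i) (hb i))

lemma bouquet_diff_singleton (hf : ∀ i, IsProperMap (f i)) (hb : ∀ i, b ∉ range (f i))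
    (hinj : ∀ i, Function.Injective (f i))
    (hdisj : ∀ i j, i ≠ j → Disjoint (range (f i)) (range (f j))) {w : ℂ}
    (hw : w ∈ ⋃ i, range (invLoop (f i) b)) (hw0 : w ≠ 0) :
    IsPreconnected ((⋃ i, range (invLoop (f i) b)) \ {w}) := by
  classical
  have hw' : w ∈ (⋃ i, range (invLoop (f i) b)) \ {0} := ⟨hw, hw0⟩
  rw [bouquet_diff_zero hb] at hw'
  obtain ⟨j, s, hs, rfl⟩ := mem_iUnion.1 hw'
  set c := fun i => invLoop (f i) b with hcdef
  have hc : ∀ i, Continuous (c i) := fun i => continuous_invLoop (hf i) (hb i)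
  have hm : c j (-(Real.pi / 2)) = 0 := invLoop_of_cos_eq_zero (by simp)
  have hp : c j (Real.pi / 2) = 0 := invLoop_of_cos_eq_zero (by simp)
  set D : ι → Set ℂ := fun i => if i = j then
    c j '' Ico (-(Real.pi / 2)) s ∪ c j '' Ioc s (Real.pi / 2) else range (c i) with hD
  have h0 : ∀ i, (0:ℂ) ∈ D i := by
    intro i
    by_cases hij : i = j
    · rw [hD]; simp only [if_pos hij]
      exact Or.inl ⟨_, ⟨le_rfl, hs.1⟩, hm⟩
    · rw [hD]; simp only [if_neg hij]
      simp only [c]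
      rw [range_invLoop]; exact mem_insert _ _
  have hDp : ∀ i, IsPreconnected (D i) := by
    intro i
    by_cases hij : i = j
    · rw [hD]; simp only [if_pos hij]
      exact IsPreconnected.union 0 ⟨_, ⟨le_rfl, hs.1⟩, hm⟩ ⟨_, ⟨hs.2, le_rfl⟩, hp⟩
        (isPreconnected_Ico.image _ (hc j).continuousOn)
        (isPreconnected_Ioc.image _ (hc j).continuousOn)
    · rw [hD]; simp only [if_neg hij]
      exact isPreconnected_range (hc i)
  have heq : (⋃ i, range (c i)) \ {c j s} = ⋃ i, D i := by
    ext z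
    constructor
    · rintro ⟨hz, hzw⟩
      obtain ⟨i, hi⟩ := mem_iUnion.1 hz
      refine mem_iUnion.2 ⟨i, ?_⟩
      by_cases hij : i = j
      · subst hij
        rw [hD]; simp only [if_true]
        simp only [c] at hi
        rw [range_invLoop_eq_image] at hi
        obtain ⟨t, ht, rfl⟩ := hi
        rcases lt_trichotomy t s with h | h | h
        · exact Or.inl ⟨t, ⟨ht.1, h⟩, rfl⟩
        · exact absurd (by rw [h]; rfl) hzw
        · exact Or.inr ⟨t, ⟨h, ht.2⟩, rfl⟩
      · rw [hD]; simp only [if_neg hij]; exact hi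
    · intro hz
      obtain ⟨i, hi⟩ := mem_iUnion.1 hz
      have key : ∀ t ∈ Icc (-(Real.pi / 2)) (Real.pi / 2), c i t = c j s → i = j ∧ t = s := by
        intro t ht e
        have h0 : c i t ≠ 0 := e ▸ hw0
        refine invLoop_injOn hinj hdisj ⟨ht.1.lt_of_ne ?_, ht.2.lt_of_ne ?_⟩ hs e
        · rintro rfl; exact h0 (invLoop_of_cos_eq_zero (by simp))
        · rintro rfl; exact h0 (invLoop_of_cos_eq_zero (by simp))
      by_cases hij : i = j
      · subst hij
        rw [hD] at hi; simp only [if_true] at hi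
        rcases hi with ⟨t, ht, rfl⟩ | ⟨t, ht, rfl⟩
        · exact ⟨mem_iUnion.2 ⟨i, mem_range_self _⟩, fun e =>
            ht.2.ne (key t ⟨ht.1, ht.2.le.trans hs.2.le⟩ e).2⟩
        · exact ⟨mem_iUnion.2 ⟨i, mem_range_self _⟩, fun e =>
            ht.1.ne' (key t ⟨hs.1.le.trans ht.1.le, ht.2⟩ e).2⟩
      · rw [hD] at hi; simp only [if_neg hij] at hi
        refine ⟨mem_iUnion.2 ⟨i, hi⟩, fun e => ?_⟩
        simp only [c] at hi
        rw [range_invLoop_eq_image] at hi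
        obtain ⟨t, ht, rfl⟩ := hi
        exact hij (key t ht e).1
  change IsPreconnected ((⋃ i, range (c i)) \ {c j s})
  rw [heq]
  exact isPreconnected_iUnion_of_mem h0 hDp

end Bouquet

lemma hasLog_compl_image_Icc {γ : ℝ → ℂ} (hγ : Continuous γ) {a b : ℝ} (hab : a ≤ b) :
    HasLog (fun z => (z - γ b) / (z - γ a)) (γ '' Icc a b)ᶜ := by
  classical
  set A := (γ '' Icc a b)ᶜ with hA
  set s : unitInterval → ℝ := fun t => a + t * (b - a) with hs
  have hsm : ∀ t, s t ∈ Icc a b := fun t =>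
    ⟨by have := mul_nonneg t.2.1 (sub_nonneg.2 hab); simp only [hs]; linarith,
      by have := mul_le_of_le_one_left (sub_nonneg.2 hab) t.2.2; simp only [hs]; linarith⟩
  have hne : ∀ (t : unitInterval) (z : A), (z : ℂ) - γ (s t) ≠ 0 := fun t z e =>
    z.2 ⟨s t, hsm t, (sub_eq_zero.1 e).symm⟩
  have hs0 : s 0 = a := by simp [hs]
  have hs1 : s 1 = b := by simp [hs]
  have hsc : Continuous s := by fun_prop
  let H : C(unitInterval × A, {z : ℂ // z ≠ 0}) :=
    ⟨fun q => ⟨((q.2 : ℂ) - γ (s q.1)) / ((q.2 : ℂ) - γ (s 0)),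
      div_ne_zero (hne _ _) (hne _ _)⟩, by
      refine Continuous.subtype_mk (Continuous.div ?_ ?_ fun q => hne _ _) _
      · exact (continuous_subtype_val.comp continuous_snd).sub
          (hγ.comp (hsc.comp continuous_fst))
      · exact (continuous_subtype_val.comp continuous_snd).sub continuous_const⟩
  have H0 : ∀ z : A, H (0, z) = ⟨_, Complex.exp_ne_zero ((0 : C(A, ℂ)) z)⟩ := fun z =>
    Subtype.ext (by simpa [H] using div_self (hne 0 z))
  set L := Complex.isCoveringMap_exp.liftHomotopy H 0 H0
  have hL : ∀ z : A, Complex.exp (L (1, z)) = ((z : ℂ) - γ b) / ((z : ℂ) - γ a) := fun z => by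
    have : Complex.exp (L (1, z)) = ((z : ℂ) - γ (s 1)) / ((z : ℂ) - γ (s 0)) :=
      congrArg Subtype.val (congrFun (Complex.isCoveringMap_exp.liftHomotopy_lifts H 0 H0) (1, z))
    rwa [hs0, hs1] at this
  refine ⟨fun z => if hz : z ∈ A then L (1, ⟨z, hz⟩) else 0, ?_, fun z hz => ?_⟩
  · rw [continuousOn_iff_continuous_domRestrict]
    have : Continuous fun z : A => L (1, z) := by fun_prop
    convert this using 1
    ext z
    simp
  · simp only [dif_pos hz]
    exact hL ⟨z, hz⟩

lemma not_hasLog_compl_pair {p q : ℂ} (hpq : p ≠ q) :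
    ¬ HasLog (fun z => (z - p) / (z - q)) {p, q}ᶜ := by
  rintro ⟨h, hc, he⟩
  have hd : 0 < ‖p - q‖ := norm_pos_iff.2 (sub_ne_zero.2 hpq)
  have hpq' : p - q ≠ 0 := sub_ne_zero.2 hpq
  have hsub : ∀ z ∈ Metric.sphere p (‖p - q‖ / 2), ‖z - p‖ = ‖p - q‖ / 2 := fun z hz => by
    rw [← dist_eq_norm]; exact hz
  have hzq : ∀ z ∈ Metric.sphere p (‖p - q‖ / 2), z ≠ q := fun z hz e => by
    have := hsub z hz
    rw [e, norm_sub_rev] at this; linarith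
  have hzp : ∀ z ∈ Metric.sphere p (‖p - q‖ / 2), z ≠ p := fun z hz e => by
    have := hsub z hz
    rw [e, sub_self, norm_zero] at this; linarith
  refine not_hasLog_sphere p (R := ‖p - q‖ / 2) (by positivity)
    ⟨fun z => h z + (Complex.log ((z - q) / (p - q)) + Complex.log (p - q)), ?_, ?_⟩
  · refine (hc.mono fun z hz => ?_).add ((ContinuousOn.clog (by fun_prop) fun z hz => ?_).add
      continuousOn_const)
    · simp [hzq z hz, hzp z hz]
    · have e : (z - q) / (p - q) = 1 + (z - p) / (p - q) := by field_simp; ring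
      rw [e]
      refine Complex.mem_slitPlane_of_norm_lt_one ?_
      rw [norm_div, hsub z hz, div_lt_one hd]; linarith
  · intro z hz
    have h1 := sub_ne_zero.2 (hzq z hz)
    rw [Complex.exp_add, Complex.exp_add, he z (by simp [hzq z hz, hzp z hz]),
      Complex.exp_log (div_ne_zero h1 hpq'), Complex.exp_log hpq']
    field_simp

lemma not_isPreconnected_compl_loop {c : ℝ → ℂ} (hc : Continuous c) {a b d : ℝ} (hab : a ≤ b)
    (hbd : b ≤ d) (had : c a = c d) (hne : c a ≠ c b)
    (hI : c '' Icc a b ∩ c '' Icc b d ⊆ {c a, c b}) : ¬ IsPreconnected (c '' Icc a d)ᶜ := by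
  intro hcon
  have hcl : ∀ s t : ℝ, IsOpen (c '' Icc s t)ᶜ := fun s t =>
    (isCompact_Icc.image hc).isClosed.isOpen_compl
  have h₁ := hasLog_div_symm (hasLog_compl_image_Icc hc hab)
  have h₂ := hasLog_compl_image_Icc hc hbd
  rw [← had] at h₂
  have hu : c '' Icc a b ∪ c '' Icc b d = c '' Icc a d := by
    rw [← image_union, Icc_union_Icc_eq_Icc hab hbd]
  rw [← hu, compl_union] at hcon
  refine not_hasLog_compl_pair hne ((HasLog.union_of_isOpen hcon (hcl _ _) (hcl _ _) h₁ h₂).mono ?_)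
  rw [← compl_inter]
  exact compl_subset_compl.2 hI

lemma exists_bounded_component {J : Set ℂ} (hJ : IsCompact J) (hJc : ¬ IsPreconnected Jᶜ) :
    ∃ O : Set ℂ, IsOpen O ∧ O.Nonempty ∧ Bornology.IsBounded O ∧ Disjoint O J ∧ frontier O ⊆ J := by
  obtain ⟨R, hR⟩ := hJ.isBounded.subset_closedBall 0
  have hfar : {z : ℂ | R < ‖z‖} ⊆ Jᶜ := fun z hz hzJ => by
    have := hR hzJ
    rw [mem_closedBall_zero_iff] at this
    exact absurd hz (not_lt.2 this)
  obtain ⟨z₀, hz₀⟩ : ∃ z₀ : ℂ, R < ‖z₀‖ := by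
    refine ⟨((|R| + 1 : ℝ) : ℂ), ?_⟩
    rw [Complex.norm_real, Real.norm_eq_abs, abs_of_pos (by positivity)]
    linarith [le_abs_self R]
  have hsub : {z : ℂ | R < ‖z‖} ⊆ connectedComponentIn Jᶜ z₀ :=
    (isPreconnected_norm_gt R).subset_connectedComponentIn hz₀ hfar
  obtain ⟨u, huJ, hu⟩ : ∃ u ∈ Jᶜ, u ∉ connectedComponentIn Jᶜ z₀ := by
    by_contra hcon
    push Not at hcon
    refine hJc ?_
    have : Jᶜ = connectedComponentIn Jᶜ z₀ :=
      subset_antisymm hcon (connectedComponentIn_subset _ _)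
    rw [this]
    exact isPreconnected_connectedComponentIn
  refine ⟨connectedComponentIn Jᶜ u, hJ.isClosed.isOpen_compl.connectedComponentIn,
    ⟨u, mem_connectedComponentIn huJ⟩, ?_, ?_, ?_⟩
  · refine Metric.isBounded_closedBall (x := (0:ℂ)) (r := R) |>.subset fun z hz => ?_
    rw [mem_closedBall_zero_iff]
    by_contra hlt
    have h1 := connectedComponentIn_eq hz
    have h2 := connectedComponentIn_eq (hsub (not_le.1 hlt))
    exact hu (by rw [h2, ← h1]; exact mem_connectedComponentIn huJ)
  · exact Set.disjoint_left.2 fun z hz hzJ => connectedComponentIn_subset _ _ hz hzJ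
  · have := frontier_connectedComponentIn_subset hJ.isClosed.isOpen_compl u
    rwa [compl_compl] at this

lemma exists_open_disjoint_of_line {f : ℝ → ℂ} (hf : IsProperMap f) (hinj : Function.Injective f)
    {x : ℂ} (hx : x ∉ range f) {U : Set ℂ} (hU : IsPreconnected U) (hUf : Disjoint U (range f))
    (hxU : x ∈ U) : ∃ O : Set ℂ, IsOpen O ∧ O.Nonempty ∧ Disjoint U O := by
  set c := invLoop f x with hcd
  have hc : Continuous c := continuous_invLoop hf hx
  have hm : c (-(Real.pi / 2)) = 0 := invLoop_of_cos_eq_zero (by simp)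
  have hp : c (Real.pi / 2) = 0 := invLoop_of_cos_eq_zero (by simp)
  have hπ := Real.pi_pos
  have h0 : c 0 ≠ 0 := fun h => by simpa using (invLoop_eq_zero_iff hx).1 h
  have hnz : ∀ t ∈ Ioo (-(Real.pi / 2)) (Real.pi / 2), c t ≠ 0 := fun t ht h =>
    (Real.cos_pos_of_mem_Ioo ht).ne' ((invLoop_eq_zero_iff hx).1 h)
  have hnp : ¬ IsPreconnected (range c)ᶜ := by
    rw [hcd, range_invLoop_eq_image]
    refine not_isPreconnected_compl_loop hc (b := 0) (by linarith) (by linarith)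
      (hm.trans hp.symm) (by rw [hm]; exact h0.symm) ?_
    rintro _ ⟨⟨s, hs, rfl⟩, t, ht, hst⟩
    rw [hm]
    by_cases h : c s = 0
    · exact Or.inl h
    · have hs' : s ∈ Ioo (-(Real.pi / 2)) (Real.pi / 2) :=
        ⟨hs.1.lt_of_ne (by rintro rfl; exact h hm), by linarith [hs.2]⟩
      have ht' : t ∈ Ioo (-(Real.pi / 2)) (Real.pi / 2) :=
        ⟨by linarith [ht.1], ht.2.lt_of_ne (by rintro rfl; exact h (hst ▸ hp))⟩
      have := (invLoop_injOn (ι := Unit) (f := fun _ => f) (fun _ => hinj)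
        (fun i j h => absurd rfl h) (i := ()) (j := ()) hs' ht' hst.symm).2
      have hs0 : s = 0 := le_antisymm hs.2 (this ▸ ht.1)
      exact Or.inr (by rw [hs0]; rfl)
  have hJ : IsCompact (range c) := by
    rw [hcd, range_invLoop_eq_image]
    exact isCompact_Icc.image hc
  obtain ⟨O, hO, ⟨u, hu⟩, hOb, hOJ, hOf⟩ := exists_bounded_component hJ hnp
  obtain ⟨R, hR0, hR⟩ := hOb.subset_closedBall_lt 0 0
  have hzO : (0:ℂ) ∉ O := fun h => Set.disjoint_left.1 hOJ h ⟨_, hm⟩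
  set g : ℂ → ℂ := fun z => (z - x)⁻¹ with hg
  have hgc : ∀ z, z ≠ x → ContinuousAt g z := fun z hz =>
    (continuousAt_id.sub continuousAt_const).inv₀ (sub_ne_zero.2 hz)
  have hpre : g ⁻¹' O ⊆ {x}ᶜ := by
    rintro z hz rfl
    simp only [mem_preimage, hg, sub_self, inv_zero] at hz
    exact hzO hz
  have hopen : IsOpen (g ⁻¹' O) := by
    have : ContinuousOn g {x}ᶜ := fun z hz => (hgc z hz).continuousWithinAt
    have h2 := this.isOpen_inter_preimage isOpen_compl_singleton hO
    rwa [inter_eq_right.2 hpre] at h2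
  have hxcl : x ∉ closure (g ⁻¹' O) := by
    intro h
    obtain ⟨z, hz, hzd⟩ := Metric.mem_closure_iff.1 h (1 / R) (by positivity)
    have h1 : ‖(z - x)⁻¹‖ ≤ R := by
      have := hR hz
      rwa [mem_closedBall_zero_iff] at this
    rw [norm_inv] at h1
    rw [dist_comm, dist_eq_norm, lt_div_iff₀ hR0] at hzd
    have h2 : 0 < ‖z - x‖ := norm_pos_iff.2 (sub_ne_zero.2 (hpre hz))
    rw [inv_le_iff_one_le_mul₀ h2] at h1
    linarith [mul_comm R ‖z - x‖]
  refine ⟨g ⁻¹' O, hopen, ⟨x + u⁻¹, by simpa [hg] using hu⟩, ?_⟩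
  by_contra hnd
  rw [Set.not_disjoint_iff] at hnd
  obtain ⟨y, hyU, hyO⟩ := hnd
  have hsub : U ⊆ g ⁻¹' O := by
    refine hU.subset_of_closure_inter_subset hopen ⟨y, hyU, hyO⟩ ?_
    rintro z ⟨hzc, hzU⟩
    have hzx : z ≠ x := by rintro rfl; exact hxcl hzc
    by_contra hzO'
    have h1 : g z ∈ closure O := by
      refine closure_mono (image_preimage_subset g O) ?_
      exact mem_closure_image (hgc z hzx) hzc
    have h2 : g z ∈ range c := hOf ⟨h1, fun h => hzO' (interior_subset (s := O) h)⟩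
    rw [hcd, range_invLoop] at h2
    rcases h2 with h2 | ⟨v, hv, hvz⟩
    · exact inv_ne_zero (sub_ne_zero.2 hzx) h2
    · have : v = z := by simpa [hg] using hvz
      exact Set.disjoint_left.1 hUf hzU (this ▸ hv)
  exact hpre (hsub hxU) rfl

lemma dense_compl_range_line {f : ℝ → ℂ} (hf : IsProperMap f) (hinj : Function.Injective f) :
    Dense (range f)ᶜ := by
  rw [← interior_eq_empty_iff_dense_compl, eq_empty_iff_forall_notMem]
  intro y hy
  obtain ⟨r, hr, hsub⟩ := Metric.mem_nhds_iff.1 (mem_interior_iff_mem_nhds.1 hy)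
  obtain ⟨t, rfl⟩ := hsub (Metric.mem_ball_self hr)
  have hball : IsPreconnected (Metric.ball (f t) r \ {f t}) := by
    have : Metric.ball (f t) r \ {f t} =
        (fun w => f t + Complex.exp w) '' {w | w.re < Real.log r} := by
      ext z
      constructor
      · rintro ⟨hz, hzt⟩
        have h0 : z - f t ≠ 0 := sub_ne_zero.2 hzt
        refine ⟨Complex.log (z - f t), ?_, by simp [Complex.exp_log h0]⟩
        rw [mem_ofPred_eq, Complex.log_re]
        exact Real.log_lt_log (norm_pos_iff.2 h0) (by rw [← dist_eq_norm]; exact hz)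
      · rintro ⟨w, hw, rfl⟩
        refine ⟨?_, by simp⟩
        rw [Metric.mem_ball, dist_eq_norm, add_sub_cancel_left, Complex.norm_exp]
        exact (Real.lt_log_iff_exp_lt hr).1 hw
    rw [this]
    exact (convex_halfSpace_re_lt _).isPreconnected.image _
      (continuous_const.add Complex.continuous_exp).continuousOn
  have hpre := (hball.preimage_of_isClosedMap hinj hf.isClosedMap
    (sdiff_subset.trans hsub)).ordConnected
  obtain ⟨ε, hε, hεs⟩ := Metric.isOpen_iff.1 (Metric.isOpen_ball.preimage hf.continuous) t
    (Metric.mem_ball_self (x := f t) hr)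
  have hmem : ∀ s : ℝ, |s| = ε / 2 → t + s ∈ f ⁻¹' (Metric.ball (f t) r \ {f t}) := by
    intro s hs
    refine ⟨hεs ?_, fun e => ?_⟩
    · rw [Metric.mem_ball, Real.dist_eq, add_sub_cancel_left, hs]; linarith
    · have : s = 0 := by simpa using hinj e
      rw [this, abs_zero] at hs; linarith
  have := hpre.out (hmem (-(ε / 2)) (by rw [abs_neg, abs_of_pos (by positivity)]))
    (hmem (ε / 2) (abs_of_pos (by positivity)))
    (show t ∈ Icc _ _ from ⟨by linarith, by linarith⟩)
  exact this.2 rfl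

lemma exists_notMem_closure {ι : Type*} [Finite ι] [Nonempty ι] {f : ι → ℝ → ℂ}
    (hf : ∀ i, IsProperMap (f i)) (hinj : ∀ i, Function.Injective (f i)) {x : ℂ} {U : Set ℂ}
    (hU : IsPreconnected U) (hUf : ∀ i, Disjoint U (range (f i))) (hxU : x ∈ U) :
    ∃ b, b ∉ closure U ∧ ∀ i, b ∉ range (f i) := by
  obtain ⟨i₀⟩ := ‹Nonempty ι›
  obtain ⟨O, hO, hOne, hUO⟩ := exists_open_disjoint_of_line (hf i₀) (hinj i₀)
    (Set.disjoint_left.1 (hUf i₀) hxU) hU (hUf i₀) hxU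
  have hd : Dense (⋂ i, (range (f i))ᶜ) := dense_iInter_of_isOpen
    (fun i => (hf i).isClosed_range.isOpen_compl) fun i => dense_compl_range_line (hf i) (hinj i)
  obtain ⟨b, hbO, hb⟩ := hd.inter_open_nonempty O hO hOne
  refine ⟨b, fun hbU => ?_, fun i => mem_iInter.1 hb i⟩
  exact Set.disjoint_left.1 (hUO.closure_left hO) hbU hbO

theorem exists_homeomorph_closure_component {ι : Type*} [Finite ι] [Nonempty ι] {f : ι → ℝ → ℂ}
    (hf : ∀ i, IsProperMap (f i)) (hinj : ∀ i, Function.Injective (f i))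
    (hdisj : ∀ i j, i ≠ j → Disjoint (range (f i)) (range (f j))) {x : ℂ}
    (hx : x ∈ (⋃ i, range (f i))ᶜ) :
    ∃ E ⊆ Metric.sphere (0:ℂ) 1, E.Finite ∧ Nonempty ((Metric.closedBall (0:ℂ) 1 \ E : Set ℂ) ≃ₜ
      closure (connectedComponentIn (⋃ i, range (f i))ᶜ x)) := by
  set O := (⋃ i, range (f i))ᶜ with hOdef
  have hO : IsOpen O := (isClosed_iUnion_of_finite fun i => (hf i).isClosed_range).isOpen_compl
  set U := connectedComponentIn O x with hUdef
  have hUo : IsOpen U := hO.connectedComponentIn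
  have hUp : IsPreconnected U := isPreconnected_connectedComponentIn
  have hUO : U ⊆ O := connectedComponentIn_subset _ _
  have hUf : ∀ i, Disjoint U (range (f i)) := fun i =>
    Set.disjoint_left.2 fun z hz hzi => hUO hz (mem_iUnion.2 ⟨i, hzi⟩)
  have hxU : x ∈ U := mem_connectedComponentIn hx
  have hfr : ∀ z ∈ closure U, z ∉ U → z ∈ ⋃ i, range (f i) := fun z hz hzU => by
    have := frontier_connectedComponentIn_subset hO x
      (show z ∈ frontier U from ⟨hz, fun h => hzU (interior_subset h)⟩)
    rwa [hOdef, compl_compl] at this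
  obtain ⟨b, hbU, hb⟩ := exists_notMem_closure hf hinj hUp hUf hxU
  set g : ℂ → ℂ := fun z => (z - b)⁻¹ with hg
  set h : ℂ → ℂ := fun w => b + w⁻¹ with hh
  have hgc : ∀ z, z ≠ b → ContinuousAt g z := fun z hz =>
    (continuousAt_id.sub continuousAt_const).inv₀ (sub_ne_zero.2 hz)
  have hhc : ∀ w, w ≠ 0 → ContinuousAt h w := fun w hw =>
    continuousAt_const.add (continuousAt_id.inv₀ hw)
  have hgh : ∀ w, g (h w) = w := fun w => by simp [hg, hh]
  have hhg : ∀ z, h (g z) = z := fun z => by simp [hg, hh]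
  have hg0 : ∀ z, z ≠ b → g z ≠ 0 := fun z hz => inv_ne_zero (sub_ne_zero.2 hz)
  have hclb : ∀ z ∈ closure U, z ≠ b := fun z hz e => hbU (e ▸ hz)
  have hUb : ∀ z ∈ U, z ≠ b := fun z hz => hclb z (subset_closure hz)
  set W := g '' U with hW
  have hWpre : W = h ⁻¹' U := by
    ext w
    constructor
    · rintro ⟨z, hz, rfl⟩
      rwa [mem_preimage, hhg]
    · exact fun hw => ⟨h w, hw, hgh w⟩
  have hW0 : W ⊆ {0}ᶜ := by
    rintro _ ⟨z, hz, rfl⟩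
    exact hg0 z (hUb z hz)
  set K := ⋃ i, range (invLoop (f i) b) with hK
  have hKmem : ∀ w, w ∈ K ↔ w = 0 ∨ h w ∈ ⋃ i, range (f i) := by
    intro w
    rw [hK, mem_iUnion, mem_iUnion]
    simp only [range_invLoop]
    constructor
    · rintro ⟨i, rfl | ⟨v, hv, rfl⟩⟩
      · exact Or.inl rfl
      · exact Or.inr ⟨i, by simpa [hh] using hv⟩
    · rintro (rfl | ⟨i, hi⟩)
      · exact ⟨Classical.arbitrary ι, mem_insert _ _⟩
      · exact ⟨i, Or.inr ⟨h w, hi, hgh w⟩⟩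
  have hclW : ∀ w ∈ closure W, w ≠ 0 → h w ∈ closure U := fun w hw hw0 => by
    have := mem_closure_image (hhc w hw0) hw
    rwa [hWpre, image_preimage_eq_of_subset] at this
    exact fun z _ => ⟨g z, hhg z⟩
  have hc : ∀ i, Continuous (invLoop (f i) b) := fun i => continuous_invLoop (hf i) (hb i)
  have hdom : ContinuumDomain W K :=
    { isOpen := by
        have h1 : ContinuousOn h {0}ᶜ := fun w hw => (hhc w hw).continuousWithinAt
        have h2 := h1.isOpen_inter_preimage isOpen_compl_singleton hUo
        rw [← hWpre] at h2
        rwa [inter_eq_right.2 hW0] at h2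
      isPreconnected := hUp.image _ fun z hz => (hgc z (hUb z hz)).continuousWithinAt
      isBounded := by
        obtain ⟨r, hr, hrU⟩ := Metric.isOpen_iff.1 isClosed_closure.isOpen_compl b hbU
        refine Metric.isBounded_closedBall (x := (0:ℂ)) (r := r⁻¹) |>.subset ?_
        rintro _ ⟨z, hz, rfl⟩
        rw [mem_closedBall_zero_iff, hg, norm_inv]
        refine inv_anti₀ hr ?_
        by_contra hlt
        exact hrU (show z ∈ Metric.ball b r by rw [Metric.mem_ball, dist_eq_norm]; exact not_le.1 hlt)
          (subset_closure hz)
      nonempty := ⟨_, mem_image_of_mem _ hxU⟩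
      disjoint := by
        refine Set.disjoint_left.2 fun w hw hwK => ?_
        rcases (hKmem w).1 hwK with h0 | h1
        · exact hW0 hw h0
        · rw [hWpre] at hw
          exact hUO hw h1
      closure_subset := by
        intro w hw
        by_cases hw0 : w = 0
        · exact Or.inr ((hKmem w).2 (Or.inl hw0))
        · have h1 := hclW w hw hw0
          by_cases h2 : h w ∈ U
          · left; rwa [hWpre]
          · exact Or.inr ((hKmem w).2 (Or.inr (hfr _ h1 h2)))
      isCompact := isCompact_iUnion_range_of_periodic hc fun i => periodic_invLoop _ _
      isPreconnected_bdry := bouquet_preconnected hf hb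
      locallyConnected := fun ε hε =>
        locallyConnected_iUnion_range hc (fun i => periodic_invLoop _ _) hε }
  obtain ⟨E, hE, hEf, ⟨Φ⟩⟩ := hdom.exists_homeomorph (p := 0) ((hKmem 0).2 (Or.inl rfl))
    (fun w hw hw0 => bouquet_diff_singleton hf hb hinj hdisj hw hw0)
    (fun i => isPreconnected_Ioo.image _ (hc i).continuousOn) (bouquet_diff_zero hb)
  refine ⟨E, hE, hEf, ⟨Φ.trans ?_⟩⟩
  have c1 : Continuous fun w : (closure W \ {0} : Set ℂ) => h w :=
    continuous_iff_continuousAt.2 fun w =>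
      ContinuousAt.comp (f := Subtype.val) (g := h) (hhc w w.2.2) continuousAt_subtype_val
  have c2 : Continuous fun z : closure U => g z :=
    continuous_iff_continuousAt.2 fun z =>
      ContinuousAt.comp (f := Subtype.val) (g := g) (hgc z (hclb z z.2)) continuousAt_subtype_val
  exact
    { toFun := fun w => ⟨h w, hclW w w.2.1 w.2.2⟩
      invFun := fun z => ⟨g z,
        mem_closure_image (hgc z (hclb z z.2)) z.2, hg0 z (hclb z z.2)⟩
      left_inv := fun w => Subtype.ext (hgh w)
      right_inv := fun z => Subtype.ext (hhg z)
      continuous_toFun := c1.subtype_mk _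
      continuous_invFun := c2.subtype_mk _ }

/-- The closure of a connected component of the complement of
a finite family of pairwise disjoint topological lines is homeomorphic to the
closed unit disk minus a finite subset of its boundary circle. -/
theorem end_compactification_of_component
    (ℱ : Set (Set Plane)) (hfin : ℱ.Finite) (hne : ℱ.Nonempty)
    (hline : ∀ L ∈ ℱ, IsTopLine L)
    (hdisj : ℱ.Pairwise Disjoint)
    (x : Plane) (hx : x ∈ (⋃₀ ℱ)ᶜ)
    (U : Set Plane) (hU : U = connectedComponentIn ((⋃₀ ℱ)ᶜ) x) :
    ∃ E : Set Plane, E ⊆ unitCircle ∧ E.Finite ∧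
      Nonempty ((unitDisk \ E : Set Plane) ≃ₜ (closure U : Set Plane)) := by
  classical
  let e : ℂ ≃ₜ Plane := Complex.equivRealProdCLM.toHomeomorph
  have hnorm : ∀ z : ℂ, (e z).1 ^ 2 + (e z).2 ^ 2 = ‖z‖ ^ 2 := fun z => by
    rw [← Complex.normSq_eq_norm_sq, Complex.normSq_apply]
    change z.re ^ 2 + z.im ^ 2 = _
    ring
  choose f _ hfinj hfp hfr using hline
  have : Finite ℱ := hfin
  have : Nonempty ℱ := hne.to_subtype
  let F : ℱ → ℝ → ℂ := fun L => e.symm ∘ f L L.2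
  have hFr : ∀ L : ℱ, range (F L) = e.symm '' (L : Set Plane) := fun L => by
    rw [range_comp, hfr]
  have hFu : (⋃ i, range (F i))ᶜ = e.symm '' (⋃₀ ℱ)ᶜ := by
    rw [image_compl_eq e.symm.bijective, sUnion_eq_iUnion, image_iUnion]
    simp only [hFr]
  obtain ⟨E, hE, hEf, ⟨Φ⟩⟩ := exists_homeomorph_closure_component (f := F) (x := e.symm x)
    (fun i => e.symm.isProperMap.comp (hfp i i.2))
    (fun i => e.symm.injective.comp (hfinj i i.2))
    (fun i j hij => by
      rw [hFr, hFr]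
      exact (disjoint_image_iff e.symm.injective).2
        (hdisj i.2 j.2 fun h => hij (Subtype.ext h)))
    (by rw [hFu]; exact mem_image_of_mem _ hx)
  have hU' : closure (connectedComponentIn (⋃ i, range (F i))ᶜ (e.symm x)) =
      e.symm '' closure U := by
    rw [hFu, ← e.symm.image_connectedComponentIn hx, ← hU, e.symm.image_closure]
  have hdisk : e '' (Metric.closedBall 0 1 \ E) = unitDisk \ e '' E := by
    rw [image_sdiff e.injective]
    congr 1
    ext p
    obtain ⟨z, rfl⟩ := e.surjective p
    rw [e.injective.mem_set_image, mem_closedBall_zero_iff]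
    change _ ↔ (e z).1 ^ 2 + (e z).2 ^ 2 ≤ 1
    rw [hnorm, sq_le_one_iff₀ (norm_nonneg z)]
  refine ⟨e '' E, ?_, hEf.image _, ⟨?_⟩⟩
  · rintro _ ⟨z, hz, rfl⟩
    change (e z).1 ^ 2 + (e z).2 ^ 2 = 1
    rw [hnorm, mem_sphere_zero_iff_norm.1 (hE hz), one_pow]
  · exact (Homeomorph.setCongr hdisk.symm).trans <| (e.image _).symm.trans <|
      Φ.trans <| (Homeomorph.setCongr hU').trans (e.symm.image _).symm
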